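/- (Eccentricity growth dichotomy.) Let δ̄ > 0 and let (u, v) ∈ S(δ̄). There is a constant C₁, depending only on δ̄, with the following property: for every sufficiently large M there exist constants η₀ (large) and h₀ > 0 (small), depending on M and on the pair (u, v), such that for every h < h₀, either η_u(h) ≤ η₀ or η_u(h/M) ≤ C₁ · η_u(h). -/

import Mathlib

noncomputable section

open MeasureTheory Metric Set
open scoped RealInnerProductSpace

abbrev R2 : Type := EuclideanSpace ℝ (Fin 2)

/-- `p` is a subgradient of `f` at `x`. -/
def SubgradAt (f : R2 → ℝ) (x p : R2) : Prop :=
  ∀ y : R2, f x + ⟪p, y - x⟫ ≤ f y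

/-- `ψ` is a (canonically extended) potential of the optimal transport between `U₁` and `U₂`:
it is convex on `ℝ²`, all its subgradients lie in `closure U₂`, and its gradient map pushes
the Lebesgue measure restricted to `U₁` forward to the Lebesgue measure restricted to `U₂`. -/
def IsOTPotential (U₁ U₂ : Set R2) (ψ : R2 → ℝ) : Prop :=
  ConvexOn ℝ Set.univ ψ ∧
  (∀ x p : R2, SubgradAt ψ x p → p ∈ closure U₂) ∧
  MeasureTheory.Measure.map (fun x => gradient ψ x) (MeasureTheory.volume.restrict U₁) =
    MeasureTheory.volume.restrict U₂

/-- `S` is a centred section of `w` at `x₀` of height `h`: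
`S = {w < w x₀ + p · (· - x₀) + h}` for a slope `p` chosen so that
the centre of mass of `S` is `x₀`. -/
def IsCentredSection (w : R2 → ℝ) (x₀ : R2) (h : ℝ) (S : Set R2) : Prop :=
  ∃ p : R2, S = {x : R2 | w x < w x₀ + ⟪p, x - x₀⟫ + h} ∧
    (∫ x in S, (x - x₀) ∂(MeasureTheory.volume)) = 0

/-- Dilation of `S` about `x₀` by factor `t`. -/
def dilate (x₀ : R2) (t : ℝ) (S : Set R2) : Set R2 :=
  (fun x => x₀ + t • (x - x₀)) '' S

/-- The (closed) ellipse centred at `0` with half-axis `A` in unit direction `e` and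
half-axis `B` in the orthogonal unit direction `f`. -/
def ellipse (e f : R2) (A B : ℝ) : Set R2 :=
  {x : R2 | (⟪x, e⟫ / A) ^ 2 + (⟪x, f⟫ / B) ^ 2 ≤ 1}

/-- `w` is an Alexandrov solution of `det D² w = χ_Ω` in `ℝ²`: the Lebesgue measure of the
subdifferential image of any Borel set `E` equals the Lebesgue measure of `E ∩ Ω`. -/
def AlexandrovSol (w : R2 → ℝ) (Ω : Set R2) : Prop :=
  ∀ E : Set R2, MeasurableSet E →
    MeasureTheory.volume (⋃ x ∈ E, {p : R2 | SubgradAt w x p}) =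
      MeasureTheory.volume (E ∩ Ω)

/-- Membership of the pair `(u, v)` in the normalized family `S(δ̄)`, together with the
associated data: the domains `Ω₁, Ω₂`, and, for each height `h ∈ (0,1]`, the ellipse
`E_h = ellipse (e h) (f h) (L h) (l h)` centred at `0` (long half-axis `L h` in unit
direction `e h`, short half-axis `l h` in the orthogonal unit direction `f h`, area `hπ`,
so `L h * l h = h`), whose perpendicular ellipse is
`E_h^⊥ = ellipse (f h) (e h) (L h) (l h)`.  The eccentricity is `η_u(h) = L h / l h`. -/
def InSFamily (δb : ℝ) (u v : R2 → ℝ) (Ω₁ Ω₂ : Set R2)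
    (L l : ℝ → ℝ) (e f : ℝ → R2) : Prop :=
  ConvexOn ℝ Set.univ u ∧ ConvexOn ℝ Set.univ v ∧
  Convex ℝ Ω₁ ∧ Convex ℝ Ω₂ ∧
  (interior Ω₁).Nonempty ∧ (interior Ω₂).Nonempty ∧
  (0 : R2) ∈ frontier Ω₁ ∧ (0 : R2) ∈ frontier Ω₂ ∧
  (fun x => gradient u x) '' Ω₁ = Ω₂ ∧ (fun y => gradient v y) '' Ω₂ = Ω₁ ∧
  AlexandrovSol u Ω₁ ∧ u 0 = 0 ∧ SubgradAt u 0 0 ∧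
  AlexandrovSol v Ω₂ ∧ v 0 = 0 ∧ SubgradAt v 0 0 ∧
  (∀ y ∈ Ω₂, v y = ⨆ x : R2, (⟪x, y⟫ - u x)) ∧
  L 1 = 1 ∧ l 1 = 1 ∧
  (∀ h : ℝ, h ∈ Set.Ioc (0 : ℝ) 1 →
    ‖e h‖ = 1 ∧ ‖f h‖ = 1 ∧ ⟪e h, f h⟫ = 0 ∧
    0 < l h ∧ l h ≤ L h ∧ L h * l h = h ∧
    (∃ S : Set R2, IsCentredSection u 0 h S ∧
      (∃ xh : R2, (fun z => xh + δb • z) '' ellipse (e h) (f h) (L h) (l h) ⊆ Ω₁ ∩ S) ∧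
      S ⊆ (fun z => δb⁻¹ • z) '' ellipse (e h) (f h) (L h) (l h)) ∧
    (∃ S : Set R2, IsCentredSection v 0 h S ∧
      (∃ yh : R2, (fun z => yh + δb • z) '' ellipse (f h) (e h) (L h) (l h) ⊆ Ω₂ ∩ S) ∧
      S ⊆ (fun z => δb⁻¹ • z) '' ellipse (f h) (e h) (L h) (l h)))

/-- `z ↦ t • x` cone over `Ω` with vertex `0` (closed): the tangent cone of `Ω` at `0`. -/
def tangentConeZero (Ω : Set R2) : Set R2 :=
  closure {y : R2 | ∃ t : ℝ, 0 ≤ t ∧ ∃ x ∈ Ω, y = t • x}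

/-- The planar cross product (determinant) of two vectors. -/
def det2 (a b : R2) : ℝ := a 0 * b 1 - a 1 * b 0

/-- `r` is the unit direction of the right tangent ray of `∂Ω` at `0`:
it lies in the tangent cone of `Ω` at `0` and the whole tangent cone lies
(weakly) counterclockwise from it. -/
def IsRightTangent (Ω : Set R2) (r : R2) : Prop :=
  ‖r‖ = 1 ∧ r ∈ tangentConeZero Ω ∧ ∀ x ∈ tangentConeZero Ω, 0 ≤ det2 r x

/-- `l` is the unit direction of the left tangent ray of `∂Ω` at `0`:
it lies in the tangent cone of `Ω` at `0` and the whole tangent cone lies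
(weakly) clockwise from it. -/
def IsLeftTangent (Ω : Set R2) (l : R2) : Prop :=
  ‖l‖ = 1 ∧ l ∈ tangentConeZero Ω ∧ ∀ x ∈ tangentConeZero Ω, det2 l x ≤ 0

/-- The open cone of direction `e` and opening angle `θ`. -/
def cone2 (e : R2) (θ : ℝ) : Set R2 :=
  {y : R2 | ∃ lam : ℝ, 0 < lam ∧ ∃ w : R2, ‖w‖ = 1 ∧
    InnerProductGeometry.angle w e < θ ∧ y = lam • w}

section

open Filter Topology
open scoped RealInnerProductSpace

/-! ### Subgradients of convex functions -/

lemma exists_subgradAt_inner_eq {u : R2 → ℝ} (hu : ConvexOn ℝ univ u) {x₀ j : R2} {t : ℝ}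
    (ht : ∀ r : ℝ, u x₀ + t * r ≤ u (x₀ + r • j)) : ∃ y, SubgradAt u x₀ y ∧ ⟪y, j⟫ = t := by
  have hcont : Continuous u := hu.locallyLipschitz.continuous
  have hA : Convex ℝ {p : R2 × ℝ | u p.1 < p.2} := by
    have := hu.convex_strict_epigraph
    simpa using this
  have hAo : IsOpen {p : R2 × ℝ | u p.1 < p.2} :=
    isOpen_lt (hcont.comp continuous_fst) continuous_snd
  have hB : Convex ℝ (range fun r : ℝ => ((x₀ + r • j, u x₀ + t * r) : R2 × ℝ)) := by
    rintro _ ⟨a, rfl⟩ _ ⟨b, rfl⟩ α β _ _ hab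
    refine ⟨α * a + β * b, ?_⟩
    obtain rfl : β = 1 - α := by linarith
    ext1
    · simp only [Prod.fst_add, Prod.smul_fst]; module
    · simp only [Prod.snd_add, Prod.smul_snd, smul_eq_mul]; ring
  have hdis : Disjoint {p : R2 × ℝ | u p.1 < p.2}
      (range fun r : ℝ => ((x₀ + r • j, u x₀ + t * r) : R2 × ℝ)) := by
    rw [Set.disjoint_left]
    rintro _ h ⟨r, rfl⟩
    exact absurd h (not_lt.2 (ht r))
  obtain ⟨F, s, hFA, hFB⟩ := geometric_hahn_banach_open hA hAo hB hdis
  set φ : R2 →L[ℝ] ℝ := F.comp (ContinuousLinearMap.inl ℝ R2 ℝ) with hφ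
  set k : ℝ := F (0, 1) with hk
  have hF : ∀ (x : R2) (r : ℝ), F (x, r) = φ x + r * k := by
    intro x r
    have : ((x, r) : R2 × ℝ) = (x, 0) + r • (0, 1) := by ext1 <;> simp
    rw [this, map_add, map_smul]
    simp [hφ, hk]
  have hline : ∀ r : ℝ, s ≤ φ x₀ + u x₀ * k + r * (φ j + t * k) := by
    intro r
    have := hFB _ ⟨r, rfl⟩
    simp only [hF, map_add, map_smul, smul_eq_mul] at this
    linarith
  have hj : φ j + t * k = 0 := by
    by_contra hne
    have := hline ((s - 1 - (φ x₀ + u x₀ * k)) / (φ j + t * k))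
    rw [div_mul_cancel₀ _ hne] at this
    linarith
  have h0 := hline 0
  have hk0 : k < 0 := by
    have := hFA (x₀, u x₀ + 1) (by simp)
    rw [hF] at this
    linarith
  refine ⟨(-k)⁻¹ • (InnerProductSpace.toDual ℝ R2).symm φ, ?_, ?_⟩
  · intro z
    rw [real_inner_smul_left, InnerProductSpace.toDual_symm_apply, map_sub]
    have hle : φ z - φ x₀ ≤ (-k) * (u z - u x₀) := by
      refine le_of_forall_pos_le_add fun ε hε => ?_
      have := hFA (z, u z + ε / (-k)) (by
        have : 0 < ε / (-k) := div_pos hε (by linarith)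
        simpa using this)
      have hk1 := hk0.ne
      rw [hF, add_mul, show ε / -k * k = -ε by field_simp] at this
      linarith
    have : (-k)⁻¹ * (φ z - φ x₀) ≤ u z - u x₀ := by
      rw [inv_mul_le_iff₀ (by linarith)]; exact hle
    linarith
  · rw [real_inner_smul_left, InnerProductSpace.toDual_symm_apply]
    have : φ j = -k * t := by linarith
    have hk1 := hk0.ne
    rw [this]
    field_simp

lemma exists_subgradAt {u : R2 → ℝ} (hu : ConvexOn ℝ univ u) (x : R2) :
    ∃ y, SubgradAt u x y := by
  obtain ⟨y, hy, -⟩ := exists_subgradAt_inner_eq hu (x₀ := x) (j := 0) (t := 0) (by simp)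
  exact ⟨y, hy⟩

lemma SubgradAt.inner_sub_nonneg {u : R2 → ℝ} {x y x' y' : R2} (h : SubgradAt u x y)
    (h' : SubgradAt u x' y') : 0 ≤ ⟪x - x', y - y'⟫ := by
  have h1 := h x'
  have h2 := h' x
  rw [inner_sub_right] at h1 h2
  rw [inner_sub_left, inner_sub_right, inner_sub_right]
  rw [real_inner_comm x' y, real_inner_comm x y] at h1
  rw [real_inner_comm x' y', real_inner_comm x y'] at h2
  linarith

lemma SubgradAt.eq_of_hasGradientAt {u : R2 → ℝ} {x p g : R2} (h : SubgradAt u x p)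
    (hg : HasGradientAt u g x) : p = g := by
  have hmin : IsLocalMin (fun z => u z - ⟪p, z⟫) x := by
    refine Filter.Eventually.of_forall fun z => ?_
    have := h z
    rw [inner_sub_right] at this
    simp only
    linarith
  have hd : HasFDerivAt (fun z => u z - ⟪p, z⟫)
      (InnerProductSpace.toDual ℝ R2 g - InnerProductSpace.toDual ℝ R2 p) x :=
    hg.hasFDerivAt.sub (InnerProductSpace.toDual ℝ R2 p).hasFDerivAt
  have h0 := hmin.hasFDerivAt_eq_zero hd
  rw [← map_sub, LinearIsometryEquiv.map_eq_zero_iff, sub_eq_zero] at h0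
  exact h0.symm

lemma subgradAt_of_hasGradientAt {u : R2 → ℝ} (hu : ConvexOn ℝ univ u) {x g : R2}
    (hg : HasGradientAt u g x) : SubgradAt u x g := by
  obtain ⟨y, hy⟩ := exists_subgradAt hu x
  exact hy.eq_of_hasGradientAt hg ▸ hy

lemma ConvexOn.lineMap_le {u : R2 → ℝ} (hu : ConvexOn ℝ univ u) (x z : R2) {t : ℝ} (h0 : 0 ≤ t)
    (h1 : t ≤ 1) : u (x + t • (z - x)) ≤ (1 - t) * u x + t * u z := by
  have h2 := hu.2 (mem_univ x) (mem_univ z) (sub_nonneg.2 h1) h0 (by ring)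
  rw [show (1 - t) • x + t • z = x + t • (z - x) by module] at h2
  simpa using h2

/-- A subgradient inequality near a point is global. -/
lemma subgradAt_of_mem_nhds {u : R2 → ℝ} (hu : ConvexOn ℝ univ u) {x p : R2} {s : Set R2}
    (hs : s ∈ 𝓝 x) (h : ∀ z ∈ s, u x + ⟪p, z - x⟫ ≤ u z) : SubgradAt u x p := by
  intro z
  have hc : Tendsto (fun t : ℝ => x + t • (z - x)) (𝓝[>] 0) (𝓝 x) := by
    have : Continuous fun t : ℝ => x + t • (z - x) := by fun_prop
    have := this.tendsto 0
    simp only [zero_smul, add_zero] at this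
    exact this.mono_left nhdsWithin_le_nhds
  have hev : ∀ᶠ t : ℝ in 𝓝[>] 0, x + t • (z - x) ∈ s ∧ t < 1 ∧ 0 < t := by
    refine (hc.eventually_mem hs).and (Filter.Eventually.and ?_ self_mem_nhdsWithin)
    exact nhdsWithin_le_nhds (Iio_mem_nhds one_pos)
  obtain ⟨t, hts, ht1, ht0⟩ := hev.exists
  have h1 := h _ hts
  have h2 := hu.lineMap_le x z ht0.le ht1.le
  rw [add_sub_cancel_left, real_inner_smul_right] at h1
  have : t * (u x + ⟪p, z - x⟫) ≤ t * u z := by linarith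
  exact le_of_mul_le_mul_left this ht0

lemma ae_differentiableAt_of_convexOn {u : R2 → ℝ} (hu : ConvexOn ℝ univ u) :
    volume {x | ¬ DifferentiableAt ℝ u x} = 0 := by
  refine measure_null_of_locally_null _ fun x _ => ?_
  obtain ⟨K, t, ht, hK⟩ := hu.locallyLipschitz x
  have hi : interior t ∈ 𝓝 x := interior_mem_nhds.2 ht
  refine ⟨_, inter_mem_nhdsWithin _ hi, ?_⟩
  have hae := (hK.mono interior_subset).ae_differentiableWithinAt_of_mem (μ := volume)
  rw [ae_iff] at hae
  refine measure_mono_null (fun z hz => ?_) hae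
  simp only [mem_ofPred_eq, Classical.not_imp]
  exact ⟨hz.2, fun hd => hz.1 (hd.differentiableAt (isOpen_interior.mem_nhds hz.2))⟩

/-- A slope in an open set of slopes supporting `u` from below at infinity is attained. -/
lemma exists_subgradAt_of_isOpen {u : R2 → ℝ} (hu : ConvexOn ℝ univ u) {V : Set R2}
    (hV : IsOpen V) (hb : ∀ q ∈ V, ∃ c : ℝ, ∀ z, c ≤ u z - ⟪q, z⟫) {q : R2} (hq : q ∈ V) :
    ∃ x, SubgradAt u x q := by
  have hcont : Continuous u := hu.locallyLipschitz.continuous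
  obtain ⟨ε, hε, hball⟩ := Metric.isOpen_iff.1 hV q hq
  have key : ∀ w : R2, ‖w‖ = 1 → ∃ c : ℝ, ∀ z, c + ε / 2 * ⟪w, z⟫ ≤ u z - ⟪q, z⟫ := by
    intro w hw
    obtain ⟨c, hc⟩ := hb (q + (ε / 2) • w) (hball (by
      rw [mem_ball, dist_eq_norm, add_sub_cancel_left, norm_smul, hw, mul_one, Real.norm_eq_abs,
        abs_of_pos (by positivity)]
      linarith))
    refine ⟨c, fun z => ?_⟩
    have := hc z
    rw [inner_add_left, real_inner_smul_left] at this
    linarith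
  obtain ⟨c₁, h₁⟩ := key !₂[1, 0] (by simp [EuclideanSpace.norm_eq])
  obtain ⟨c₂, h₂⟩ := key !₂[-1, 0] (by simp [EuclideanSpace.norm_eq])
  obtain ⟨c₃, h₃⟩ := key !₂[0, 1] (by simp [EuclideanSpace.norm_eq])
  obtain ⟨c₄, h₄⟩ := key !₂[0, -1] (by simp [EuclideanSpace.norm_eq])
  set c := min (min c₁ c₂) (min c₃ c₄) with hcdef
  have hc1 : c ≤ c₁ := (min_le_left _ _).trans (min_le_left _ _)
  have hc2 : c ≤ c₂ := (min_le_left _ _).trans (min_le_right _ _)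
  have hc3 : c ≤ c₃ := (min_le_right _ _).trans (min_le_left _ _)
  have hc4 : c ≤ c₄ := (min_le_right _ _).trans (min_le_right _ _)
  have hlow : ∀ z, c + ε / 4 * ‖z‖ ≤ u z - ⟪q, z⟫ := by
    intro z
    have g₁ := h₁ z
    have g₂ := h₂ z
    have g₃ := h₃ z
    have g₄ := h₄ z
    simp [PiLp.inner_apply, Fin.sum_univ_two] at g₁ g₂ g₃ g₄
    have hn : ‖z‖ ≤ |z 0| + |z 1| := by
      rw [EuclideanSpace.norm_eq, Fin.sum_univ_two]
      refine Real.sqrt_le_iff.2 ⟨by positivity, ?_⟩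
      simp only [Real.norm_eq_abs]
      nlinarith [abs_nonneg (z 0), abs_nonneg (z 1)]
    have q1 : c + ε / 2 * |z 0| ≤ u z - ⟪q, z⟫ := by
      rcases abs_cases (z 0) with ⟨h, -⟩ | ⟨h, -⟩ <;> rw [h] <;>
        simp [PiLp.inner_apply, Fin.sum_univ_two] <;> linarith
    have q2 : c + ε / 2 * |z 1| ≤ u z - ⟪q, z⟫ := by
      rcases abs_cases (z 1) with ⟨h, -⟩ | ⟨h, -⟩ <;> rw [h] <;>
        simp [PiLp.inner_apply, Fin.sum_univ_two] <;> linarith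
    nlinarith
  have htend : Tendsto (fun z => u z - ⟪q, z⟫) (cocompact R2) atTop := by
    refine tendsto_atTop_mono hlow ?_
    refine tendsto_atTop_add_const_left _ _ ?_
    exact (tendsto_norm_cocompact_atTop (E := R2)).const_mul_atTop (by positivity)
  obtain ⟨x, hx⟩ := Continuous.exists_forall_le (f := fun z => u z - ⟪q, z⟫) (by fun_prop) htend
  refine ⟨x, fun z => ?_⟩
  have := hx z
  rw [inner_sub_right]
  linarith

/-! ### Regularity of the transport map -/

lemma exists_inner_lt_of_notMem {O : Set R2} (hO : Convex ℝ O) (ho : IsOpen O) {x : R2}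
    (hx : x ∉ O) : ∃ n : R2, ∀ z ∈ O, ⟪n, x⟫ < ⟪n, z⟫ := by
  obtain ⟨F, hF⟩ := geometric_hahn_banach_point_open hO ho hx
  exact ⟨(InnerProductSpace.toDual ℝ R2).symm F, fun z hz => by
    simpa [InnerProductSpace.toDual_symm_apply] using hF z hz⟩

lemma subgradAt_mem_closure {u : R2 → ℝ} {Ω₁ Ω₂ : Set R2} (hu : ConvexOn ℝ univ u)
    (h₁ : Convex ℝ Ω₁) (hi : (interior Ω₂).Nonempty)
    (hgrad : (fun x => gradient u x) '' Ω₁ = Ω₂) (hA : AlexandrovSol u Ω₁)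
    (h0 : SubgradAt u 0 0) {x p : R2} (hp : SubgradAt u x p) : p ∈ closure Ω₂ := by
  by_contra hpc
  set K : Set R2 := {q | ∃ c : ℝ, ∀ z, c ≤ u z - ⟪q, z⟫} with hK
  have hsub : ∀ {x q : R2}, SubgradAt u x q → q ∈ K := by
    intro x q h
    refine ⟨u x - ⟪q, x⟫, fun z => ?_⟩
    have := h z
    rw [inner_sub_right] at this
    linarith
  have hKΩ : Ω₂ ⊆ K := by
    rw [← hgrad]
    rintro _ ⟨z, -, rfl⟩
    by_cases hd : DifferentiableAt ℝ u z
    · exact hsub (subgradAt_of_hasGradientAt hu hd.hasGradientAt)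
    · simp only [gradient_eq_zero_of_not_differentiableAt hd]
      exact hsub h0
  have hKc : Convex ℝ K := by
    rintro a ⟨c, hc⟩ b ⟨d, hd⟩ s t hs ht hst
    refine ⟨s * c + t * d, fun z => ?_⟩
    rw [inner_add_left, real_inner_smul_left, real_inner_smul_left]
    obtain rfl : t = 1 - s := by linarith
    nlinarith [mul_le_mul_of_nonneg_left (hc z) hs, mul_le_mul_of_nonneg_left (hd z) ht]
  obtain ⟨y₀, hy₀⟩ := hi
  have hyK : y₀ ∈ interior K := interior_mono hKΩ hy₀
  have hev : ∀ᶠ t : ℝ in 𝓝[>] 0, p + t • (y₀ - p) ∈ (closure Ω₂)ᶜ ∧ t < 1 ∧ 0 < t := by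
    have hc : Tendsto (fun t : ℝ => p + t • (y₀ - p)) (𝓝[>] 0) (𝓝 p) := by
      have : Continuous fun t : ℝ => p + t • (y₀ - p) := by fun_prop
      have := this.tendsto 0
      simp only [zero_smul, add_zero] at this
      exact this.mono_left nhdsWithin_le_nhds
    refine (hc.eventually_mem (isClosed_closure.isOpen_compl.mem_nhds hpc)).and
      (Filter.Eventually.and ?_ self_mem_nhdsWithin)
    exact nhdsWithin_le_nhds (Iio_mem_nhds one_pos)
  obtain ⟨t, htc, ht1, ht0⟩ := hev.exists
  have hti : p + t • (y₀ - p) ∈ interior K := by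
    have := hKc.combo_interior_self_mem_interior hyK (hsub hp) ht0 (sub_nonneg.2 ht1.le)
      (by ring : t + (1 - t) = 1)
    convert this using 1
    module
  set V := interior K ∩ (closure Ω₂)ᶜ with hV
  have hVo : IsOpen V := isOpen_interior.inter isClosed_closure.isOpen_compl
  have hVn : V.Nonempty := ⟨_, hti, htc⟩
  set E : Set R2 := ({z | DifferentiableAt ℝ u z}ᶜ ∪ (closure Ω₁)ᶜ) ∪ frontier Ω₁ with hE
  have hEm : MeasurableSet E :=
    ((measurableSet_of_differentiableAt ℝ u).compl.union
      isClosed_closure.measurableSet.compl).union isClosed_frontier.measurableSet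
  have hVE : V ⊆ ⋃ x ∈ E, {p : R2 | SubgradAt u x p} := by
    intro q hq
    obtain ⟨z, hz⟩ := exists_subgradAt_of_isOpen hu hVo (fun q hq => (interior_subset hq.1 : q ∈ K)) hq
    refine mem_biUnion (x := z) ?_ hz
    by_contra hzE
    simp only [hE, mem_union, mem_compl_iff, not_or, not_not] at hzE
    obtain ⟨⟨hd, hcl⟩, hfr⟩ := hzE
    have hzi : z ∈ interior Ω₁ := by
      by_contra hn
      exact hfr ⟨hcl, hn⟩
    refine hq.2 (subset_closure ?_)
    rw [← hgrad, hz.eq_of_hasGradientAt hd.hasGradientAt]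
    exact ⟨z, interior_subset hzi, rfl⟩
  have hnull : volume (E ∩ Ω₁) = 0 := by
    refine measure_mono_null (t := {z | ¬ DifferentiableAt ℝ u z} ∪ frontier Ω₁) ?_
      (measure_union_null (ae_differentiableAt_of_convexOn hu) (h₁.addHaar_frontier _))
    rintro z ⟨(h | h) | h, hz⟩
    · exact Or.inl h
    · exact absurd (subset_closure hz) h
    · exact Or.inr h
  rw [← hA E hEm] at hnull
  exact (hVo.measure_pos volume hVn).ne' (measure_mono_null hVE hnull)

/-- If `y` minimises `⟪μ, ·⟫` among all possible slopes, then `y` remains a subgradient along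
the half-line of direction `-μ`. -/
lemma SubgradAt.sub_smul {u : R2 → ℝ} {O : Set R2} (hu : ConvexOn ℝ univ u)
    (hcl : ∀ x p, SubgradAt u x p → p ∈ closure O) {x y μ : R2} (h : SubgradAt u x y)
    (hμ : ∀ z ∈ O, ⟪μ, y⟫ ≤ ⟪μ, z⟫) {τ : ℝ} (hτ : 0 ≤ τ) : SubgradAt u (x - τ • μ) y := by
  obtain ⟨p, hp⟩ := exists_subgradAt hu (x - τ • μ)
  have hpO : ⟪μ, y⟫ ≤ ⟪μ, p⟫ := by
    have hclosed : IsClosed {z : R2 | ⟪μ, y⟫ ≤ ⟪μ, z⟫} :=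
      isClosed_le continuous_const (by fun_prop)
    exact closure_minimal hμ hclosed (hcl _ _ hp)
  intro z
  have h1 := hp x
  have h2 := h z
  rw [sub_sub_cancel, real_inner_smul_right, real_inner_comm] at h1
  rw [sub_sub_eq_add_sub, add_sub_right_comm, inner_add_right, real_inner_smul_right,
    real_inner_comm μ y]
  nlinarith

lemma eq_of_subgradAt_smul {u : R2 → ℝ} {x x' y : R2} (h : SubgradAt u x y)
    (h' : SubgradAt u x' y) {t : ℝ} (h0 : 0 ≤ t) (h1 : t ≤ 1) (hu : ConvexOn ℝ univ u) :
    SubgradAt u (x + t • (x' - x)) y := by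
  intro z
  have e1 := h z
  have e2 := h' z
  have := hu.lineMap_le x x' h0 h1
  have e : ⟪y, z - (x + t • (x' - x))⟫ = (1 - t) * ⟪y, z - x⟫ + t * ⟪y, z - x'⟫ := by
    simp only [inner_sub_right, inner_add_right, real_inner_smul_right]; ring
  rw [e]
  nlinarith [mul_le_mul_of_nonneg_left e1 (sub_nonneg.2 h1), mul_le_mul_of_nonneg_left e2 h0]

/-- Data of a pair of potentials, with the (open) domains and the axes of the ellipses. -/
structure Dat where
  u : R2 → ℝ
  v : R2 → ℝ
  O₁ : Set R2
  O₂ : Set R2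
  L : ℝ → ℝ
  l : ℝ → ℝ
  e : ℝ → R2
  f : ℝ → R2

/-- The dual pair. -/
@[simps]
def Dat.swap (D : Dat) : Dat := ⟨D.v, D.u, D.O₂, D.O₁, D.L, D.l, D.f, D.e⟩

/-- The gauge of the box with the same axes as the ellipse of height `h`. -/
def Dat.q (D : Dat) (h : ℝ) (x : R2) : ℝ := max (|⟪x, D.e h⟫| / D.L h) (|⟪x, D.f h⟫| / D.l h)

/-- One-sided properties of the potential `D.u`. -/
structure Half (δ : ℝ) (D : Dat) : Prop where
  conv : ConvexOn ℝ univ D.u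
  convex : Convex ℝ D.O₁
  isOpen : IsOpen D.O₁
  nonempty : D.O₁.Nonempty
  zero_notMem : (0 : R2) ∉ D.O₁
  zero_mem : (0 : R2) ∈ closure D.O₁
  u_zero : D.u 0 = 0
  u_nonneg : ∀ x, 0 ≤ D.u x
  mem_closure : ∀ x y, SubgradAt D.u x y → y ∈ closure D.O₂
  exists_dual : ∀ x ∈ D.O₁, ∃ y ∈ D.O₂, SubgradAt D.u x y ∧ SubgradAt D.v y x
  unique : ∀ x ∈ D.O₁, ∀ y y', SubgradAt D.u x y → SubgradAt D.u x y' → y = y'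
  unique' : ∀ y ∈ D.O₂, ∀ x x', SubgradAt D.u x y → SubgradAt D.u x' y → x = x'
  volume_image : ∀ E ⊆ D.O₁, MeasurableSet E →
    volume (⋃ x ∈ E, {p : R2 | SubgradAt D.u x p}) = volume E
  sect : ∀ h ∈ Ioc (0 : ℝ) 1, ∃ p xh : R2,
    (∫ x in {x | D.u x < ⟪p, x⟫ + h}, x) = 0 ∧
    (∀ z, D.q h z ≤ δ / 2 → xh + z ∈ D.O₁ ∧ D.u (xh + z) < ⟪p, xh + z⟫ + h) ∧
    (∀ x, D.u x < ⟪p, x⟫ + h → D.q h x ≤ 1 / δ)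

/-- The symmetric list of properties of a pair in the family. -/
structure Core (δ : ℝ) (D : Dat) : Prop where
  δ_pos : 0 < δ
  δ_le : δ ≤ 1
  half : Half δ D
  half' : Half δ D.swap
  axes : ∀ h ∈ Ioc (0 : ℝ) 1, ‖D.e h‖ = 1 ∧ ‖D.f h‖ = 1 ∧ ⟪D.e h, D.f h⟫ = 0 ∧
    0 < D.l h ∧ D.l h ≤ D.L h ∧ D.L h * D.l h = h

lemma Core.swap {δ : ℝ} {D : Dat} (H : Core δ D) : Core δ D.swap where
  δ_pos := H.δ_pos
  δ_le := H.δ_le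
  half := H.half'
  half' := H.half
  axes h hh := by
    obtain ⟨a, b, c, d⟩ := H.axes h hh
    exact ⟨b, a, by rw [real_inner_comm]; exact c, d⟩

lemma hasGradientAt_of_gradient_ne {u : R2 → ℝ} {x y : R2} (h : gradient u x = y) (hy : y ≠ 0) :
    HasGradientAt u y x := by
  by_cases hd : DifferentiableAt ℝ u x
  · exact h ▸ hd.hasGradientAt
  · exact absurd (h ▸ gradient_eq_zero_of_not_differentiableAt hd) hy

section Regularity

variable {u v : R2 → ℝ} {Ω₁ Ω₂ : Set R2}

lemma bddAbove_inner_sub (hu : ConvexOn ℝ univ u)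
    (hgrad : (fun x => gradient u x) '' Ω₁ = Ω₂) (h0 : SubgradAt u 0 0) {y : R2} (hy : y ∈ Ω₂) :
    BddAbove (range fun x : R2 => ⟪x, y⟫ - u x) := by
  rw [← hgrad] at hy
  obtain ⟨x, -, rfl⟩ := hy
  have hsub : ∃ x', SubgradAt u x' (gradient u x) := by
    by_cases hd : DifferentiableAt ℝ u x
    · exact ⟨x, subgradAt_of_hasGradientAt hu hd.hasGradientAt⟩
    · exact ⟨0, by rw [gradient_eq_zero_of_not_differentiableAt hd]; exact h0⟩
  obtain ⟨x', hx'⟩ := hsub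
  refine ⟨⟪x', gradient u x⟫ - u x', ?_⟩
  rintro _ ⟨z, rfl⟩
  have := hx' z
  rw [inner_sub_right, real_inner_comm z, real_inner_comm x'] at this
  simp only
  linarith

variable (hu : ConvexOn ℝ univ u) (hv : ConvexOn ℝ univ v)
  (h₁ : Convex ℝ Ω₁) (h₂ : Convex ℝ Ω₂)
  (hi₂ : (interior Ω₂).Nonempty)
  (hle : ∀ y ∈ Ω₂, ∀ z, ⟪z, y⟫ - u z ≤ v y)
  (hsup : ∀ y ∈ Ω₂, ∀ c, (∀ z, ⟪z, y⟫ - u z ≤ c) → v y ≤ c)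
  (hclu : ∀ x p, SubgradAt u x p → p ∈ closure (interior Ω₂))
  (hclv : ∀ x p, SubgradAt v x p → p ∈ closure (interior Ω₁))

include hsup in
lemma legendre_eq {x y : R2} (hy : y ∈ Ω₂) (h : SubgradAt u x y) : v y ≤ ⟪x, y⟫ - u x := by
  refine hsup y hy _ fun z => ?_
  have := h z
  rw [inner_sub_right, real_inner_comm z, real_inner_comm x] at this
  linarith

include hv hle hsup in
lemma subgradAt_dual {x y : R2} (hy : y ∈ interior Ω₂) (h : SubgradAt u x y) :
    SubgradAt v y x := by
  refine subgradAt_of_mem_nhds hv (isOpen_interior.mem_nhds hy) fun z hz => ?_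
  have h1 := legendre_eq hsup (interior_subset hy) h
  have h2 := hle z (interior_subset hz) x
  rw [inner_sub_right]
  linarith

include hu h₂ hi₂ hle hsup hclu in
lemma subgradAt_of_dual {x y : R2} (hy : y ∈ Ω₂) (h : SubgradAt v y x) : SubgradAt u x y := by
  obtain ⟨q, hq⟩ := exists_subgradAt hu x
  obtain ⟨y₀, hy₀⟩ := hi₂
  have hkey : v y ≤ ⟪x, y⟫ - u x := by
    have hall : ∀ t : ℝ, 0 < t → t < 1 →
        v y + ⟪x, q + t • (y₀ - q) - y⟫ ≤ (1 - t) * (⟪x, q⟫ - u x) + t * v y₀ := by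
      intro t h0 h1
      have hmem : q + t • (y₀ - q) ∈ interior Ω₂ := by
        have hq' : q ∈ closure Ω₂ := closure_mono interior_subset (hclu _ _ hq)
        have := h₂.combo_interior_closure_mem_interior hy₀ hq' h0 (sub_nonneg.2 h1.le)
          (by ring : t + (1 - t) = 1)
        convert this using 1
        module
      refine (h _).trans (hsup _ (interior_subset hmem) _ fun z => ?_)
      have e1 := hq z
      have e2 := hle y₀ (interior_subset hy₀) z
      rw [inner_sub_right, real_inner_comm z, real_inner_comm x] at e1
      rw [inner_add_right, real_inner_smul_right, inner_sub_right]
      nlinarith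
    have hlim : v y + ⟪x, q + (0 : ℝ) • (y₀ - q) - y⟫
        ≤ (1 - 0) * (⟪x, q⟫ - u x) + 0 * v y₀ := by
      have c1 : Continuous fun t : ℝ => v y + ⟪x, q + t • (y₀ - q) - y⟫ := by fun_prop
      have c2 : Continuous fun t : ℝ => (1 - t) * (⟪x, q⟫ - u x) + t * v y₀ := by fun_prop
      refine le_of_tendsto_of_tendsto (b := 𝓝[>] (0 : ℝ))
        ((c1.tendsto 0).mono_left nhdsWithin_le_nhds)
        ((c2.tendsto 0).mono_left nhdsWithin_le_nhds) ?_
      filter_upwards [self_mem_nhdsWithin, nhdsWithin_le_nhds (Iio_mem_nhds one_pos)] with t a b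
      exact hall t a b
    simp only [zero_smul, add_zero, sub_zero, one_mul, zero_mul, inner_sub_right] at hlim
    linarith
  intro z
  have := hle y hy z
  rw [inner_sub_right, real_inner_comm z, real_inner_comm x]
  linarith

include hu hv h₁ h₂ hi₂ hle hsup hclu hclv in
lemma exists_hasGradientAt_of_mem₂ (hgrad : (fun x => gradient u x) '' Ω₁ = Ω₂)
    (h0 : (0 : R2) ∉ interior Ω₂) {y : R2} (hy : y ∈ interior Ω₂) :
    ∃ x ∈ interior Ω₁, HasGradientAt u y x := by
  obtain ⟨x, hx, hxy⟩ : y ∈ (fun x => gradient u x) '' Ω₁ := hgrad ▸ interior_subset hy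
  have hg : HasGradientAt u y x := hasGradientAt_of_gradient_ne hxy (by rintro rfl; exact h0 hy)
  refine ⟨x, ?_, hg⟩
  by_contra hn
  obtain ⟨n, hn⟩ := exists_inner_lt_of_notMem h₁.interior isOpen_interior hn
  have hs := subgradAt_dual hv hle hsup hy (subgradAt_of_hasGradientAt hu hg)
  have hc : Tendsto (fun t : ℝ => y - t • n) (𝓝[>] 0) (𝓝 y) := by
    have : Continuous fun t : ℝ => y - t • n := by fun_prop
    have := this.tendsto 0
    simp only [zero_smul, sub_zero] at this
    exact this.mono_left nhdsWithin_le_nhds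
  obtain ⟨t, ht, ht0⟩ := ((hc.eventually_mem (isOpen_interior.mem_nhds hy)).and
    self_mem_nhdsWithin).exists
  have hs' := hs.sub_smul hv hclv (fun z hz => (hn z hz).le) (le_of_lt ht0)
  have := (subgradAt_of_dual hu h₂ hi₂ hle hsup hclu (interior_subset ht) hs').eq_of_hasGradientAt hg
  rw [sub_eq_self, smul_eq_zero] at this
  rcases this with h | rfl
  · exact (ne_of_gt ht0) h
  · obtain ⟨z, hz⟩ : (interior Ω₁).Nonempty := by
      by_contra hne
      rw [not_nonempty_iff_eq_empty] at hne
      have := hclv _ _ hs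
      simp [hne] at this
    simpa using hn z hz

include hu hv h₂ hi₂ hle hsup hclu in
lemma exists_hasGradientAt_of_mem₁ (hgrad : (fun y => gradient v y) '' Ω₂ = Ω₁)
    (h0 : (0 : R2) ∉ interior Ω₁) {x : R2} (hx : x ∈ interior Ω₁) :
    ∃ y ∈ interior Ω₂, HasGradientAt v x y := by
  have hex : ∀ x ∈ interior Ω₁, ∃ y ∈ Ω₂, HasGradientAt v x y := by
    intro x hx
    obtain ⟨y, hy, hxy⟩ : x ∈ (fun y => gradient v y) '' Ω₂ := hgrad ▸ interior_subset hx
    exact ⟨y, hy, hasGradientAt_of_gradient_ne hxy (by rintro rfl; exact h0 hx)⟩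
  obtain ⟨y, hy, hg⟩ := hex x hx
  refine ⟨y, ?_, hg⟩
  by_contra hn
  obtain ⟨n, hn⟩ := exists_inner_lt_of_notMem h₂.interior isOpen_interior hn
  have hs := subgradAt_of_dual hu h₂ hi₂ hle hsup hclu hy (subgradAt_of_hasGradientAt hv hg)
  have hc : Tendsto (fun t : ℝ => x - t • n) (𝓝[>] 0) (𝓝 x) := by
    have : Continuous fun t : ℝ => x - t • n := by fun_prop
    have := this.tendsto 0
    simp only [zero_smul, sub_zero] at this
    exact this.mono_left nhdsWithin_le_nhds
  obtain ⟨t, ht, ht0⟩ := ((hc.eventually_mem (isOpen_interior.mem_nhds hx)).and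
    self_mem_nhdsWithin).exists
  have ht0 : 0 < t := ht0
  obtain ⟨y', hy', hg'⟩ := hex _ ht
  have hs1 := hs.sub_smul hu hclu (fun z hz => (hn z hz).le) ht0.le
  have hs2 := subgradAt_of_dual hu h₂ hi₂ hle hsup hclu hy' (subgradAt_of_hasGradientAt hv hg')
  have hcl : ⟪n, y⟫ ≤ ⟪n, y'⟫ := by
    have hclosed : IsClosed {z : R2 | ⟪n, y⟫ ≤ ⟪n, z⟫} :=
      isClosed_le continuous_const (by fun_prop)
    exact closure_minimal (fun z hz => (hn z hz).le) hclosed (hclu _ _ hs2)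
  have a1 := hs (x - t • n)
  have a2 := hs2 x
  rw [sub_sub_cancel, real_inner_smul_right, real_inner_comm] at a2
  rw [sub_sub_cancel_left, inner_neg_right, real_inner_smul_right, real_inner_comm] at a1
  have hs1' := hs1 x
  rw [sub_sub_cancel, real_inner_smul_right, real_inner_comm] at hs1'
  have heq : ⟪n, y'⟫ = ⟪n, y⟫ := le_antisymm (le_of_mul_le_mul_left (by linarith) ht0) hcl
  have hs3 : SubgradAt u x y' := by
    intro z
    have := hs2 z
    rw [sub_sub_eq_add_sub, add_sub_right_comm, inner_add_right, real_inner_smul_right,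
      real_inner_comm n y'] at this
    rw [heq] at this a2
    linarith
  obtain ⟨y₀, hy₀⟩ := hi₂
  have hlt := hn y₀ hy₀
  have hd : HasDerivAt (fun r : ℝ => v (y' + r • (y₀ - y'))) ⟪x - t • n, y₀ - y'⟫ 0 := by
    have hl : HasDerivAt (fun r : ℝ => y' + r • (y₀ - y')) (y₀ - y') 0 := by
      simpa using ((hasDerivAt_id (0 : ℝ)).smul_const (y₀ - y')).const_add y'
    have hgf := hg'.hasFDerivAt
    have := HasFDerivAt.comp_hasDerivAt_of_eq (0 : ℝ) hgf hl (by simp)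
    simpa [Function.comp_def, inner_sub_left, real_inner_smul_left] using this
  have hslope := hd.tendsto_slope_zero_right
  have hge : ⟪x, y₀ - y'⟫ ≤ ⟪x - t • n, y₀ - y'⟫ := by
    refine ge_of_tendsto hslope ?_
    filter_upwards [self_mem_nhdsWithin, nhdsWithin_le_nhds (Iio_mem_nhds one_pos)] with r r0 r1
    have r0 : 0 < r := r0
    have r1 : r < 1 := r1
    have hmem : y' + r • (y₀ - y') ∈ Ω₂ := by
      have := h₂ hy' (interior_subset hy₀) (sub_nonneg.2 r1.le) r0.le (by ring)
      convert this using 1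
      module
    have b1 := hle _ hmem x
    have b2 := legendre_eq hsup hy' hs3
    rw [inner_add_right, real_inner_smul_right] at b1
    simp only [zero_add, zero_smul, add_zero, smul_eq_mul]
    rw [le_inv_mul_iff₀ r0]
    linarith
  rw [inner_sub_left, real_inner_smul_left, inner_sub_right n] at hge
  nlinarith

end Regularity

lemma centredSection_box {δ δb : ℝ} (hδ : 0 < δ) (hδb : δ ≤ δb) {u : R2 → ℝ} (hu0 : u 0 = 0)
    {Ω : Set R2} {e f : R2} {L l h : ℝ} (hL : 0 < L) (hl : 0 < l)
    (H : ∃ S : Set R2, IsCentredSection u 0 h S ∧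
      (∃ xh : R2, (fun z => xh + δb • z) '' ellipse e f L l ⊆ Ω ∩ S) ∧
      S ⊆ (fun z => δb⁻¹ • z) '' ellipse e f L l) :
    ∃ p xh : R2, (∫ x in {x | u x < ⟪p, x⟫ + h}, x) = 0 ∧
      (∀ z, max (|⟪z, e⟫| / L) (|⟪z, f⟫| / l) ≤ δ / 2 →
        xh + z ∈ interior Ω ∧ u (xh + z) < ⟪p, xh + z⟫ + h) ∧
      (∀ x, u x < ⟪p, x⟫ + h → max (|⟪x, e⟫| / L) (|⟪x, f⟫| / l) ≤ 1 / δ) := by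
  obtain ⟨S, ⟨p, hS, hint⟩, ⟨xh, hin⟩, hout⟩ := H
  have hδb0 : 0 < δb := hδ.trans_le hδb
  have hS' : S = {x | u x < ⟪p, x⟫ + h} := by
    rw [hS]; ext x; simp [hu0]
  have habs : ∀ {a b c : ℝ}, 0 < b → |a| / b ≤ c → (a / b) ^ 2 ≤ c ^ 2 := by
    intro a b c hb h
    rw [← sq_abs, abs_div, abs_of_pos hb]
    exact pow_le_pow_left₀ (by positivity) h 2
  refine ⟨p, xh, ?_, ?_, ?_⟩
  · rw [← hS']; simpa using hint
  · intro z hz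
    obtain ⟨h1, h2⟩ := max_le_iff.1 hz
    have hzmem : ∀ w : R2, (⟪w, e⟫ / L) ^ 2 + (⟪w, f⟫ / l) ^ 2 < δb ^ 2 → xh + w ∈ Ω ∩ S := by
      intro w hw
      refine hin ⟨δb⁻¹ • w, ?_, by simp [smul_smul, hδb0.ne']⟩
      simp only [ellipse, mem_ofPred_eq, real_inner_smul_left]
      have : (δb⁻¹ * ⟪w, e⟫ / L) ^ 2 + (δb⁻¹ * ⟪w, f⟫ / l) ^ 2
          = ((⟪w, e⟫ / L) ^ 2 + (⟪w, f⟫ / l) ^ 2) / δb ^ 2 := by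
        field_simp
      rw [this, div_le_one (by positivity)]
      exact hw.le
    have hz' : (⟪z, e⟫ / L) ^ 2 + (⟪z, f⟫ / l) ^ 2 < δb ^ 2 := by
      have := habs hL h1
      have := habs hl h2
      nlinarith
    refine ⟨?_, ?_⟩
    · refine interior_maximal (s := Ω)
        (t := {x | (⟪x - xh, e⟫ / L) ^ 2 + (⟪x - xh, f⟫ / l) ^ 2 < δb ^ 2}) ?_ ?_ ?_
      · intro x hx
        simpa using (hzmem (x - xh) hx).1
      · exact isOpen_lt (by fun_prop) continuous_const
      · simpa using hz'
    · have := (hzmem z hz').2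
      rw [hS'] at this
      exact this
  · intro x hx
    have hx' : x ∈ S := by rw [hS']; exact hx
    obtain ⟨z, hz, rfl⟩ := hout hx'
    simp only [ellipse, mem_ofPred_eq] at hz
    have hb : ∀ {a b : ℝ}, 0 < b → (a / b) ^ 2 ≤ 1 → |δb⁻¹ * a| / b ≤ 1 / δ := by
      intro a b hb h
      have h1 : |a| / b ≤ 1 := by
        rw [← abs_of_pos hb, ← abs_div]
        exact abs_le_one_iff_mul_self_le_one.2 (by nlinarith)
      rw [abs_mul, abs_of_pos (inv_pos.2 hδb0), mul_div_assoc]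
      calc δb⁻¹ * (|a| / b) ≤ δb⁻¹ * 1 := by gcongr
        _ ≤ 1 / δ := by rw [mul_one, ← one_div]; gcongr
    refine max_le ?_ ?_
    · rw [real_inner_smul_left]
      exact hb hL (by nlinarith [sq_nonneg (⟪z, f⟫ / l)])
    · rw [real_inner_smul_left]
      exact hb hl (by nlinarith [sq_nonneg (⟪z, e⟫ / L)])

lemma zero_mem_closure_interior {Ω : Set R2} (h : Convex ℝ Ω) (hi : (interior Ω).Nonempty)
    (h0 : (0 : R2) ∈ frontier Ω) : (0 : R2) ∈ closure (interior Ω) := by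
  rw [h.closure_interior_eq_closure_of_nonempty_interior hi]
  exact h0.1

/-- Every member of the family gives a pair satisfying the symmetric properties. -/
theorem InSFamily.core {δb : ℝ} (hδb : 0 < δb) {u v : R2 → ℝ} {Ω₁ Ω₂ : Set R2} {L l : ℝ → ℝ}
    {e f : ℝ → R2} (H : InSFamily δb u v Ω₁ Ω₂ L l e f) :
    Core (min δb 1) ⟨u, v, interior Ω₁, interior Ω₂, L, l, e, f⟩ := by
  obtain ⟨hu, hv, h₁, h₂, hi₁, hi₂, hf₁, hf₂, hg₁, hg₂, hA₁, hu0, hu00, hA₂, hv0, hv00, hleg,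
    -, -, hsec⟩ := H
  have hδ : 0 < min δb 1 := lt_min hδb one_pos
  have hclu : ∀ x p, SubgradAt u x p → p ∈ closure (interior Ω₂) := fun x p hp => by
    rw [h₂.closure_interior_eq_closure_of_nonempty_interior hi₂]
    exact subgradAt_mem_closure hu h₁ hi₂ hg₁ hA₁ hu00 hp
  have hclv : ∀ x p, SubgradAt v x p → p ∈ closure (interior Ω₁) := fun x p hp => by
    rw [h₁.closure_interior_eq_closure_of_nonempty_interior hi₁]
    exact subgradAt_mem_closure hv h₂ hi₁ hg₂ hA₂ hv00 hp
  have hle : ∀ y ∈ Ω₂, ∀ z, ⟪z, y⟫ - u z ≤ v y := fun y hy z => by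
    rw [hleg y hy]
    exact le_ciSup (bddAbove_inner_sub hu hg₁ hu00 hy) z
  have hsup : ∀ y ∈ Ω₂, ∀ c, (∀ z, ⟪z, y⟫ - u z ≤ c) → v y ≤ c := fun y hy c hc => by
    rw [hleg y hy]
    exact ciSup_le hc
  have h01 : (0 : R2) ∉ interior Ω₁ := hf₁.2
  have h02 : (0 : R2) ∉ interior Ω₂ := hf₂.2
  have A₂ : ∀ y ∈ interior Ω₂, ∃ x ∈ interior Ω₁, HasGradientAt u y x := fun y hy =>
    exists_hasGradientAt_of_mem₂ hu hv h₁ h₂ hi₂ hle hsup hclu hclv hg₁ h02 hy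
  have A₁ : ∀ x ∈ interior Ω₁, ∃ y ∈ interior Ω₂, HasGradientAt v x y := fun x hx =>
    exists_hasGradientAt_of_mem₁ hu hv h₂ hi₂ hle hsup hclu hg₂ h01 hx
  have dual : ∀ {x y}, y ∈ interior Ω₂ → SubgradAt u x y → SubgradAt v y x :=
    fun hy h => subgradAt_dual hv hle hsup hy h
  have dual' : ∀ {x y}, y ∈ interior Ω₂ → SubgradAt v y x → SubgradAt u x y :=
    fun hy h => subgradAt_of_dual hu h₂ hi₂ hle hsup hclu (interior_subset hy) h
  have B₁ : ∀ x ∈ interior Ω₁, ∃ y ∈ interior Ω₂, HasGradientAt u y x ∧ HasGradientAt v x y := by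
    intro x hx
    obtain ⟨y, hy, hg⟩ := A₁ x hx
    obtain ⟨x', hx', hg'⟩ := A₂ y hy
    obtain rfl := (dual hy (subgradAt_of_hasGradientAt hu hg')).eq_of_hasGradientAt hg
    exact ⟨y, hy, hg', hg⟩
  have B₂ : ∀ y ∈ interior Ω₂, ∃ x ∈ interior Ω₁, HasGradientAt u y x ∧ HasGradientAt v x y := by
    intro y hy
    obtain ⟨x, hx, hg⟩ := A₂ y hy
    obtain ⟨y', hy', hg', hgv⟩ := B₁ x hx
    obtain rfl := hg.unique hg'
    exact ⟨x, hx, hg, hgv⟩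
  have uq₁ : ∀ x ∈ interior Ω₁, ∀ y y', SubgradAt u x y → SubgradAt u x y' → y = y' := by
    intro x hx y y' h h'
    obtain ⟨_, -, hg, -⟩ := B₁ x hx
    rw [h.eq_of_hasGradientAt hg, h'.eq_of_hasGradientAt hg]
  have uq₂ : ∀ y ∈ interior Ω₂, ∀ x x', SubgradAt v y x → SubgradAt v y x' → x = x' := by
    intro x hx y y' h h'
    obtain ⟨_, -, -, hg⟩ := B₂ x hx
    rw [h.eq_of_hasGradientAt hg, h'.eq_of_hasGradientAt hg]
  have uq₃ : ∀ x ∈ interior Ω₁, ∀ y y', SubgradAt v y x → SubgradAt v y' x → y = y' := by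
    intro x hx
    obtain ⟨ŷ, hŷ, hgu, hgv⟩ := B₁ x hx
    have hsv := subgradAt_of_hasGradientAt hv hgv
    have key : ∀ y, SubgradAt v y x → y = ŷ := by
      intro y hy
      have hc : Tendsto (fun t : ℝ => ŷ + t • (y - ŷ)) (𝓝[>] 0) (𝓝 ŷ) := by
        have : Continuous fun t : ℝ => ŷ + t • (y - ŷ) := by fun_prop
        have := this.tendsto 0
        simp only [zero_smul, add_zero] at this
        exact this.mono_left nhdsWithin_le_nhds
      obtain ⟨t, ht, ht0, ht1⟩ := ((hc.eventually_mem (isOpen_interior.mem_nhds hŷ)).and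
        (Filter.Eventually.and self_mem_nhdsWithin
          (nhdsWithin_le_nhds (Iio_mem_nhds one_pos)))).exists
      have ht0 : 0 < t := ht0
      have ht1 : t < 1 := ht1
      have := (dual' ht (eq_of_subgradAt_smul hsv hy ht0.le ht1.le hv)).eq_of_hasGradientAt hgu
      rw [add_eq_left, smul_eq_zero, or_iff_right ht0.ne', sub_eq_zero] at this
      exact this
    intro y y' h h'
    rw [key y h, key y' h']
  have hmeas : ∀ {w : R2 → ℝ} {Ω : Set R2}, AlexandrovSol w Ω → ∀ E ⊆ interior Ω,
      MeasurableSet E → volume (⋃ x ∈ E, {p : R2 | SubgradAt w x p}) = volume E := by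
    intro w Ω hA E hE hEm
    rw [hA E hEm, inter_eq_left.2 (hE.trans interior_subset)]
  refine ⟨hδ, min_le_right _ _, ?_, ?_, fun h hh => ?_⟩
  · exact
    { conv := hu
      convex := h₁.interior
      isOpen := isOpen_interior
      nonempty := hi₁
      zero_notMem := h01
      zero_mem := zero_mem_closure_interior h₁ hi₁ hf₁
      u_zero := hu0
      u_nonneg := fun x => by simpa [hu0] using hu00 x
      mem_closure := hclu
      exists_dual := fun x hx => by
        obtain ⟨y, hy, hgu, hgv⟩ := B₁ x hx
        exact ⟨y, hy, subgradAt_of_hasGradientAt hu hgu, subgradAt_of_hasGradientAt hv hgv⟩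
      unique := uq₁
      unique' := fun y hy x x' h h' => uq₂ y hy x x' (dual hy h) (dual hy h')
      volume_image := hmeas hA₁
      sect := fun h hh => by
        obtain ⟨-, -, -, hl, hlL, -, hsu, -⟩ := hsec h hh
        exact centredSection_box hδ (min_le_left _ _) hu0 (hl.trans_le hlL) hl hsu }
  · exact
    { conv := hv
      convex := h₂.interior
      isOpen := isOpen_interior
      nonempty := hi₂
      zero_notMem := h02
      zero_mem := zero_mem_closure_interior h₂ hi₂ hf₂
      u_zero := hv0
      u_nonneg := fun x => by simpa [hv0] using hv00 x
      mem_closure := hclv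
      exists_dual := fun y hy => by
        obtain ⟨x, hx, hgu, hgv⟩ := B₂ y hy
        exact ⟨x, hx, subgradAt_of_hasGradientAt hv hgv, subgradAt_of_hasGradientAt hu hgu⟩
      unique := uq₂
      unique' := uq₃
      volume_image := hmeas hA₂
      sect := fun h hh => by
        obtain ⟨-, -, -, hl, hlL, -, -, hsv⟩ := hsec h hh
        exact centredSection_box hδ (min_le_left _ _) hv0 (hl.trans_le hlL) hl hsv }
  · obtain ⟨a, b, c, d, e', g, -, -⟩ := hsec h hh
    exact ⟨a, b, c, d, e', g⟩

end

section

open Filter Topology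
open scoped Pointwise

/-! ### Gauges -/

lemma inner_eq_coord (x y : R2) : ⟪x, y⟫ = x 0 * y 0 + x 1 * y 1 := by
  simp [PiLp.inner_apply, Fin.sum_univ_two, mul_comm]

lemma orthonormal_coord {a₀ a₁ b₀ b₁ : ℝ} (ha : a₀ * a₀ + a₁ * a₁ = 1) (hb : b₀ * b₀ + b₁ * b₁ = 1)
    (hab : a₀ * b₀ + a₁ * b₁ = 0) :
    a₀ * a₀ + b₀ * b₀ = 1 ∧ a₁ * a₁ + b₁ * b₁ = 1 ∧ a₀ * a₁ + b₀ * b₁ = 0 := by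
  have hdet : (a₀ * b₁ - a₁ * b₀) ^ 2 = 1 := by grind
  grind

lemma eq_add_smul_of_orthonormal {a b : R2} (ha : ‖a‖ = 1) (hb : ‖b‖ = 1) (hab : ⟪a, b⟫ = 0)
    (x : R2) : x = ⟪x, a⟫ • a + ⟪x, b⟫ • b := by
  have ha2 : ⟪a, a⟫ = 1 := by rw [real_inner_self_eq_norm_sq, ha]; norm_num
  have hb2 : ⟪b, b⟫ = 1 := by rw [real_inner_self_eq_norm_sq, hb]; norm_num
  rw [inner_eq_coord] at ha2 hb2 hab
  obtain ⟨h1, h2, h3⟩ := orthonormal_coord ha2 hb2 hab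
  rw [inner_eq_coord, inner_eq_coord]
  ext k
  fin_cases k
  · simp only [PiLp.add_apply, PiLp.smul_apply, smul_eq_mul, Fin.zero_eta]
    linear_combination (-(x 0)) * h1 - x 1 * h3
  · simp only [PiLp.add_apply, PiLp.smul_apply, smul_eq_mul, Fin.mk_one]
    linear_combination (-(x 1)) * h2 - x 0 * h3

lemma inner_eq_of_orthonormal {a b : R2} (ha : ‖a‖ = 1) (hb : ‖b‖ = 1) (hab : ⟪a, b⟫ = 0)
    (x y : R2) : ⟪x, y⟫ = ⟪x, a⟫ * ⟪y, a⟫ + ⟪x, b⟫ * ⟪y, b⟫ := by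
  conv_lhs => rw [eq_add_smul_of_orthonormal ha hb hab y]
  rw [inner_add_right, real_inner_smul_right, real_inner_smul_right]
  ring

variable {δ : ℝ} {D : Dat}

namespace Core

variable (H : Core δ D) {h : ℝ} (hh : h ∈ Ioc (0 : ℝ) 1)

include H hh in
lemma l_pos : 0 < D.l h := (H.axes h hh).2.2.2.1

include H hh in
lemma L_pos : 0 < D.L h := (H.axes h hh).2.2.2.1.trans_le (H.axes h hh).2.2.2.2.1

include H hh in
lemma L_mul_l : D.L h * D.l h = h := (H.axes h hh).2.2.2.2.2

include H hh in
lemma q_nonneg (x : R2) : 0 ≤ D.q h x :=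
  le_max_of_le_left (div_nonneg (abs_nonneg _) (H.L_pos hh).le)

include H hh in
lemma abs_inner_e_le (x : R2) : |⟪x, D.e h⟫| ≤ D.L h * D.q h x := by
  rw [mul_comm, ← div_le_iff₀ (H.L_pos hh)]
  exact le_max_left _ _

include H hh in
lemma abs_inner_f_le (x : R2) : |⟪x, D.f h⟫| ≤ D.l h * D.q h x := by
  rw [mul_comm, ← div_le_iff₀ (H.l_pos hh)]
  exact le_max_right _ _

include H hh in
lemma q_le_iff {x : R2} {r : ℝ} :
    D.q h x ≤ r ↔ |⟪x, D.e h⟫| ≤ D.L h * r ∧ |⟪x, D.f h⟫| ≤ D.l h * r := by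
  rw [Dat.q, max_le_iff, div_le_iff₀ (H.L_pos hh), div_le_iff₀ (H.l_pos hh), mul_comm r,
    mul_comm r]

include H hh in
lemma q_add_le (x y : R2) : D.q h (x + y) ≤ D.q h x + D.q h y := by
  rw [H.q_le_iff hh, inner_add_left, inner_add_left, mul_add, mul_add]
  exact ⟨(abs_add_le _ _).trans (add_le_add (H.abs_inner_e_le hh x) (H.abs_inner_e_le hh y)),
    (abs_add_le _ _).trans (add_le_add (H.abs_inner_f_le hh x) (H.abs_inner_f_le hh y))⟩

lemma _root_.Dat.q_smul (D : Dat) (h c : ℝ) (x : R2) : D.q h (c • x) = |c| * D.q h x := by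
  simp only [Dat.q, real_inner_smul_left, abs_mul, mul_div_assoc]
  rw [mul_max_of_nonneg _ _ (abs_nonneg c)]

lemma _root_.Dat.q_neg (D : Dat) (h : ℝ) (x : R2) : D.q h (-x) = D.q h x := by
  simp only [Dat.q, inner_neg_left, abs_neg]

lemma _root_.Dat.q_zero (D : Dat) (h : ℝ) : D.q h 0 = 0 := by
  simp [Dat.q]

lemma _root_.Dat.continuous_q (D : Dat) (h : ℝ) : Continuous (D.q h) := by
  unfold Dat.q
  fun_prop

include H hh in
lemma inner_eq (x y : R2) :
    ⟪x, y⟫ = ⟪x, D.e h⟫ * ⟪y, D.e h⟫ + ⟪x, D.f h⟫ * ⟪y, D.f h⟫ := by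
  obtain ⟨a, b, c, -⟩ := H.axes h hh
  exact inner_eq_of_orthonormal a b c x y

include H hh in
lemma abs_inner_le (x y : R2) : |⟪x, y⟫| ≤ 2 * h * (D.q h x * D.swap.q h y) := by
  rw [H.inner_eq hh]
  have h1 := H.abs_inner_e_le hh x
  have h2 := H.abs_inner_f_le hh x
  have h3 : |⟪y, D.f h⟫| ≤ D.L h * D.swap.q h y := H.swap.abs_inner_e_le hh y
  have h4 : |⟪y, D.e h⟫| ≤ D.l h * D.swap.q h y := H.swap.abs_inner_f_le hh y
  have hL := H.L_mul_l hh
  have q1 := H.q_nonneg hh x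
  have := H.L_pos hh
  have := H.l_pos hh
  calc _ ≤ |⟪x, D.e h⟫| * |⟪y, D.e h⟫| + |⟪x, D.f h⟫| * |⟪y, D.f h⟫| := by
        rw [← abs_mul, ← abs_mul]; exact abs_add_le _ _
    _ ≤ (D.L h * D.q h x) * (D.l h * D.swap.q h y) + (D.l h * D.q h x) * (D.L h * D.swap.q h y) := by
        gcongr
    _ = 2 * (D.L h * D.l h) * (D.q h x * D.swap.q h y) := by ring
    _ = _ := by rw [hL]

include H hh in
/-- The dual gauge is attained. -/
lemma exists_inner_eq (y : R2) : ∃ x, D.q h x ≤ 1 ∧ ⟪x, y⟫ = h * D.swap.q h y := by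
  have hL := H.L_pos hh
  have hl := H.l_pos hh
  have hLl := H.L_mul_l hh
  obtain ⟨a, b, c, -⟩ := H.axes h hh
  have aa : ⟪D.e h, D.e h⟫ = 1 := by rw [real_inner_self_eq_norm_sq, a]; norm_num
  have bb : ⟪D.f h, D.f h⟫ = 1 := by rw [real_inner_self_eq_norm_sq, b]; norm_num
  have c' : ⟪D.f h, D.e h⟫ = 0 := by rw [real_inner_comm]; exact c
  have hs : ∀ t : ℝ, ∃ s : ℝ, |s| = 1 ∧ s * t = |t| := fun t => by
    rcases le_total 0 t with h | h
    · exact ⟨1, by simp, by rw [abs_of_nonneg h]; ring⟩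
    · exact ⟨-1, by simp, by rw [abs_of_nonpos h]; ring⟩
  rcases le_total (|⟪y, D.f h⟫| / D.L h) (|⟪y, D.e h⟫| / D.l h) with hm | hm
  · have hq : D.swap.q h y = |⟪y, D.e h⟫| / D.l h := max_eq_right hm
    obtain ⟨s, hs1, hs2⟩ := hs ⟪y, D.e h⟫
    refine ⟨(s * D.L h) • D.e h, ?_, ?_⟩
    · rw [H.q_le_iff hh]
      simp only [real_inner_smul_left, aa, c, mul_one, mul_zero, abs_zero, abs_mul, hs1,
        abs_of_pos hL, one_mul]
      exact ⟨le_rfl, hl.le⟩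
    · rw [hq, real_inner_smul_left, real_inner_comm, mul_assoc, mul_comm (D.L h), ← mul_assoc, hs2]
      rw [mul_div_assoc', eq_div_iff hl.ne', mul_assoc, hLl, mul_comm]
  · have hq : D.swap.q h y = |⟪y, D.f h⟫| / D.L h := max_eq_left hm
    obtain ⟨s, hs1, hs2⟩ := hs ⟪y, D.f h⟫
    refine ⟨(s * D.l h) • D.f h, ?_, ?_⟩
    · rw [H.q_le_iff hh]
      simp only [real_inner_smul_left, bb, c', mul_one, mul_zero, abs_zero, abs_mul, hs1,
        abs_of_pos hl, one_mul]
      exact ⟨hL.le, le_rfl⟩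
    · rw [hq, real_inner_smul_left, real_inner_comm, mul_assoc, mul_comm (D.l h), ← mul_assoc, hs2]
      rw [mul_div_assoc', eq_div_iff hL.ne', mul_assoc, mul_comm (D.l h), hLl, mul_comm]

include H hh in
lemma norm_le_q (x : R2) : ‖x‖ ≤ (D.L h + D.l h) * D.q h x := by
  obtain ⟨a, b, c, -⟩ := H.axes h hh
  rw [eq_add_smul_of_orthonormal a b c x]
  refine (norm_add_le _ _).trans ?_
  rw [norm_smul, norm_smul, a, b, mul_one, mul_one, add_mul, Real.norm_eq_abs, Real.norm_eq_abs,
    ← eq_add_smul_of_orthonormal a b c x]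
  exact add_le_add (H.abs_inner_e_le hh x) (H.abs_inner_f_le hh x)

include H hh in
lemma isBounded_box (r : ℝ) : Bornology.IsBounded {x | D.q h x ≤ r} := by
  refine (Metric.isBounded_closedBall (x := (0 : R2)) (r := (D.L h + D.l h) * r)).subset ?_
  intro x hx
  rw [mem_closedBall_zero_iff]
  refine (H.norm_le_q hh x).trans ?_
  have := H.L_pos hh
  have := H.l_pos hh
  have : D.q h x ≤ r := hx
  gcongr

include H hh in
lemma volume_unit_box_pos : 0 < volume.real {x | D.q h x ≤ 1} := by
  refine ENNReal.toReal_pos ?_ (H.isBounded_box hh 1).measure_lt_top.ne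
  have ho : IsOpen {x | D.q h x < 1} := isOpen_lt (D.continuous_q h) continuous_const
  have := ho.measure_pos volume ⟨0, by simp [Dat.q_zero]⟩
  exact (this.trans_le (measure_mono fun x (hx : D.q h x < 1) => hx.le)).ne'

lemma _root_.Dat.volume_box (D : Dat) (h : ℝ) (a : R2) {r : ℝ} (hr : 0 < r) :
    volume.real {x | D.q h (x - a) ≤ r} = r ^ 2 * volume.real {x | D.q h x ≤ 1} := by
  have h1 : {x | D.q h (x - a) ≤ r} = (fun x => x - a) ⁻¹' (r • {x | D.q h x ≤ 1}) := by
    ext x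
    simp only [mem_ofPred_eq, mem_preimage]
    rw [mem_smul_set_iff_inv_smul_mem₀ hr.ne', mem_ofPred_eq, Dat.q_smul, abs_of_pos (inv_pos.2 hr),
      inv_mul_le_iff₀ hr, mul_one]
  simp only [sub_eq_add_neg] at h1 ⊢
  rw [h1, measureReal_def, measure_preimage_add_right, Measure.addHaar_smul, finrank_euclideanSpace_fin,
    ENNReal.toReal_mul, abs_of_pos (by positivity), ENNReal.toReal_ofReal (by positivity),
    measureReal_def]

lemma _root_.measure_mul_le_of_centred {S K : Set R2} (hS : MeasurableSet S)
    (hb : Bornology.IsBounded S) (hint : ∫ x in S, x = 0) (hK : MeasurableSet K) (hKS : K ⊆ S)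
    {α k : ℝ} {ν : R2} (hg : ∀ x ∈ S, 0 ≤ α + ⟪ν, x⟫) (hk : ∀ x ∈ K, k ≤ α + ⟪ν, x⟫) :
    k * volume.real K ≤ α * volume.real S := by
  have hfin : volume S ≠ ⊤ := hb.measure_lt_top.ne
  have hid : IntegrableOn (fun x : R2 => x) S volume := by
    obtain ⟨r, hr⟩ := hb.subset_closedBall 0
    refine IntegrableOn.mono_set ?_ hr
    exact continuous_id.continuousOn.integrableOn_compact (isCompact_closedBall _ _)
  have hin : IntegrableOn (fun x : R2 => ⟪ν, x⟫) S volume := hid.const_inner ν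
  have hgi : IntegrableOn (fun x : R2 => α + ⟪ν, x⟫) S volume :=
    (integrableOn_const hfin).add hin
  have h1 : ∫ x in S, (α + ⟪ν, x⟫) = α * volume.real S := by
    rw [integral_add (f := fun _ => α) (integrableOn_const hfin) hin, integral_inner hid, hint, inner_zero_right,
      setIntegral_const, smul_eq_mul]
    ring
  rw [← h1]
  calc k * volume.real K = ∫ x in K, k := by rw [setIntegral_const, smul_eq_mul, mul_comm]
    _ ≤ ∫ x in K, (α + ⟪ν, x⟫) :=
        setIntegral_mono_on (integrableOn_const (measure_ne_top_of_subset hKS hfin))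
          (hgi.mono_set hKS) hK hk
    _ ≤ ∫ x in S, (α + ⟪ν, x⟫) :=
        setIntegral_mono_set hgi ((ae_restrict_iff' hS).2 (Eventually.of_forall hg))
          (Eventually.of_forall hKS)

end Core

end

section

open Filter Topology
open scoped Pointwise
variable {δ : ℝ} {D : Dat}

namespace Core

lemma exists_section (H : Core δ D) {h : ℝ} (hh : h ∈ Ioc (0 : ℝ) 1) : ∃ p xh : R2,
    (∀ z, D.q h z ≤ δ / 2 → xh + z ∈ D.O₁ ∧ D.u (xh + z) < ⟪p, xh + z⟫ + h) ∧
    (∀ x, D.u x < ⟪p, x⟫ + h → D.q h x ≤ 1 / δ ∧ ⟪p, x⟫ ≤ 32 / δ ^ 4 * h) ∧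
    (∀ x, D.q h x ≤ δ ^ 5 / 512 → D.u x < ⟪p, x⟫ + h) := by
  obtain ⟨p, xh, hint, hin, hout⟩ := H.half.sect h hh
  have hδ := H.δ_pos
  have hucont : Continuous D.u := H.half.conv.locallyLipschitz.continuous
  set S := {x | D.u x < ⟪p, x⟫ + h} with hS
  have hSo : IsOpen S := isOpen_lt hucont (by fun_prop)
  have hSb : Bornology.IsBounded S := (H.isBounded_box hh (1 / δ)).subset hout
  have hSc : Convex ℝ S := by
    have h1 : ConvexOn ℝ univ fun x => D.u x - ⟪p, x⟫ :=
      H.half.conv.sub ((innerSL ℝ p).toLinearMap.concaveOn convex_univ)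
    have h2 : S = {x | x ∈ univ ∧ D.u x - ⟪p, x⟫ < h} := by
      refine Set.ext fun x => ⟨fun hx => ⟨mem_univ _, ?_⟩, fun hx => ?_⟩
      · have hx' : D.u x < ⟪p, x⟫ + h := hx
        linarith
      · change D.u x < ⟪p, x⟫ + h
        linarith [hx.2]
    exact h2 ▸ h1.convex_lt h
  have h0S : (0 : R2) ∈ S := by simp [hS, H.half.u_zero, hh.1]
  set B := volume.real {x | D.q h x ≤ 1} with hB
  have hBpos : 0 < B := H.volume_unit_box_pos hh
  have hvolS : volume.real S ≤ (1 / δ) ^ 2 * B := by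
    rw [← D.volume_box h 0 (by positivity : 0 < 1 / δ)]
    refine measureReal_mono (fun x hx => ?_) ?_
    · simpa using hout x hx
    · have := (H.isBounded_box hh (1 / δ)).measure_lt_top (μ := volume)
      simpa using this.ne
  refine ⟨p, xh, hin, fun x₀ hx₀ => ⟨hout x₀ hx₀, ?_⟩, fun w hw => ?_⟩
  · by_contra hcon
    rw [not_le] at hcon
    have hm0 : 0 < ⟪p, x₀⟫ := lt_of_le_of_lt (by have := hh.1; positivity) hcon
    have hpos : ∀ x ∈ S, 0 ≤ h + ⟪p, x⟫ := fun x hx => by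
      have h1 : D.u x < ⟪p, x⟫ + h := hx
      have h2 := H.half.u_nonneg x
      linarith
    set K : Set R2 := {x | D.q h (x - ((1 / 2 : ℝ) • x₀ + (1 / 2 : ℝ) • xh)) ≤ δ / 4} with hK
    have hKz : ∀ x ∈ K, ∃ z ∈ S, x = (1 / 2 : ℝ) • x₀ + (1 / 2 : ℝ) • z := by
      intro x hx
      refine ⟨xh + (2 : ℝ) • (x - ((1 / 2 : ℝ) • x₀ + (1 / 2 : ℝ) • xh)), (hin _ ?_).2, by module⟩
      rw [Dat.q_smul, abs_of_pos two_pos]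
      have : D.q h (x - ((1 / 2 : ℝ) • x₀ + (1 / 2 : ℝ) • xh)) ≤ δ / 4 := hx
      linarith
    have hKm : MeasurableSet K :=
      (isClosed_le ((D.continuous_q h).comp (by fun_prop)) continuous_const).measurableSet
    have hKS : K ⊆ S := by
      intro x hx
      obtain ⟨z, hz, rfl⟩ := hKz x hx
      exact hSc hx₀ hz (by norm_num) (by norm_num) (by norm_num)
    have hk : ∀ x ∈ K, ⟪p, x₀⟫ / 2 ≤ h + ⟪p, x⟫ := by
      intro x hx
      obtain ⟨z, hz, rfl⟩ := hKz x hx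
      have := hpos z hz
      rw [inner_add_right, real_inner_smul_right, real_inner_smul_right]
      linarith [hh.1]
    have hmain := measure_mul_le_of_centred hSo.measurableSet hSb hint hKm hKS hpos hk
    rw [hK, D.volume_box h _ (by positivity : 0 < δ / 4), ← hB] at hmain
    have h1 : ⟪p, x₀⟫ / 2 * ((δ / 4) ^ 2 * B) ≤ h * ((1 / δ) ^ 2 * B) :=
      hmain.trans (by have := hh.1; gcongr)
    have h2 : 32 / δ ^ 4 * h / 2 * ((δ / 4) ^ 2 * B) < ⟪p, x₀⟫ / 2 * ((δ / 4) ^ 2 * B) := by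
      gcongr
    have h3 : 32 / δ ^ 4 * h / 2 * ((δ / 4) ^ 2 * B) = h * ((1 / δ) ^ 2 * B) := by
      field_simp
      ring
    linarith
  · by_contra hwS
    obtain ⟨ν, hν⟩ := exists_inner_lt_of_notMem hSc hSo hwS
    have hν' : ∀ x ∈ S, 0 ≤ -⟪ν, w⟫ + ⟪ν, x⟫ := fun x hx => by linarith [hν x hx]
    have hα : 0 < -⟪ν, w⟫ := by have := hν 0 h0S; simp at this; linarith
    obtain ⟨z, hz1, hz2⟩ := H.exists_inner_eq hh ν
    set β := h * D.swap.q h ν with hβ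
    have hβb : ∀ x, |⟪ν, x⟫| ≤ 2 * β * D.q h x := fun x => by
      have := H.abs_inner_le hh x ν
      rw [real_inner_comm] at this
      rw [hβ]; linarith
    have hβ0 : 0 < β := by
      have h1 := hβb w
      have h2 := H.q_nonneg hh w
      rw [abs_of_neg (by linarith)] at h1
      by_contra hcon
      nlinarith
    have hxh : -⟪ν, w⟫ + ⟪ν, xh⟫ ≥ δ / 2 * β := by
      have := hν' (xh + (-(δ / 2)) • z) (hin _ (by
        rw [Dat.q_smul, abs_neg, abs_of_pos (by positivity)]
        nlinarith)).2
      rw [inner_add_right, real_inner_smul_right, real_inner_comm z ν, hz2] at this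
      linarith
    set K : Set R2 := {x | D.q h (x - (xh + (δ / 4) • z)) ≤ δ / 8} with hK
    have hKm : MeasurableSet K :=
      (isClosed_le ((D.continuous_q h).comp (by fun_prop)) continuous_const).measurableSet
    have hKS : K ⊆ S := by
      intro x hx
      have hx' : D.q h (x - (xh + (δ / 4) • z)) ≤ δ / 8 := hx
      have e : x = xh + ((x - (xh + (δ / 4) • z)) + (δ / 4) • z) := by module
      rw [e]
      refine (hin _ ?_).2
      refine (H.q_add_le hh _ _).trans ?_
      rw [Dat.q_smul, abs_of_pos (by positivity)]
      nlinarith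
    have hk : ∀ x ∈ K, δ / 2 * β ≤ -⟪ν, w⟫ + ⟪ν, x⟫ := by
      intro x hx
      have hx' : D.q h (x - (xh + (δ / 4) • z)) ≤ δ / 8 := hx
      have e : ⟪ν, x⟫ = ⟪ν, xh⟫ + δ / 4 * β + ⟪ν, x - (xh + (δ / 4) • z)⟫ := by
        rw [inner_sub_right, inner_add_right, real_inner_smul_right, real_inner_comm z ν, hz2]
        ring
      have h1 := (abs_le.1 (hβb (x - (xh + (δ / 4) • z)))).1
      rw [e]
      nlinarith
    have hmain := measure_mul_le_of_centred hSo.measurableSet hSb hint hKm hKS hν' hk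
    rw [hK, D.volume_box h _ (by positivity : 0 < δ / 8), ← hB] at hmain
    have h1 : δ / 2 * β * ((δ / 8) ^ 2 * B) ≤ -⟪ν, w⟫ * ((1 / δ) ^ 2 * B) :=
      hmain.trans (by gcongr)
    have h2 : -⟪ν, w⟫ ≤ 2 * β * (δ ^ 5 / 512) := by
      have := hβb w
      rw [abs_of_neg (by linarith)] at this
      exact this.trans (by gcongr)
    have h3 : -⟪ν, w⟫ * ((1 / δ) ^ 2 * B) ≤ 2 * β * (δ ^ 5 / 512) * ((1 / δ) ^ 2 * B) := by gcongr
    have h4 : 2 * β * (δ ^ 5 / 512) * ((1 / δ) ^ 2 * B) = β * δ ^ 3 * B / 256 := by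
      field_simp
      ring
    have h5 : δ / 2 * β * ((δ / 8) ^ 2 * B) = β * δ ^ 3 * B / 128 := by ring
    have h6 : 0 < β * δ ^ 3 * B := by positivity
    linarith

end Core

namespace Core

lemma smul_mem (H : Core δ D) {x : R2} (hx : x ∈ D.O₁) {t : ℝ} (ht : 0 < t) (ht1 : t ≤ 1) :
    t • x ∈ D.O₁ := by
  have h1 := H.half.convex.combo_interior_closure_mem_interior
    (H.half.isOpen.interior_eq.symm ▸ hx) H.half.zero_mem ht (by linarith : 0 ≤ 1 - t) (by ring)
  rw [H.half.isOpen.interior_eq] at h1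
  simpa using h1

lemma u_smul_le (H : Core δ D) (x : R2) {t : ℝ} (ht : 0 ≤ t) (ht1 : t ≤ 1) :
    D.u (t • x) ≤ t * D.u x := by
  have := ConvexOn.lineMap_le H.half.conv 0 x ht ht1
  simpa [H.half.u_zero] using this

lemma q_eq_zero (H : Core δ D) {h : ℝ} (hh : h ∈ Ioc (0 : ℝ) 1) {x : R2} (hx : D.q h x = 0) :
    x = 0 := by
  have := H.norm_le_q hh x
  rw [hx, mul_zero] at this
  exact norm_le_zero_iff.1 this

/-- Basic estimates relating the potential, the subgradients and the gauges. -/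
lemma exists_basic (hδ : 0 < δ) (hδ1 : δ ≤ 1) : ∃ C : ℝ, 1 ≤ C ∧ ∀ D, Core δ D →
    ∀ h ∈ Ioc (0 : ℝ) 1,
      (∀ x, C * D.q h x ≤ 1 → D.u x ≤ C * h) ∧
      (∀ x y, SubgradAt D.u x y → C * D.q h x ≤ 1 → D.swap.q h y ≤ C) ∧
      (∀ h' ∈ Ioc (0 : ℝ) 1, ∀ x, D.q h' x ≤ C * max 1 (h / h') * D.q h x) ∧
      ∃ xh, D.q h xh ≤ C ∧ ∀ z, C * D.q h z ≤ 1 → xh + z ∈ D.O₁ := by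
  set c := δ ^ 5 / 512 with hc
  set A := 32 / δ ^ 4 + 1 with hA
  have hc0 : 0 < c := by positivity
  have hc1 : c ≤ 1 := by
    rw [hc]
    have : δ ^ 5 ≤ 1 := pow_le_one₀ hδ.le hδ1
    linarith
  have hA0 : 1 ≤ A := by
    rw [hA]
    have : 0 ≤ 32 / δ ^ 4 := by positivity
    linarith
  have hcδ : c ≤ δ / 2 := by
    rw [hc]
    have : δ ^ 4 ≤ 1 := pow_le_one₀ hδ.le hδ1
    nlinarith
  have hC1 : 1 / c ≤ 2 * A / (c * δ) := by
    rw [div_le_div_iff₀ hc0 (by positivity)]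
    nlinarith
  have hC2 : A ≤ 2 * A / (c * δ) := by
    rw [le_div_iff₀ (by positivity)]
    nlinarith [mul_le_one₀ hc1 hδ.le hδ1]
  have hC3 : 2 * A / c ≤ 2 * A / (c * δ) := by
    gcongr
    nlinarith
  have hcC : ∀ {r : ℝ}, 0 ≤ r → 2 * A / (c * δ) * r ≤ 1 → r ≤ c / 2 := fun {r} h0 hr => by
    have h1 : 2 * (r / c) ≤ 2 * A / (c * δ) * r := by
      rw [div_mul_eq_mul_div, mul_div_assoc', div_le_div_iff₀ hc0 (by positivity)]
      have h3 : c * r * δ ≤ c * r * A := by gcongr; linarith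
      nlinarith
    have h2 : r / c ≤ 1 / 2 := by linarith
    rw [div_le_iff₀ hc0] at h2
    linarith
  refine ⟨2 * A / (c * δ), hA0.trans hC2, fun D H h hh => ?_⟩
  have hbd : ∀ {h}, h ∈ Ioc (0 : ℝ) 1 → ∀ x, D.q h x ≤ c → D.u x ≤ A * h := by
    intro h hh x hx
    obtain ⟨p, xh, -, h2, h3⟩ := H.exists_section hh
    have h4 := h3 x hx
    have h5 := (h2 x h4).2
    have := hh.1
    rw [hA]
    linarith
  refine ⟨fun x hx => ?_, fun x y hxy hx => ?_, fun h' hh' x => ?_, ?_⟩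
  · refine (hbd hh x ?_).trans ?_
    · linarith [hcC (H.q_nonneg hh x) hx]
    · have := hh.1
      gcongr
  · obtain ⟨w, hw1, hw2⟩ := H.exists_inner_eq hh y
    have h1 := hxy (x + (c / 2) • w)
    have h2 := hbd hh (x + (c / 2) • w) (by
      refine (H.q_add_le hh _ _).trans ?_
      rw [Dat.q_smul, abs_of_pos (by positivity)]
      have := hcC (H.q_nonneg hh x) hx
      nlinarith)
    have h3 := H.half.u_nonneg x
    rw [add_sub_cancel_left, real_inner_smul_right, real_inner_comm, hw2] at h1
    refine le_trans ?_ hC3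
    rw [le_div_iff₀ hc0]
    have := hh.1
    have h4 : (D.swap.q h y * c) * h ≤ 2 * A * h := by nlinarith
    exact le_of_mul_le_mul_right h4 this
  · have hh0 := hh.1
    have hh0' := hh'.1
    rcases eq_or_lt_of_le (H.q_nonneg hh x) with hx | hx
    · rw [H.q_eq_zero hh hx.symm, Dat.q_zero, Dat.q_zero, mul_zero]
    · obtain ⟨p, xh, -, h2, -⟩ := H.exists_section hh'
      set m := max 1 (h / h') with hm
      have hm1 : 1 ≤ m := le_max_left _ _
      have hmh : h ≤ m * h' := by
        rw [← div_le_iff₀ hh0']; exact le_max_right _ _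
      set σ := 1 / (2 * A * m) with hσ
      have hσ0 : 0 < σ := by positivity
      have hσ1 : σ ≤ 1 := by
        rw [hσ, div_le_one (by positivity)]
        nlinarith
      have key : ∀ s : ℝ, |s| = 1 → 0 ≤ ⟪p, (s * (c / D.q h x)) • x⟫ →
          D.q h' x ≤ 2 * A / (c * δ) * m * D.q h x := by
        intro s hs hs2
        have h3 := hbd hh ((s * (c / D.q h x)) • x) (by
          rw [Dat.q_smul, abs_mul, hs, abs_of_pos (by positivity)]
          field_simp
          exact le_rfl)
        have h4 := H.u_smul_le ((s * (c / D.q h x)) • x) hσ0.le hσ1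
        have h5 : D.u (σ • (s * (c / D.q h x)) • x) ≤ h' / 2 := by
          refine h4.trans ((mul_le_mul_of_nonneg_left h3 hσ0.le).trans ?_)
          rw [hσ, div_mul_eq_mul_div, div_le_div_iff₀ (by positivity) two_pos]
          nlinarith
        have h6 := (h2 (σ • (s * (c / D.q h x)) • x) (by
          rw [real_inner_smul_right]
          have := mul_nonneg hσ0.le hs2
          linarith)).1
        rw [Dat.q_smul, Dat.q_smul, abs_mul, hs, abs_of_pos hσ0, abs_of_pos (by positivity),
          hσ] at h6
        have h7 : 1 / (2 * A * m) * (1 * (c / D.q h x) * D.q h' x) =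
            D.q h' x * c / (2 * A * m * D.q h x) := by field_simp
        rw [h7, div_le_div_iff₀ (by positivity) hδ] at h6
        rw [div_mul_eq_mul_div, div_mul_eq_mul_div, le_div_iff₀ (by positivity)]
        linarith
      rcases le_total 0 ⟪p, (c / D.q h x) • x⟫ with h3 | h3
      · exact key 1 (by simp) (by simpa using h3)
      · refine key (-1) (by simp) ?_
        rw [mul_smul, neg_one_smul, inner_neg_right]
        linarith
  · obtain ⟨p, xh, h1, h2, -⟩ := H.exists_section hh
    refine ⟨xh, ?_, fun z hz => (h1 z ?_).1⟩
    · have h3 := (h1 0 (by rw [Dat.q_zero]; positivity)).2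
      rw [add_zero] at h3
      refine (h2 xh h3).1.trans (le_trans ?_ hC1)
      gcongr
      linarith
    · linarith [hcC (H.q_nonneg hh z) hz]

end Core

end

section

open Filter Topology
open scoped Pointwise

lemma det2_eq_of_orthonormal {e f : R2} (he : ‖e‖ = 1) (hf : ‖f‖ = 1) (hef : ⟪e, f⟫ = 0)
    (a x : R2) : det2 a x = (⟪a, e⟫ * ⟪x, f⟫ - ⟪a, f⟫ * ⟪x, e⟫) * det2 e f := by
  conv_lhs => rw [eq_add_smul_of_orthonormal he hf hef a, eq_add_smul_of_orthonormal he hf hef x]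
  simp only [det2, PiLp.add_apply, PiLp.smul_apply, smul_eq_mul]
  ring

lemma abs_det2_of_orthonormal {e f : R2} (he : ‖e‖ = 1) (hf : ‖f‖ = 1) (hef : ⟪e, f⟫ = 0) :
    |det2 e f| = 1 := by
  have h1 : ⟪e, e⟫ = 1 := by rw [real_inner_self_eq_norm_sq, he]; norm_num
  have h2 : ⟪f, f⟫ = 1 := by rw [real_inner_self_eq_norm_sq, hf]; norm_num
  rw [inner_eq_coord] at h1 h2 hef
  have : det2 e f ^ 2 = 1 := by
    have : det2 e f ^ 2 = (e 0 * e 0 + e 1 * e 1) * (f 0 * f 0 + f 1 * f 1) -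
      (e 0 * f 0 + e 1 * f 1) ^ 2 := by simp only [det2]; ring
    rw [this, h1, h2, hef]; norm_num
  rw [← sq_abs] at this
  nlinarith [abs_nonneg (det2 e f)]

/-- The linear map with component functionals `⟪·, a⟫` and `⟪·, b⟫`. -/
def pairMap (a b : R2) : R2 →ₗ[ℝ] R2 where
  toFun x := !₂[⟪x, a⟫, ⟪x, b⟫]
  map_add' x y := by ext i; fin_cases i <;> simp [inner_add_left]
  map_smul' c x := by ext i; fin_cases i <;> simp [real_inner_smul_left]

lemma det_pairMap (a b : R2) : LinearMap.det (pairMap a b) = det2 a b := by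
  rw [← LinearMap.det_toMatrix (EuclideanSpace.basisFun (Fin 2) ℝ).toBasis, Matrix.det_fin_two]
  simp [LinearMap.toMatrix_apply, pairMap, det2, inner_eq_coord]
  try ring

lemma volume_pair_preimage {a b : R2} (hab : det2 a b ≠ 0) {S : Set (ℝ × ℝ)}
    (hS : MeasurableSet S) :
    volume {x : R2 | (⟪x, a⟫, ⟪x, b⟫) ∈ S} = ENNReal.ofReal |(det2 a b)⁻¹| * volume S := by
  have h1 : MeasurePreserving (fun y : R2 => (y 0, y 1)) volume volume :=
    (volume_preserving_finTwoArrow ℝ).comp (EuclideanSpace.volume_preserving_symm_measurableEquiv_toLp _)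
  have h2 := Measure.addHaar_preimage_linearMap volume (f := pairMap a b)
    (by rwa [det_pairMap]) ((fun y : R2 => (y 0, y 1)) ⁻¹' S)
  rw [h1.measure_preimage hS.nullMeasurableSet, det_pairMap] at h2
  rw [← h2]
  rfl

lemma volume_parallelogram {a b : R2} (hab : det2 a b ≠ 0) {α β m : ℝ} (hα : 0 ≤ α) :
    volume {x : R2 | |⟪x, a⟫| ≤ α ∧ |⟪x, b⟫ - m| ≤ β} =
      ENNReal.ofReal (4 * α * β / |det2 a b|) := by
  have h1 : {x : R2 | |⟪x, a⟫| ≤ α ∧ |⟪x, b⟫ - m| ≤ β} =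
      {x : R2 | (⟪x, a⟫, ⟪x, b⟫) ∈ Icc (-α) α ×ˢ Icc (m - β) (m + β)} := by
    ext x
    simp only [mem_ofPred_eq, mem_prod, mem_Icc, abs_le]
    constructor <;> rintro ⟨⟨h1, h2⟩, h3, h4⟩ <;> refine ⟨⟨?_, ?_⟩, ?_, ?_⟩ <;> linarith
  rw [h1, volume_pair_preimage hab (measurableSet_Icc.prod measurableSet_Icc), Measure.volume_eq_prod,
    Measure.prod_prod, Real.volume_Icc, Real.volume_Icc, ← ENNReal.ofReal_mul (by linarith),
    ← ENNReal.ofReal_mul (abs_nonneg _), abs_inv]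
  congr 1
  ring

namespace Core
variable {δ : ℝ} {D : Dat} (H : Core δ D) {h : ℝ} (hh : h ∈ Ioc (0 : ℝ) 1)

include H hh in
lemma volume_box (a : R2) {r : ℝ} (hr : 0 ≤ r) :
    volume {x | D.q h (x - a) ≤ r} = ENNReal.ofReal (4 * r ^ 2 * h) := by
  obtain ⟨he, hf, hef, -⟩ := H.axes h hh
  have h1 := abs_det2_of_orthonormal he hf hef
  have h2 : {x | D.q h x ≤ r} =
      {x | |⟪x, D.e h⟫| ≤ D.L h * r ∧ |⟪x, D.f h⟫ - 0| ≤ D.l h * r} := by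
    ext x
    simp only [mem_ofPred_eq, sub_zero]
    exact H.q_le_iff hh
  have h3 : {x | D.q h (x - a) ≤ r} = (fun x => x + -a) ⁻¹' {x | D.q h x ≤ r} := by
    ext x
    simp [sub_eq_add_neg]
  have := (H.L_pos hh).le
  have := (H.l_pos hh).le
  rw [h3, measure_preimage_add_right, h2, volume_parallelogram (by rw [← abs_pos, h1]; simp)
    (by positivity), h1]
  congr 1
  linear_combination 4 * r ^ 2 * H.L_mul_l hh

include H hh in
lemma abs_det2_le (a x : R2) : |det2 a x| ≤ 2 * h * (D.q h a * D.q h x) := by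
  obtain ⟨he, hf, hef, -⟩ := H.axes h hh
  rw [det2_eq_of_orthonormal he hf hef, abs_mul, abs_det2_of_orthonormal he hf hef, mul_one]
  refine (abs_sub _ _).trans ?_
  rw [abs_mul, abs_mul]
  have h1 := mul_le_mul (H.abs_inner_e_le hh a) (H.abs_inner_f_le hh x) (abs_nonneg _)
    (mul_nonneg (H.L_pos hh).le (H.q_nonneg hh _))
  have h2 := mul_le_mul (H.abs_inner_f_le hh a) (H.abs_inner_e_le hh x) (abs_nonneg _)
    (mul_nonneg (H.l_pos hh).le (H.q_nonneg hh _))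
  have e1 : D.L h * D.q h a * (D.l h * D.q h x) = h * (D.q h a * D.q h x) := by
    linear_combination D.q h a * D.q h x * H.L_mul_l hh
  have e2 : D.l h * D.q h a * (D.L h * D.q h x) = h * (D.q h a * D.q h x) := by
    linear_combination D.q h a * D.q h x * H.L_mul_l hh
  linarith

include H hh in
lemma exists_det2_eq (a : R2) : ∃ z, D.q h z ≤ 1 ∧ det2 a z = h * D.q h a := by
  obtain ⟨he, hf, hef, -⟩ := H.axes h hh
  have hL := H.L_pos hh
  have hl := H.l_pos hh
  have key : ∃ z, D.q h z ≤ 1 ∧ |det2 a z| = h * D.q h a := by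
    have he' : ⟪D.e h, D.e h⟫ = 1 := by rw [real_inner_self_eq_norm_sq, he]; norm_num
    have hf' : ⟪D.f h, D.f h⟫ = 1 := by rw [real_inner_self_eq_norm_sq, hf]; norm_num
    have hfe : ⟪D.f h, D.e h⟫ = 0 := by rw [real_inner_comm, hef]
    rcases le_total (|⟪a, D.e h⟫| / D.L h) (|⟪a, D.f h⟫| / D.l h) with hc | hc
    · refine ⟨D.L h • D.e h, ?_, ?_⟩
      · simp [Dat.q, real_inner_smul_left, he, hef, abs_of_pos hL, hL.ne']
      · rw [det2_eq_of_orthonormal he hf hef, abs_mul, abs_det2_of_orthonormal he hf hef, Dat.q,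
          max_eq_right hc]
        simp only [real_inner_smul_left, he', hef]
        rw [mul_one, mul_one, mul_zero, mul_zero, zero_sub, abs_neg, abs_mul, abs_of_pos hL]
        field_simp
        linear_combination |⟪a, D.f h⟫| * H.L_mul_l hh
    · refine ⟨D.l h • D.f h, ?_, ?_⟩
      · simp [Dat.q, real_inner_smul_left, hf, hfe, abs_of_pos hl, hl.ne']
      · rw [det2_eq_of_orthonormal he hf hef, abs_mul, abs_det2_of_orthonormal he hf hef, Dat.q,
          max_eq_left hc]
        simp only [real_inner_smul_left, hf', hfe]
        rw [mul_one, mul_one, mul_zero, mul_zero, sub_zero, abs_mul, abs_of_pos hl]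
        field_simp
        linear_combination |⟪a, D.e h⟫| * H.L_mul_l hh
  obtain ⟨z, hz1, hz2⟩ := key
  rcases abs_choice (det2 a z) with hc | hc
  · exact ⟨z, hz1, by rw [← hz2, hc]⟩
  · refine ⟨-z, by rwa [Dat.q_neg], ?_⟩
    rw [← hz2, hc]
    simp only [det2, PiLp.neg_apply]
    ring

end Core

lemma det2_add_right (a x y : R2) : det2 a (x + y) = det2 a x + det2 a y := by
  simp only [det2, PiLp.add_apply]; ring

lemma det2_smul_right (a x : R2) (c : ℝ) : det2 a (c • x) = c * det2 a x := by
  simp only [det2, PiLp.smul_apply, smul_eq_mul]; ring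

/-- Cramer's rule. -/
lemma det2_smul_eq (a b x : R2) : det2 a b • x = det2 x b • a + det2 a x • b := by
  ext i
  fin_cases i <;> simp [det2] <;> ring

/-- Scale-invariant control of the potential `D.u` with constant `C`. -/
structure Ctl (C : ℝ) (D : Dat) : Prop where
  one_le : 1 ≤ C
  u_le : ∀ h ∈ Ioc (0 : ℝ) 1, ∀ x, C * D.q h x ≤ 1 → D.u x ≤ C * h
  subgrad_le : ∀ h ∈ Ioc (0 : ℝ) 1, ∀ x y, SubgradAt D.u x y → C * D.q h x ≤ 1 →
    D.swap.q h y ≤ C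
  q_le : ∀ h ∈ Ioc (0 : ℝ) 1, ∀ h' ∈ Ioc (0 : ℝ) 1, ∀ x,
    D.q h' x ≤ C * max 1 (h / h') * D.q h x
  fat : ∀ h ∈ Ioc (0 : ℝ) 1, ∃ xh, D.q h xh ≤ C ∧ ∀ z, C * D.q h z ≤ 1 → xh + z ∈ D.O₁

variable {δ C : ℝ} {D : Dat}

lemma exists_ctl (hδ : 0 < δ) (hδ1 : δ ≤ 1) : ∃ C : ℝ, 1 ≤ C ∧ ∀ D, Core δ D →
    Ctl C D ∧ Ctl C D.swap := by
  obtain ⟨C, hC, h⟩ := Core.exists_basic hδ hδ1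
  have key : ∀ D, Core δ D → Ctl C D := fun D H =>
    ⟨hC, fun s hs => (h D H s hs).1, fun s hs => (h D H s hs).2.1,
      fun s hs => (h D H s hs).2.2.1, fun s hs => (h D H s hs).2.2.2⟩
  exact ⟨C, hC, fun D H => ⟨key D H, key _ H.swap⟩⟩

namespace Core

lemma q_le_of_le (B : Ctl C D) {h h' : ℝ} (hh : h ∈ Ioc (0 : ℝ) 1) (hh' : h' ∈ Ioc (0 : ℝ) 1)
    (hle : h ≤ h') (x : R2) : D.q h' x ≤ C * D.q h x := by
  have := B.q_le h hh h' hh' x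
  rwa [max_eq_left ((div_le_one hh'.1).2 hle), mul_one] at this

lemma q_le_of_ge (B : Ctl C D) {h h' : ℝ} (hh : h ∈ Ioc (0 : ℝ) 1) (hh' : h' ∈ Ioc (0 : ℝ) 1)
    (hle : h' ≤ h) (x : R2) : D.q h' x ≤ C * (h / h') * D.q h x := by
  have := B.q_le h hh h' hh' x
  rwa [max_eq_right ((one_le_div hh'.1).2 hle)] at this

lemma exists_fat_box (H : Core δ D) (B : Ctl C D) {t : ℝ} (ht : t ∈ Ioc (0 : ℝ) 1) {a : R2}
    {κ C' : ℝ} (hκ : 0 < κ) (hκa : κ ≤ D.q t a) (haC : D.q t a ≤ C') {lam : ℝ} (hlam : 0 < lam)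
    (hlam1 : lam ≤ 1) : ∃ x₀ : R2, ∃ σ : ℝ, |σ| = 1 ∧
      ∀ x, D.q t (x - x₀) ≤ lam * (κ / (8 * C * C')) →
        x ∈ D.O₁ ∧ D.q t x ≤ 3 * C * lam ∧ lam * (κ / (4 * C)) * t ≤ σ * det2 a x := by
  have hC := B.one_le
  have hC' : 0 < C' := hκ.trans_le (hκa.trans haC)
  have ht0 := ht.1
  obtain ⟨xh, hxh, hfat⟩ := B.fat t ht
  obtain ⟨z, hz1, hz2⟩ := H.exists_det2_eq ht a
  have hμ : κ / (8 * C * C') ≤ 1 / (8 * C) := by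
    rw [div_le_div_iff₀ (by positivity) (by positivity)]
    nlinarith
  -- choose the sign
  obtain ⟨τ, hτ, σ, hσ, hdet⟩ : ∃ τ : ℝ, |τ| = 1 ∧ ∃ σ : ℝ, |σ| = 1 ∧
      κ / (2 * C) * t ≤ σ * det2 a (xh + (τ / (2 * C)) • z) := by
    have e : ∀ τ : ℝ, det2 a (xh + (τ / (2 * C)) • z) = det2 a xh + τ * (t * D.q t a / (2 * C)) := by
      intro τ
      rw [det2_add_right, det2_smul_right, hz2]
      ring
    have h1 : κ / (2 * C) * t ≤ t * D.q t a / (2 * C) := by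
      rw [div_mul_eq_mul_div, mul_comm κ t]
      gcongr
    rcases le_total 0 (det2 a xh) with h0 | h0
    · refine ⟨1, by simp, 1, by simp, ?_⟩
      rw [e]; linarith
    · refine ⟨-1, by simp, -1, by simp, ?_⟩
      rw [e]; linarith
  refine ⟨lam • (xh + (τ / (2 * C)) • z), σ, hσ, fun x hx => ?_⟩
  obtain ⟨w, rfl⟩ : ∃ w, x = lam • (xh + ((τ / (2 * C)) • z + w)) :=
    ⟨lam⁻¹ • x - (xh + (τ / (2 * C)) • z), by
      rw [← add_assoc, add_sub_cancel, smul_inv_smul₀ hlam.ne']⟩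
  have hw : D.q t w ≤ κ / (8 * C * C') := by
    have : lam • (xh + ((τ / (2 * C)) • z + w)) - lam • (xh + (τ / (2 * C)) • z) = lam • w := by
      module
    rw [this, Dat.q_smul, abs_of_pos hlam] at hx
    exact le_of_mul_le_mul_left hx hlam
  have hzq : D.q t ((τ / (2 * C)) • z) ≤ 1 / (2 * C) := by
    rw [Dat.q_smul, abs_div, hτ, abs_of_pos (by positivity)]
    exact mul_le_of_le_one_right (by positivity) hz1
  have hq : D.q t ((τ / (2 * C)) • z + w) ≤ 1 / C := by
    refine (H.q_add_le ht _ _).trans ((add_le_add hzq (hw.trans hμ)).trans ?_)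
    rw [div_add_div _ _ (by positivity) (by positivity), div_le_div_iff₀ (by positivity)
      (by positivity)]
    nlinarith
  refine ⟨H.smul_mem (hfat _ ?_) hlam hlam1, ?_, ?_⟩
  · rwa [le_div_iff₀ (by positivity), mul_comm] at hq
  · rw [Dat.q_smul, abs_of_pos hlam]
    have h1 : 1 / C ≤ C := by
      rw [div_le_iff₀ (by positivity)]; nlinarith
    have := H.q_add_le ht xh ((τ / (2 * C)) • z + w)
    nlinarith
  · rw [det2_smul_right, ← add_assoc, det2_add_right]
    have h1 : |σ * det2 a w| ≤ κ / (4 * C) * t := by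
      rw [abs_mul, hσ, one_mul]
      refine (H.abs_det2_le ht a w).trans ?_
      have : D.q t a * D.q t w ≤ C' * (κ / (8 * C * C')) :=
        mul_le_mul haC hw (H.q_nonneg ht _) hC'.le
      have e : C' * (κ / (8 * C * C')) = κ / (8 * C) := by field_simp
      have e2 : κ / (4 * C) = 2 * (κ / (8 * C)) := by field_simp; norm_num
      rw [e2]
      nlinarith
    have e3 : κ / (2 * C) = 2 * (κ / (4 * C)) := by field_simp; norm_num
    rw [e3] at hdet
    have h2 := (abs_le.1 h1).1
    have h3 : κ / (4 * C) * t ≤ σ * (det2 a (xh + (τ / (2 * C)) • z) + det2 a w) := by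
      rw [mul_add]; linarith
    have := mul_le_mul_of_nonneg_left h3 hlam.le
    linarith

lemma exists_spread (H : Core δ D) (B : Ctl C D) {t : ℝ} (ht : t ∈ Ioc (0 : ℝ) 1) {a b x₀ : R2}
    {C' r ℓ : ℝ} (haC : D.q t a ≤ C') (hab : 0 < det2 a b) (hr : 0 < r)
    (hbox : ∀ x, D.q t (x - x₀) ≤ r → x ∈ D.O₁ ∧ C * D.q t x ≤ 1)
    (hℓ0 : 0 ≤ ℓ) (hℓ : 2 * C * C' * ℓ < r ^ 2 * det2 a b) :
    ∃ x₁ y₁ x₂ y₂, D.q t (x₁ - x₀) ≤ r ∧ D.q t (x₂ - x₀) ≤ r ∧ SubgradAt D.u x₁ y₁ ∧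
      SubgradAt D.u x₂ y₂ ∧ ℓ < ⟪y₂, b⟫ - ⟪y₁, b⟫ := by
  by_contra! hcon
  have hC := B.one_le
  have hC' : 0 ≤ C' := (H.q_nonneg ht a).trans haC
  have ht0 := ht.1
  have hx₀ : D.q t (x₀ - x₀) ≤ r := by rw [sub_self, Dat.q_zero]; exact hr.le
  obtain ⟨y₀, -, hy₀, -⟩ := H.half.exists_dual x₀ (hbox x₀ hx₀).1
  have hm : MeasurableSet {x | D.q t (x - x₀) ≤ r} :=
    (isClosed_le ((D.continuous_q t).comp (by fun_prop)) continuous_const).measurableSet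
  have hv := H.half.volume_image {x | D.q t (x - x₀) ≤ r} (fun x hx => (hbox x hx).1) hm
  rw [H.volume_box ht x₀ hr.le] at hv
  have hsub : (⋃ x ∈ {x | D.q t (x - x₀) ≤ r}, {p : R2 | SubgradAt D.u x p}) ⊆
      {y : R2 | |⟪y, a⟫| ≤ 2 * t * (C' * C) ∧ |⟪y, b⟫ - ⟪y₀, b⟫| ≤ ℓ} := by
    intro y hy
    simp only [mem_iUnion] at hy
    obtain ⟨x, hx, hxy⟩ := hy
    have hx : D.q t (x - x₀) ≤ r := hx
    have hxy : SubgradAt D.u x y := hxy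
    refine ⟨?_, ?_⟩
    · have h1 := H.abs_inner_le ht a y
      rw [real_inner_comm] at h1
      refine h1.trans ?_
      have h2 := B.subgrad_le t ht x y hxy (hbox x hx).2
      have h3 := H.swap.q_nonneg ht y
      gcongr
    · rw [abs_le]
      have h1 := hcon x₀ y₀ x y hx₀ hx hy₀ hxy
      have h2 := hcon x y x₀ y₀ hx hx₀ hxy hy₀
      exact ⟨by linarith, by linarith⟩
  have h1 := measure_mono (μ := volume) hsub
  rw [hv, volume_parallelogram hab.ne' (by positivity), abs_of_pos hab,
    ENNReal.ofReal_le_ofReal_iff (by positivity), le_div_iff₀ hab] at h1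
  nlinarith

end Core

end

section

open Filter Topology
open scoped Pointwise
variable {δ C : ℝ} {D : Dat}

namespace Core

set_option maxHeartbeats 1000000 in
/-- The inductive step for `exists_strict`: over a dyadic chain of scales at which the direction
`a` is long, the slopes of `u` in the transversal direction `b` spread linearly. -/
lemma exists_slopes (H : Core δ D) (B : Ctl C D) (B' : Ctl C D.swap) {κ lam K c ℓ h h' : ℝ}
    (hh : h ∈ Ioc (0 : ℝ) 1) (hh' : h' ∈ Ioc (0 : ℝ) 1)
    {a b : R2} (ha : ∀ t, h' ≤ t → t ≤ h → κ ≤ D.q t a ∧ D.q t a ≤ C) (hκ : 0 < κ)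
    (hdet : det2 a b = h) (hb : D.q h b ≤ 1 / κ)
    (hlam : 0 < lam) (hlam1 : 3 * C * lam * C ≤ 1)
    (hlam2 : 3 * C * lam * (1 + 2 * C ^ 2 / κ) ≤ κ / C ^ 2)
    (hc : c = lam * (κ / (4 * C)))
    (hℓ : 0 < ℓ) (hℓr : 2 * C * C * ℓ < (lam * (κ / (8 * C * C))) ^ 2)
    (hK1 : 1 ≤ K) (hK : (4 + C) / (c * K) ≤ ℓ / 2) (i : ℕ) (hi : K ^ i * h' ≤ h) :
    ∃ α β : ℝ, i * (ℓ / 2 * h) ≤ α - β ∧ |α| ≤ 2 * C ^ 2 / κ * h ∧ |β| ≤ 2 * C ^ 2 / κ * h ∧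
      ∀ x : R2, |det2 x b| ≤ h / C ^ 2 →
        α * (det2 a x / h) - 4 * (K ^ i * h') ≤ D.u x ∧
        β * (det2 a x / h) - 4 * (K ^ i * h') ≤ D.u x := by
  have hC := B.one_le
  have hlam3 : lam ≤ 1 := by nlinarith
  have hh0 := hh.1
  have hh0' := hh'.1
  induction i with
  | zero =>
    refine ⟨0, 0, by simp, by simp; positivity, by simp; positivity, fun x _ => ?_⟩
    have := H.half.u_nonneg x
    constructor <;> simp <;> linarith
  | succ i ih =>
    set t := K ^ (i + 1) * h' with ht
    set t' := K ^ i * h' with ht'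
    have htt' : t = K * t' := by rw [ht, ht']; ring
    have hKi : 1 ≤ K ^ i := one_le_pow₀ hK1
    have ht'h : h' ≤ t' := by rw [ht']; exact le_mul_of_one_le_left hh0'.le hKi
    have ht't : t' ≤ t := by rw [htt']; exact le_mul_of_one_le_left (by linarith) hK1
    have ht'm : t' ∈ Ioc (0 : ℝ) 1 := ⟨by linarith, by linarith [hh.2]⟩
    have htm : t ∈ Ioc (0 : ℝ) 1 := ⟨by linarith, by linarith [hh.2]⟩
    have ht0 := htm.1
    have ht0' := ht'm.1
    obtain ⟨α, β, hαβ, hα, hβ, hinv⟩ := ih (by linarith)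
    obtain ⟨hat1, hat2⟩ := ha t (by linarith) hi
    have hat' := (ha t' ht'h (by linarith)).2
    obtain ⟨x₀, σ, hσ, hbox⟩ := H.exists_fat_box B htm hκ hat1 hat2 hlam hlam3
    -- control of the `a`-component of points at scale `t`
    have hs : ∀ x, D.q t x ≤ 3 * C * lam → |det2 x b| ≤ h / C ^ 2 := by
      intro x hx
      have h1 : det2 x b • a = h • x - det2 a x • b := by
        have := det2_smul_eq a b x
        rw [hdet] at this
        rw [this]; abel
      have h2 : D.q t (det2 x b • a) ≤ h * (3 * C * lam * (1 + 2 * C ^ 2 / κ)) := by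
        rw [h1, sub_eq_add_neg]
        refine (H.q_add_le htm _ _).trans ?_
        rw [Dat.q_neg, Dat.q_smul, Dat.q_smul, abs_of_pos hh0]
        have h3 := H.abs_det2_le htm a x
        have h4 : |det2 a x| ≤ 2 * t * (C * (3 * C * lam)) := by
          refine h3.trans ?_
          have := H.q_nonneg htm x
          gcongr
        have h5 : D.q t b ≤ C * (h / t) * (1 / κ) :=
          (q_le_of_ge B hh htm hi b).trans (by gcongr)
        have h6 := mul_le_mul h4 h5 (H.q_nonneg htm b) (by positivity)
        have e : 2 * t * (C * (3 * C * lam)) * (C * (h / t) * (1 / κ)) =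
            h * (3 * C * lam * (2 * C ^ 2 / κ)) := by field_simp
        have h7 : h * D.q t x ≤ h * (3 * C * lam) := by gcongr
        rw [e] at h6
        linarith
      rw [Dat.q_smul] at h2
      have h3 : |det2 x b| * κ ≤ h * (κ / C ^ 2) :=
        (mul_le_mul_of_nonneg_left hat1 (abs_nonneg _)).trans (h2.trans (by gcongr))
      have e : h * (κ / C ^ 2) = h / C ^ 2 * κ := by ring
      rw [e] at h3
      exact le_of_mul_le_mul_right h3 hκ
    have hqb : ∀ x y, SubgradAt D.u x y → C * D.q t x ≤ 1 → |⟪y, b⟫| ≤ 2 * C ^ 2 / κ * h := by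
      intro x y hxy hx
      have h1 := B.subgrad_le t htm x y hxy hx
      have h2 := q_le_of_le B' htm hh hi y
      have h3 := H.abs_inner_le hh b y
      rw [real_inner_comm] at h3
      refine h3.trans ?_
      have h4 : D.swap.q h y ≤ C * C := h2.trans (by gcongr)
      have := mul_le_mul hb h4 (H.swap.q_nonneg hh y) (by positivity)
      have e : 2 * C ^ 2 / κ * h = 2 * h * (1 / κ * (C * C)) := by ring
      rw [e]
      gcongr
    have hsmall : ∀ x, D.q t (x - x₀) ≤ lam * (κ / (8 * C * C)) → C * D.q t x ≤ 1 := by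
      intro x hx
      have := mul_le_mul_of_nonneg_left (hbox x hx).2.1 (by linarith : 0 ≤ C)
      linarith
    -- the slopes bound `u` from below at larger scales
    have hlow : ∀ x y, SubgradAt D.u x y → C * D.q t x ≤ 1 → ∀ z, |det2 z b| ≤ h / C ^ 2 →
        ⟪y, b⟫ * (det2 a z / h) - 4 * t ≤ D.u z := by
      intro x y hxy hx z hz
      have h1 := hxy z
      have h2 := B.subgrad_le t htm x y hxy hx
      have h3 := H.half.u_nonneg x
      have h4 := H.abs_inner_le htm x y
      have h4' : |⟪x, y⟫| ≤ 2 * t := by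
        refine h4.trans ?_
        have := mul_le_mul_of_nonneg_left h2 (H.q_nonneg htm x)
        exact mul_le_of_le_one_right (by linarith) (by linarith)
      have h5 := H.abs_inner_le htm a y
      have h5' : |⟪a, y⟫| ≤ 2 * t * C ^ 2 := by
        refine h5.trans ?_
        rw [sq]
        have := H.swap.q_nonneg htm y
        gcongr
      have h6 : ⟪y, z⟫ = det2 z b / h * ⟪a, y⟫ + det2 a z / h * ⟪y, b⟫ := by
        have e := det2_smul_eq a b z
        rw [hdet] at e
        have e2 := congrArg (fun w => ⟪y, w⟫) e
        simp only [inner_add_right, real_inner_smul_right] at e2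
        rw [real_inner_comm y a]
        field_simp
        linarith
      have h7 : |det2 z b / h * ⟪a, y⟫| ≤ 2 * t := by
        rw [abs_mul, abs_div, abs_of_pos hh0]
        have h8 : |det2 z b| / h ≤ 1 / C ^ 2 := by
          rw [div_le_iff₀ hh0]
          refine hz.trans (le_of_eq (by ring))
        refine (mul_le_mul h8 h5' (abs_nonneg _) (by positivity)).trans (le_of_eq ?_)
        field_simp
      rw [inner_sub_right, real_inner_comm x y, h6] at h1
      have := (abs_le.1 h7).1
      have := (abs_le.1 h4').2
      linarith
    -- monotonicity of slopes along the chain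
    have hmono : ∀ x y, SubgradAt D.u x y → D.q t (x - x₀) ≤ lam * (κ / (8 * C * C)) →
        ∀ γ, (∀ x : R2, |det2 x b| ≤ h / C ^ 2 → γ * (det2 a x / h) - 4 * t' ≤ D.u x) →
          -(ℓ / 2 * h) ≤ σ * (⟪y, b⟫ - γ) := by
      intro x y hxy hx γ hγ
      obtain ⟨-, hx3, hxr⟩ := hbox x hx
      have hxs := hs x hx3
      have h1 := hγ x hxs
      have h2 := hxy ((det2 x b / h) • a)
      have h3 : (det2 x b / h) • a - x = -((det2 a x / h) • b) := by
        have e := det2_smul_eq a b x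
        rw [hdet] at e
        have e2 : x = (1 / h) • (h • x) := by rw [smul_smul, one_div_mul_cancel hh0.ne', one_smul]
        rw [e] at e2
        nth_rw 2 [e2]
        rw [smul_add, smul_smul, smul_smul]
        module
      rw [h3, inner_neg_right, real_inner_smul_right] at h2
      have h4 : D.u ((det2 x b / h) • a) ≤ C * t' := by
        refine B.u_le t' ht'm _ ?_
        rw [Dat.q_smul, abs_div, abs_of_pos hh0]
        have h8 : |det2 x b| / h ≤ 1 / C ^ 2 := by
          rw [div_le_iff₀ hh0]
          refine hxs.trans (le_of_eq (by ring))
        have := mul_le_mul h8 hat' (H.q_nonneg ht'm a) (by positivity)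
        calc C * (|det2 x b| / h * D.q t' a) ≤ C * (1 / C ^ 2 * C) := by gcongr
          _ = 1 := by field_simp
      have h5 : -((4 + C) * t') ≤ det2 a x / h * (⟪y, b⟫ - γ) := by linarith
      have hσ2 : σ * σ = 1 := by rw [← abs_mul_abs_self, hσ]; norm_num
      rw [← hc] at hxr
      have h6 : c * t / h ≤ σ * det2 a x / h := by gcongr
      have hc0 : 0 < c := by rw [hc]; positivity
      by_contra! hcon
      have h7 : (σ * det2 a x / h) * (σ * (⟪y, b⟫ - γ)) < c * t / h * (-(ℓ / 2 * h)) := by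
        have h8 : 0 < c * t / h := by positivity
        have h9 : 0 < ℓ / 2 * h := by positivity
        exact (mul_le_mul_of_nonpos_right h6 (by linarith)).trans_lt (mul_lt_mul_of_pos_left hcon h8)
      have e1 : (σ * det2 a x / h) * (σ * (⟪y, b⟫ - γ)) = det2 a x / h * (⟪y, b⟫ - γ) := by
        linear_combination (det2 a x / h * (⟪y, b⟫ - γ)) * hσ2
      have e2 : c * t / h * (-(ℓ / 2 * h)) = - (c * K * (ℓ / 2) * t') := by
        rw [htt']; field_simp
      rw [e1, e2] at h7
      rw [div_le_iff₀ (by positivity)] at hK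
      have := mul_le_mul_of_nonneg_right hK ht0'.le
      linarith
    obtain ⟨x₁, y₁, x₂, y₂, hx₁, hx₂, hxy₁, hxy₂, hgap⟩ :=
      H.exists_spread (b := b) (x₀ := x₀) (r := lam * (κ / (8 * C * C))) (ℓ := ℓ * h) B htm hat2
        (by rw [hdet]; exact hh0)
        (by positivity) (fun x hx => ⟨(hbox x hx).1, hsmall x hx⟩) (by positivity)
        (by rw [hdet]; have := mul_lt_mul_of_pos_right hℓr hh0; linarith)
    have hprev : ∀ γ, (∀ x : R2, |det2 x b| ≤ h / C ^ 2 → γ * (det2 a x / h) - 4 * t' ≤ D.u x) →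
        ∀ x : R2, |det2 x b| ≤ h / C ^ 2 → γ * (det2 a x / h) - 4 * t ≤ D.u x :=
      fun γ hγ x hx => by linarith [hγ x hx]
    push_cast
    rcases eq_or_eq_neg_of_abs_eq hσ with rfl | rfl
    · refine ⟨⟪y₂, b⟫, β, ?_, hqb _ _ hxy₂ (hsmall _ hx₂), hβ, fun x hx =>
        ⟨hlow _ _ hxy₂ (hsmall _ hx₂) x hx, hprev β (fun x hx => (hinv x hx).2) x hx⟩⟩
      have := hmono x₁ y₁ hxy₁ hx₁ α (fun x hx => (hinv x hx).1)
      linarith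
    · refine ⟨α, ⟪y₁, b⟫, ?_, hα, hqb _ _ hxy₁ (hsmall _ hx₁), fun x hx =>
        ⟨hprev α (fun x hx => (hinv x hx).1) x hx, hlow _ _ hxy₁ (hsmall _ hx₁) x hx⟩⟩
      have := hmono x₂ y₂ hxy₂ hx₂ β (fun x hx => (hinv x hx).2)
      linarith

end Core

end

section

open Filter Topology
open scoped Pointwise
variable {δ C : ℝ}

namespace Core

/-- Quantitative strict convexity: the boxes shrink geometrically. -/
lemma exists_strict (hC : 1 ≤ C) {κ : ℝ} (hκ : 0 < κ) :
    ∃ N : ℝ, 1 ≤ N ∧ ∀ D, Core δ D → Ctl C D → Ctl C D.swap → ∀ h ∈ Ioc (0 : ℝ) 1,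
      ∀ h' ∈ Ioc (0 : ℝ) 1, N * h' ≤ h → ∀ x, D.q h x ≤ κ * D.q h' x := by
  set κ₁ := κ / C with hκ₁
  have hκ₁0 : 0 < κ₁ := by positivity
  have hκκ₁ : κ₁ ≤ κ := div_le_self hκ.le hC
  set lam := min (1 / (3 * C * C)) (κ₁ / C ^ 2 / (3 * C * (1 + 2 * C ^ 2 / κ₁))) with hlam
  have hlam0 : 0 < lam := by positivity
  have hlam1 : 3 * C * lam * C ≤ 1 := by
    have : lam ≤ 1 / (3 * C * C) := min_le_left _ _
    rw [le_div_iff₀ (by positivity)] at this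
    linarith
  have hlam2 : 3 * C * lam * (1 + 2 * C ^ 2 / κ₁) ≤ κ₁ / C ^ 2 := by
    have : lam ≤ κ₁ / C ^ 2 / (3 * C * (1 + 2 * C ^ 2 / κ₁)) := min_le_right _ _
    rw [le_div_iff₀ (by positivity)] at this
    linarith
  set c := lam * (κ₁ / (4 * C)) with hc
  have hc0 : 0 < c := by positivity
  set ρ := (lam * (κ₁ / (8 * C * C))) ^ 2 with hρ
  have hρ0 : 0 < ρ := by positivity
  set ℓ := ρ / (4 * C * C) with hℓ
  have hℓ0 : 0 < ℓ := by positivity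
  have hℓr : 2 * C * C * ℓ < ρ := by
    have : 2 * C * C * ℓ = ρ / 2 := by rw [hℓ]; field_simp; norm_num
    linarith
  set K := max 1 (2 * (4 + C) / (c * ℓ)) with hK
  have hK1 : 1 ≤ K := le_max_left _ _
  have hK2 : (4 + C) / (c * K) ≤ ℓ / 2 := by
    have : 2 * (4 + C) / (c * ℓ) ≤ K := le_max_right _ _
    rw [div_le_iff₀ (by positivity)] at this
    rw [div_le_div_iff₀ (by positivity) two_pos]
    linarith
  obtain ⟨n, hn⟩ := exists_nat_gt (4 * C ^ 2 / κ₁ / (ℓ / 2))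
  rw [div_lt_iff₀ (by positivity)] at hn
  refine ⟨K ^ n, one_le_pow₀ hK1, fun D H B B' h hh h' hh' hN a₀ => ?_⟩
  by_contra! hcon
  have hh0 := hh.1
  have hpos : 0 < D.q h' a₀ := by
    refine (H.q_nonneg hh' a₀).lt_of_ne fun h0 => ?_
    rw [← h0, H.q_eq_zero hh' h0.symm, Dat.q_zero] at hcon
    linarith
  have hKn : 1 ≤ K ^ n := one_le_pow₀ hK1
  have hh'h : h' ≤ h := (le_mul_of_one_le_left hh'.1.le hKn).trans hN
  set a := (D.q h' a₀)⁻¹ • a₀ with ha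
  have ha1 : D.q h' a = 1 := by
    rw [ha, Dat.q_smul, abs_of_pos (by positivity), inv_mul_cancel₀ hpos.ne']
  have ha2 : κ < D.q h a := by
    rw [ha, Dat.q_smul, abs_of_pos (by positivity), inv_mul_eq_div, lt_div_iff₀ hpos]
    exact hcon
  obtain ⟨z, hz1, hz2⟩ := H.exists_det2_eq hh a
  have hqa : 0 < D.q h a := hκ.trans ha2
  obtain ⟨α, β, h1, h2, h3, -⟩ := H.exists_slopes (κ := κ₁) (lam := lam) (K := K) (c := c)
    (ℓ := ℓ) (a := a) (b := (D.q h a)⁻¹ • z) B B' hh hh' (fun t ht1 ht2 => by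
      have htm : t ∈ Ioc (0 : ℝ) 1 := ⟨hh'.1.trans_le ht1, ht2.trans hh.2⟩
      constructor
      · rw [hκ₁, div_le_iff₀ (by linarith)]
        have := q_le_of_le B htm hh ht2 a
        linarith
      · have := q_le_of_le B hh' htm ht1 a
        rwa [ha1, mul_one] at this) hκ₁0
    (by rw [det2_smul_right, hz2]; field_simp)
    (by
      rw [Dat.q_smul, abs_of_pos (by positivity), ← one_div]
      refine (mul_le_of_le_one_right (by positivity) hz1).trans ?_
      gcongr
      linarith) hlam0 hlam1 hlam2 hc hℓ0 hℓr hK1 hK2 n hN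
  have h4 := (abs_le.1 h2).2
  have h5 := (abs_le.1 h3).1
  have h6 := mul_lt_mul_of_pos_right hn hh0
  have e : 4 * C ^ 2 / κ₁ * h = 2 * (2 * C ^ 2 / κ₁ * h) := by ring
  linarith

end Core

end

section

open Filter Topology
open scoped Pointwise
variable {δ C : ℝ} {D : Dat}

namespace Core

lemma exists_inner_lower (hC : 1 ≤ C) {c : ℝ} (hc : 0 < c) :
    ∃ ε : ℝ, 0 < ε ∧ ∀ D, Core δ D → Ctl C D → Ctl C D.swap → ∀ h ∈ Ioc (0 : ℝ) 1,
      ∀ x y, SubgradAt D.u x y → c ≤ D.swap.q h y → ε * h ≤ ⟪x, y⟫ := by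
  obtain ⟨N, hN, hs⟩ := exists_strict (δ := δ) hC (κ := c / (4 * C ^ 2)) (by positivity)
  refine ⟨1 / N, by positivity, fun D H B B' h hh x y hxy hy => ?_⟩
  by_contra! hcon
  have hh0 := hh.1
  have hh' : h / N ∈ Ioc (0 : ℝ) 1 := ⟨by positivity, (div_le_self hh0.le hN).trans hh.2⟩
  obtain ⟨w, hw1, hw2⟩ := H.exists_inner_eq hh' y
  have h1 := B.u_le _ hh' ((1 / C) • w) (by
    rw [Dat.q_smul, abs_of_pos (by positivity), ← mul_assoc, mul_one_div_cancel (by positivity),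
      one_mul]
    exact hw1)
  have h2 := hxy ((1 / C) • w)
  have h3 := H.half.u_nonneg x
  rw [inner_sub_right, real_inner_comm x y, real_inner_smul_right, real_inner_comm w y, hw2] at h2
  have h4 : D.swap.q (h / N) y ≤ 2 * C ^ 2 := by
    have h5 : 1 / C * (h / N * D.swap.q (h / N) y) ≤ 2 * C * (h / N) := by
      have : 1 / N * h = h / N := by ring
      have : h / N ≤ C * (h / N) := le_mul_of_one_le_left hh'.1.le hC
      linarith
    have h6 : D.swap.q (h / N) y * (h / N) ≤ 2 * C ^ 2 * (h / N) := by
      rw [div_mul_eq_mul_div, one_mul, div_le_iff₀ (by positivity)] at h5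
      linarith
    exact le_of_mul_le_mul_right h6 hh'.1
  have h5 := hs D.swap H.swap B' B h hh (h / N) hh' (by field_simp; exact le_rfl) y
  have h6 : c / (4 * C ^ 2) * D.swap.q (h / N) y ≤ c / (4 * C ^ 2) * (2 * C ^ 2) := by gcongr
  have e : c / (4 * C ^ 2) * (2 * C ^ 2) = c / 2 := by field_simp; norm_num
  linarith

lemma exists_subgrad_bound (hC : 1 ≤ C) {K : ℝ} (hK : 0 < K) :
    ∃ C' h₁ : ℝ, 0 < C' ∧ 0 < h₁ ∧ h₁ ≤ 1 ∧ ∀ D, Core δ D → Ctl C D → Ctl C D.swap →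
      ∀ h ∈ Ioc (0 : ℝ) h₁, ∀ x y, SubgradAt D.u x y → D.q h x ≤ K → D.swap.q h y ≤ C' := by
  obtain ⟨N, hN, hs⟩ := exists_strict (δ := δ) hC (κ := 1 / (C * K)) (by positivity)
  refine ⟨C * N * C, 1 / N, by positivity, by positivity, (div_le_one (by positivity)).2 hN,
    fun D H B B' h hh x y hxy hx => ?_⟩
  have hh0 := hh.1
  have hNh : N * h ≤ 1 := by
    have := hh.2
    rwa [le_div_iff₀ (by positivity), mul_comm] at this
  have hle : h ≤ N * h := le_mul_of_one_le_left hh0.le hN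
  have hh' : h ∈ Ioc (0 : ℝ) 1 := ⟨hh0, hle.trans hNh⟩
  have hNm : N * h ∈ Ioc (0 : ℝ) 1 := ⟨by positivity, hNh⟩
  have h1 := hs D H B B' _ hNm h hh' le_rfl x
  have h2 := B.subgrad_le _ hNm x y hxy (by
    calc C * D.q (N * h) x ≤ C * (1 / (C * K) * K) := by gcongr; exact h1.trans (by gcongr)
      _ = 1 := by field_simp)
  refine (q_le_of_ge B' hNm hh' hle y).trans ?_
  rw [mul_div_assoc, div_self hh0.ne', mul_one]
  gcongr

end Core

/-- The orthonormal frame `(i, j)` is aligned with the axes of the box at height `h`. -/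
structure Aligned (D : Dat) (A h : ℝ) (i j : R2) : Prop where
  norm_i : ‖i‖ = 1
  norm_j : ‖j‖ = 1
  inner_ij : ⟪i, j⟫ = 0
  le : |⟪D.e h, j⟫| ≤ A * (D.l h / D.L h)

/-- In the plane, two orthonormal frames have matching off-diagonal entries. -/
lemma abs_inner_eq_of_orthonormal {e f i j : R2} (he : ‖e‖ = 1) (hf : ‖f‖ = 1) (hef : ⟪e, f⟫ = 0)
    (hi : ‖i‖ = 1) (hj : ‖j‖ = 1) (hij : ⟪i, j⟫ = 0) : |⟪f, i⟫| = |⟪e, j⟫| := by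
  have h1 := inner_eq_of_orthonormal hi hj hij f f
  have h2 := inner_eq_of_orthonormal he hf hef j j
  rw [real_inner_self_eq_norm_sq, hf] at h1
  rw [real_inner_self_eq_norm_sq, hj] at h2
  rw [← sq_eq_sq_iff_abs_eq_abs]
  rw [real_inner_comm j f, real_inner_comm e j] at *
  nlinarith

lemma abs_inner_le_one {a b : R2} (ha : ‖a‖ = 1) (hb : ‖b‖ = 1) : |⟪a, b⟫| ≤ 1 := by
  simpa [ha, hb] using abs_real_inner_le_norm a b

lemma abs_mul_add_mul_le {a b c d A B E F : ℝ} (ha : |a| ≤ A) (hb : |b| ≤ B) (hc : |c| ≤ E)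
    (hd : |d| ≤ F) : |a * b + c * d| ≤ A * B + E * F := by
  refine (abs_add_le _ _).trans ?_
  rw [abs_mul, abs_mul]
  have := (abs_nonneg a).trans ha
  have := (abs_nonneg c).trans hc
  gcongr

namespace Aligned

variable {A h : ℝ} {i j : R2}

lemma le' (F : Aligned D A h i j) (H : Core δ D) (hh : h ∈ Ioc (0 : ℝ) 1) :
    |⟪D.f h, i⟫| ≤ A * (D.l h / D.L h) := by
  obtain ⟨a, b, c, -⟩ := H.axes h hh
  rw [abs_inner_eq_of_orthonormal a b c F.norm_i F.norm_j F.inner_ij]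
  exact F.le

lemma swap (F : Aligned D A h i j) (H : Core δ D) (hh : h ∈ Ioc (0 : ℝ) 1) :
    Aligned D.swap A h j i :=
  ⟨F.norm_j, F.norm_i, by rw [real_inner_comm]; exact F.inner_ij, F.le' H hh⟩

lemma neg_right (F : Aligned D A h i j) : Aligned D A h i (-j) :=
  ⟨F.norm_i, by simpa using F.norm_j, by simpa using F.inner_ij, by simpa using F.le⟩

lemma q_le (F : Aligned D A h i j) (H : Core δ D) (hh : h ∈ Ioc (0 : ℝ) 1) (hA : 0 ≤ A) {r : ℝ}
    {x : R2} (h1 : |⟪x, i⟫| ≤ r * D.L h) (h2 : |⟪x, j⟫| ≤ r * D.l h) :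
    D.q h x ≤ (1 + A) * r := by
  obtain ⟨a, b, c, l0, lL, -⟩ := H.axes h hh
  have L0 := H.L_pos hh
  have hr : 0 ≤ r := by
    by_contra! hr
    have := (abs_nonneg _).trans h2
    have := mul_neg_of_neg_of_pos hr l0
    linarith
  rw [H.q_le_iff hh, inner_eq_of_orthonormal F.norm_i F.norm_j F.inner_ij x (D.e h),
    inner_eq_of_orthonormal F.norm_i F.norm_j F.inner_ij x (D.f h)]
  have k1 : D.l h / D.L h ≤ 1 := (div_le_one L0).2 lL
  constructor
  · refine (abs_mul_add_mul_le h1 (abs_inner_le_one a F.norm_i) h2 F.le).trans ?_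
    have : r * D.l h * (A * (D.l h / D.L h)) ≤ r * D.L h * (A * 1) := by gcongr
    linarith
  · refine (abs_mul_add_mul_le h1 (F.le' H hh) h2 (abs_inner_le_one b F.norm_j)).trans ?_
    have : r * D.L h * (A * (D.l h / D.L h)) = r * A * D.l h := by field_simp
    linarith

lemma abs_inner_i_le (F : Aligned D A h i j) (H : Core δ D) (hh : h ∈ Ioc (0 : ℝ) 1) (hA : 0 ≤ A)
    (x : R2) : |⟪x, i⟫| ≤ (1 + A) * D.q h x * D.L h := by
  obtain ⟨a, b, c, l0, lL, -⟩ := H.axes h hh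
  have L0 := H.L_pos hh
  have q0 := H.q_nonneg hh x
  obtain ⟨h1, h2⟩ := (H.q_le_iff hh).1 (le_refl (D.q h x))
  rw [inner_eq_of_orthonormal a b c x i]
  have k1 : D.l h / D.L h ≤ 1 := (div_le_one L0).2 lL
  have g2 := F.le' H hh
  rw [real_inner_comm] at g2
  refine (abs_mul_add_mul_le h1 (abs_inner_le_one F.norm_i a) h2 g2).trans ?_
  have : D.l h * D.q h x * (A * (D.l h / D.L h)) ≤ D.L h * D.q h x * (A * 1) := by gcongr
  linarith

lemma abs_inner_j_le (F : Aligned D A h i j) (H : Core δ D) (hh : h ∈ Ioc (0 : ℝ) 1)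
    (x : R2) : |⟪x, j⟫| ≤ (1 + A) * D.q h x * D.l h := by
  obtain ⟨a, b, c, l0, lL, -⟩ := H.axes h hh
  have L0 := H.L_pos hh
  have q0 := H.q_nonneg hh x
  obtain ⟨h1, h2⟩ := (H.q_le_iff hh).1 (le_refl (D.q h x))
  rw [inner_eq_of_orthonormal a b c x j]
  have g2 := F.le
  rw [real_inner_comm] at g2
  refine (abs_mul_add_mul_le h1 g2 h2 (abs_inner_le_one F.norm_j b)).trans ?_
  have : D.L h * D.q h x * (A * (D.l h / D.L h)) = D.q h x * A * D.l h := by field_simp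
  linarith

end Aligned

namespace Core

/-- Bounds for subgradients in an aligned frame. -/
lemma exists_frame_bound (hC : 1 ≤ C) {A : ℝ} (hA : 0 ≤ A) :
    ∃ C' h₁ : ℝ, 1 ≤ C' ∧ 0 < h₁ ∧ h₁ ≤ 1 ∧ ∀ D, Core δ D → Ctl C D → Ctl C D.swap →
      ∀ h ∈ Ioc (0 : ℝ) h₁, ∀ i j, Aligned D A h i j → ∀ x y, SubgradAt D.u x y →
        |⟪x, i⟫| ≤ D.L h → |⟪x, j⟫| ≤ D.l h →
        |⟪y, i⟫| ≤ C' * D.l h ∧ |⟪y, j⟫| ≤ C' * D.L h := by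
  obtain ⟨C', h₁, h0, h1, h2, h3⟩ := exists_subgrad_bound (δ := δ) hC (K := 1 + A) (by positivity)
  refine ⟨(1 + A) * C' + 1, h₁, by nlinarith, h1, h2, fun D H B B' h hh i j F x y hxy hi hj => ?_⟩
  have hh' : h ∈ Ioc (0 : ℝ) 1 := ⟨hh.1, hh.2.trans h2⟩
  have hx := F.q_le H hh' hA (r := 1) (x := x) (by simpa) (by simpa)
  rw [mul_one] at hx
  have hy := h3 D H B B' h hh x y hxy hx
  have G := F.swap H hh'
  have k1 := G.abs_inner_j_le H.swap hh' y
  have k2 := G.abs_inner_i_le H.swap hh' hA y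
  have l0 := H.l_pos hh'
  have L0 := H.L_pos hh'
  constructor
  · refine k1.trans ?_
    change _ * D.l h ≤ _
    have : (1 + A) * D.swap.q h y ≤ (1 + A) * C' := by gcongr
    gcongr
    linarith
  · refine k2.trans ?_
    change _ * D.L h ≤ _
    have : (1 + A) * D.swap.q h y ≤ (1 + A) * C' := by gcongr
    gcongr
    linarith

/-- Lower bound for the pairing in an aligned frame. -/
lemma exists_frame_inner_lower (hC : 1 ≤ C) {A c : ℝ} (hA : 0 ≤ A) (hc : 0 < c) :
    ∃ ε : ℝ, 0 < ε ∧ ∀ D, Core δ D → Ctl C D → Ctl C D.swap → ∀ h ∈ Ioc (0 : ℝ) 1,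
      ∀ i j, Aligned D A h i j → ∀ x y, SubgradAt D.v y x →
        (c * D.L h ≤ |⟪x, i⟫| ∨ c * D.l h ≤ |⟪x, j⟫|) → ε * h ≤ ⟪x, y⟫ := by
  obtain ⟨ε, hε, hG⟩ := exists_inner_lower (δ := δ) hC (c := c / (1 + A)) (by positivity)
  refine ⟨ε, hε, fun D H B B' h hh i j F x y hxy hx => ?_⟩
  have l0 := H.l_pos hh
  have L0 := H.L_pos hh
  rw [real_inner_comm]
  refine hG D.swap H.swap B' B h hh y x hxy ?_
  change _ ≤ D.q h x
  rw [div_le_iff₀ (by positivity)]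
  have k1 := F.abs_inner_j_le H hh x
  have k2 := F.abs_inner_i_le H hh hA x
  rcases hx with hx | hx
  · have := le_of_mul_le_mul_right (hx.trans k2) L0
    linarith
  · have := le_of_mul_le_mul_right (hx.trans k1) l0
    linarith

end Core

/-- There is a contact pair `(a, y)` with `a` at height `l` in the direction `j` and
`y` at height comparable with `L` in the direction `j`, both having small `i`-coordinate. -/
def HasPoint (D : Dat) (ε C' K L l : ℝ) (i j : R2) : Prop :=
  ∃ a ∈ D.O₁, ∃ y ∈ D.O₂, SubgradAt D.u a y ∧ SubgradAt D.v y a ∧ ⟪a, j⟫ = l ∧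
    |⟪a, i⟫| ≤ K * l ∧ |⟪y, i⟫| ≤ C' * l ∧ ε * L ≤ ⟪y, j⟫ ∧ ⟪y, j⟫ ≤ C' * L

namespace Core

lemma l_le_of_le (H : Core δ D) {h c : ℝ} (hh : h ∈ Ioc (0 : ℝ) 1) (hc : 0 < c) (hhc : h ≤ c ^ 2) :
    D.l h ≤ c := by
  obtain ⟨-, -, -, l0, lL, e⟩ := H.axes h hh
  have : D.l h * D.l h ≤ D.L h * D.l h := by gcongr
  exact le_of_sq_le_sq (by linarith [sq (D.l h)]) hc.le

lemma exists_hasPoint (hC : 1 ≤ C) {A : ℝ} (hA : 0 ≤ A) :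
    ∃ ε C' : ℝ, 0 < ε ∧ 1 ≤ C' ∧ ∀ cp Cp : ℝ, 0 < cp → 0 ≤ Cp → ∃ η₀ h₁ : ℝ, 0 < η₀ ∧ 0 < h₁ ∧
      h₁ ≤ 1 ∧ ∀ D, Core δ D → Ctl C D → Ctl C D.swap → ∀ h ∈ Ioc (0 : ℝ) h₁, ∀ i j,
        Aligned D A h i j → η₀ * D.l h ≤ D.L h → ∀ z ∈ D.O₁, cp ≤ ⟪z, j⟫ → ‖z‖ ≤ Cp →
        HasPoint D ε C' (Cp / cp) (D.L h) (D.l h) i j := by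
  obtain ⟨C', h₁, hC', hh₁, hh₁', hB⟩ := exists_frame_bound (δ := δ) hC hA
  obtain ⟨ε, hε, hG⟩ := exists_frame_inner_lower (δ := δ) hC hA one_pos
  refine ⟨ε / 2, C', by positivity, hC', fun cp Cp hcp hCp => ?_⟩
  have hK : 0 ≤ Cp / cp := by positivity
  refine ⟨max 1 (max (Cp / cp) (2 * (Cp / cp) * C' / ε)), min h₁ (cp ^ 2),
    lt_of_lt_of_le one_pos (le_max_left _ _), by positivity, (min_le_left _ _).trans hh₁',
    fun D H B B' h hh i j F hη z hz hzj hzn => ?_⟩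
  set K := Cp / cp with hKd
  have hhh : h ∈ Ioc (0 : ℝ) 1 := ⟨hh.1, hh.2.trans ((min_le_left _ _).trans hh₁')⟩
  have l0 := H.l_pos hhh
  have L0 := H.L_pos hhh
  have Ll := H.L_mul_l hhh
  have hl : D.l h ≤ cp := H.l_le_of_le hhh hcp (hh.2.trans (min_le_right _ _))
  have hzj0 : 0 < ⟪z, j⟫ := hcp.trans_le hzj
  have ht : 0 < D.l h / ⟪z, j⟫ := by positivity
  have ha : (D.l h / ⟪z, j⟫) • z ∈ D.O₁ :=
    H.smul_mem hz ht ((div_le_one hzj0).2 (hl.trans hzj))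
  obtain ⟨y, hy, hay, hya⟩ := H.half.exists_dual _ ha
  set a := (D.l h / ⟪z, j⟫) • z with had
  have haj : ⟪a, j⟫ = D.l h := by
    rw [had, real_inner_smul_left]; field_simp
  have hai : |⟪a, i⟫| ≤ K * D.l h := by
    rw [had, real_inner_smul_left, abs_mul, abs_of_pos ht]
    have : |⟪z, i⟫| ≤ Cp := by
      have := abs_real_inner_le_norm z i
      rw [F.norm_i, mul_one] at this
      exact this.trans hzn
    calc D.l h / ⟪z, j⟫ * |⟪z, i⟫| ≤ D.l h / cp * Cp := by gcongr
      _ = K * D.l h := by rw [hKd]; ring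
  have hη1 : K * D.l h ≤ D.L h := by
    refine le_trans ?_ hη
    gcongr
    exact (le_max_left _ _).trans (le_max_right _ _)
  have hη2 : K * C' * D.l h ≤ ε / 2 * D.L h := by
    have : 2 * K * C' / ε * D.l h ≤ D.L h := by
      refine le_trans ?_ hη
      gcongr
      exact (le_max_right _ _).trans (le_max_right _ _)
    rw [div_mul_eq_mul_div, div_le_iff₀ hε] at this
    linarith
  obtain ⟨b1, b2⟩ := hB D H B B' h ⟨hh.1, hh.2.trans (min_le_left _ _)⟩ i j F a y hay
    (hai.trans hη1) (by rw [haj, abs_of_pos l0])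
  have g := hG D H B B' h hhh i j F a y hya (Or.inr (by rw [haj, abs_of_pos l0, one_mul]))
  refine ⟨a, ha, y, hy, hay, hya, haj, hai, b1, ?_, (le_abs_self _).trans b2⟩
  rw [inner_eq_of_orthonormal F.norm_i F.norm_j F.inner_ij, haj] at g
  have g1 : ⟪a, i⟫ * ⟪y, i⟫ ≤ K * D.l h * (C' * D.l h) := by
    refine (le_abs_self _).trans ?_
    rw [abs_mul]
    gcongr
  have g2 : (ε / 2 * D.L h) * D.l h ≤ ⟪y, j⟫ * D.l h := by
    have := mul_le_mul_of_nonneg_right hη2 l0.le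
    have : ε * (D.L h * D.l h) = ε * h := by rw [Ll]
    linarith
  exact le_of_mul_le_mul_right g2 l0

end Core

/-- A rotation by a right angle. -/
structure IsRot (R : R2 →ₗ[ℝ] R2) : Prop where
  sq : ∀ x, R (R x) = -x
  inner : ∀ x y, ⟪R x, R y⟫ = ⟪x, y⟫

namespace IsRot

variable {R : R2 →ₗ[ℝ] R2}

lemma inner_left (hR : IsRot R) (x y : R2) : ⟪R x, y⟫ = -⟪x, R y⟫ := by
  rw [← hR.inner (R x) y, hR.sq, inner_neg_left]

lemma inner_self (hR : IsRot R) (x : R2) : ⟪x, R x⟫ = 0 := by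
  have := hR.inner_left x x
  rw [real_inner_comm] at this
  linarith

lemma norm (hR : IsRot R) (x : R2) : ‖R x‖ = ‖x‖ := by
  rw [← sq_eq_sq₀ (norm_nonneg _) (norm_nonneg _), ← real_inner_self_eq_norm_sq, hR.inner,
    real_inner_self_eq_norm_sq]

lemma neg (hR : IsRot R) : IsRot (-R) :=
  ⟨fun x => by simp [hR.sq], fun x y => by simp [hR.inner]⟩

end IsRot

lemma exists_sign_close {w a b : R2} {τ : ℝ} (hw : ‖w‖ = 1) (ha : ‖a‖ = 1) (hb : ‖b‖ = 1)
    (hab : ⟪a, b⟫ = 0) (ht : |⟪w, b⟫| ≤ τ) :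
    ∃ σ : ℝ, (σ = 1 ∨ σ = -1) ∧ ‖σ • w - a‖ ≤ 2 * τ := by
  have key : ∀ w' : R2, ‖w'‖ = 1 → |⟪w', b⟫| ≤ τ → 0 ≤ ⟪w', a⟫ → ‖w' - a‖ ≤ 2 * τ := by
    intro w' hw' ht' hs
    have h1 := inner_eq_of_orthonormal ha hb hab w' w'
    rw [real_inner_self_eq_norm_sq, hw'] at h1
    have h2 := eq_add_smul_of_orthonormal ha hb hab w'
    have h3 := (abs_le.1 (abs_inner_le_one hw' ha)).2
    have e : w' - a = (⟪w', a⟫ - 1) • a + ⟪w', b⟫ • b := by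
      conv_lhs => rw [h2]
      module
    have h4 : |⟪w', a⟫ - 1| ≤ |⟪w', b⟫| := by
      rw [← sq_le_sq]
      nlinarith
    rw [e]
    refine (norm_add_le _ _).trans ?_
    rw [norm_smul, norm_smul, ha, hb, Real.norm_eq_abs, Real.norm_eq_abs]
    linarith
  rcases le_total 0 ⟪w, a⟫ with hs | hs
  · exact ⟨1, Or.inl rfl, by rw [one_smul]; exact key w hw ht hs⟩
  · refine ⟨-1, Or.inr rfl, ?_⟩
    rw [neg_one_smul]
    exact key (-w) (by simpa) (by simpa) (by simpa)

/-- One-sided alignment of a supporting normal of `O₂` from a contact point. -/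
lemma HasPoint.neg_le_inner {ε C' K L l : ℝ} {i ik jk : R2} (hp : HasPoint D ε C' K L l ik jk)
    (hε : 0 < ε) (hL : 0 < L) (hl : 0 < l) (hC' : 0 ≤ C') (hi : ‖i‖ = 1) (hik : ‖ik‖ = 1)
    (hjk : ‖jk‖ = 1) (hijk : ⟪ik, jk⟫ = 0) (hO : ∀ y ∈ D.O₂, 0 ≤ ⟪y, i⟫) :
    -(C' / ε * (l / L)) ≤ ⟪i, jk⟫ := by
  obtain ⟨a, ha, y, hy, -, -, -, -, hy1, hy2, -⟩ := hp
  have h1 := hO y hy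
  rw [inner_eq_of_orthonormal hik hjk hijk] at h1
  by_contra! hcon
  have h2 : ⟪y, ik⟫ * ⟪i, ik⟫ ≤ C' * l * 1 := by
    refine (le_abs_self _).trans ?_
    rw [abs_mul]
    gcongr
    exact abs_inner_le_one hi hik
  have hneg : ⟪i, jk⟫ ≤ 0 := hcon.le.trans (by simp; positivity)
  have h3 : ⟪y, jk⟫ * ⟪i, jk⟫ ≤ ε * L * ⟪i, jk⟫ := mul_le_mul_of_nonpos_right hy2 hneg
  have h4 : ε * L * ⟪i, jk⟫ < ε * L * -(C' / ε * (l / L)) := by gcongr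
  have e : ε * L * -(C' / ε * (l / L)) = -(C' * l) := by field_simp
  linarith

namespace Core

/-- Comparison of the axes at two comparable heights. -/
lemma axes_comparison (H : Core δ D) (B : Ctl C D) {h k M : ℝ} (hh : h ∈ Ioc (0 : ℝ) 1)
    (hk : k ∈ Ioc (0 : ℝ) 1) (hkh : k ≤ h) (hM : h ≤ M * k) :
    D.L h ≤ 2 * C * M * D.L k ∧ D.l k ≤ 2 * C * M * D.l h ∧
      |⟪D.e k, D.f h⟫| ≤ 2 * C ^ 2 * M * (D.l h / D.L h) := by
  obtain ⟨a, b, c, l0, lL, e⟩ := H.axes h hh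
  obtain ⟨a', b', c', l0', lL', e'⟩ := H.axes k hk
  have L0 := H.L_pos hh
  have L0' := H.L_pos hk
  have hC := B.one_le
  have hk0 := hk.1
  have hM1 : 1 ≤ M := by
    by_contra! hcon
    have := mul_lt_mul_of_pos_right hcon hk0
    linarith
  have h1 : D.L h ≤ 2 * C * M * D.L k := by
    have q1 : D.q h (D.L h • D.e h) ≤ 1 := by
      rw [H.q_le_iff hh, real_inner_smul_left, real_inner_smul_left, real_inner_self_eq_norm_sq, a,
        c]
      simp [abs_of_pos L0, l0.le]
    have q2 := q_le_of_ge B hh hk hkh (D.L h • D.e h)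
    have q3 := H.norm_le_q hk (D.L h • D.e h)
    rw [norm_smul, a, Real.norm_eq_abs, abs_of_pos L0, mul_one] at q3
    have q4 : D.q k (D.L h • D.e h) ≤ C * M * 1 := by
      have := H.q_nonneg hh (D.L h • D.e h)
      refine q2.trans ?_
      gcongr
      rwa [div_le_iff₀ hk0]
    have q0 := H.q_nonneg hk (D.L h • D.e h)
    calc D.L h ≤ (D.L k + D.L k) * (C * M * 1) := by refine q3.trans ?_; gcongr
      _ = _ := by ring
  refine ⟨h1, ?_, ?_⟩
  · have : D.L h * D.l k ≤ D.L h * (2 * C * M * D.l h) := by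
      calc D.L h * D.l k ≤ 2 * C * M * D.L k * D.l k := by gcongr
        _ = 2 * C * M * k := by linear_combination (2 * C * M) * e'
        _ ≤ 2 * C * M * h := by gcongr
        _ = _ := by linear_combination -(2 * C * M) * e
    exact le_of_mul_le_mul_left this L0
  · have q1 : D.q k (D.L k • D.e k) ≤ 1 := by
      rw [H.q_le_iff hk, real_inner_smul_left, real_inner_smul_left, real_inner_self_eq_norm_sq,
        a', c']
      simp [abs_of_pos L0', l0'.le]
    have q2 := q_le_of_le B hk hh hkh (D.L k • D.e k)
    have q3 := ((H.q_le_iff hh).1 (q2.trans (mul_le_mul_of_nonneg_left q1 (by positivity)))).2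
    rw [real_inner_smul_left, abs_mul, abs_of_pos L0', mul_one] at q3
    have : |⟪D.e k, D.f h⟫| * D.L h ≤ 2 * C ^ 2 * M * D.l h := by
      calc |⟪D.e k, D.f h⟫| * D.L h ≤ |⟪D.e k, D.f h⟫| * (2 * C * M * D.L k) := by gcongr
        _ = 2 * C * M * (D.L k * |⟪D.e k, D.f h⟫|) := by ring
        _ ≤ 2 * C * M * (D.l h * C) := by gcongr
        _ = _ := by ring
    rw [← mul_div_assoc, le_div_iff₀ L0]
    exact this

/-- If a frame is exactly aligned at height `h`, then so is a nearby frame at any comparable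
smaller height. -/
lemma exists_close_frame (H : Core δ D) (B : Ctl C D) {h k M ω : ℝ} (hh : h ∈ Ioc (0 : ℝ) 1)
    (hk : k ∈ Ioc (0 : ℝ) 1) (hkh : k ≤ h) (hM : h ≤ M * k) (hω : 0 < ω)
    (hη : 4 * C ^ 2 * M / ω * D.l h ≤ D.L h) {R : R2 →ₗ[ℝ] R2} (hR : IsRot R) {ih : R2}
    (F : Aligned D 0 h ih (R ih)) :
    ∃ ik, Aligned D 0 k ik (R ik) ∧ ‖ik - ih‖ ≤ ω ∧ ‖R ik - R ih‖ ≤ ω := by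
  obtain ⟨-, -, h3⟩ := H.axes_comparison B hh hk hkh hM
  obtain ⟨a, b, c, l0, lL, e⟩ := H.axes h hh
  obtain ⟨a', b', c', l0', lL', e'⟩ := H.axes k hk
  have L0 := H.L_pos hh
  have h0 : ⟪R ih, D.e h⟫ = 0 := by
    have := F.le
    rw [zero_mul] at this
    rw [real_inner_comm]
    exact abs_nonpos_iff.1 this
  have h4 : |⟪D.e k, R ih⟫| ≤ ω / 2 := by
    rw [real_inner_comm, inner_eq_of_orthonormal a b c, h0, zero_mul, zero_add, abs_mul]
    calc |⟪R ih, D.f h⟫| * |⟪D.e k, D.f h⟫| ≤ 1 * (2 * C ^ 2 * M * (D.l h / D.L h)) := by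
          gcongr
          exact abs_inner_le_one F.norm_j b
      _ ≤ ω / 2 := by
          rw [one_mul, ← mul_div_assoc, div_le_iff₀ L0]
          rw [div_mul_eq_mul_div, div_le_iff₀ hω] at hη
          linarith
  obtain ⟨σ, hσ, hcl⟩ := exists_sign_close a' F.norm_i F.norm_j F.inner_ij h4
  have hn : ‖σ • D.e k‖ = 1 := by
    rw [norm_smul, a']; rcases hσ with rfl | rfl <;> simp
  refine ⟨σ • D.e k, ⟨hn, by rw [hR.norm, hn], hR.inner_self _, ?_⟩, by linarith, ?_⟩
  · rw [map_smul, real_inner_smul_right, hR.inner_self]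
    simp
  · rw [← map_sub, hR.norm]
    linarith

end Core

lemma Aligned.of_inner_le {A k : ℝ} {ik jk i j : R2} (H : Core δ D) (hk : k ∈ Ioc (0 : ℝ) 1)
    (F : Aligned D 0 k ik jk) (hi : ‖i‖ = 1) (hj : ‖j‖ = 1) (hij : ⟪i, j⟫ = 0)
    (h : |⟪i, jk⟫| ≤ A * (D.l k / D.L k)) : Aligned D A k i j := by
  obtain ⟨a, -, -, -⟩ := H.axes k hk
  refine ⟨hi, hj, hij, le_trans ?_ h⟩
  have h0 : ⟪D.e k, jk⟫ = 0 := by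
    have := F.le
    rw [zero_mul] at this
    exact abs_nonpos_iff.1 this
  rw [inner_eq_of_orthonormal F.norm_i F.norm_j F.inner_ij, h0, zero_mul, add_zero, abs_mul,
    abs_inner_eq_of_orthonormal hi hj hij F.norm_i F.norm_j F.inner_ij]
  exact mul_le_of_le_one_left (abs_nonneg _) (abs_inner_le_one a F.norm_i)

lemma abs_inner_sub_le {z a b : R2} {Cp cp : ℝ} (hCp : 0 ≤ Cp) (hcp : 0 < cp) (hz : ‖z‖ ≤ Cp)
    (h : ‖a - b‖ ≤ cp / (2 * (Cp + 1))) : |⟪z, a⟫ - ⟪z, b⟫| ≤ cp / 2 := by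
  rw [← inner_sub_right]
  calc |⟪z, a - b⟫| ≤ ‖z‖ * ‖a - b‖ := abs_real_inner_le_norm _ _
    _ ≤ (Cp + 1) * (cp / (2 * (Cp + 1))) := by gcongr; linarith
    _ = cp / 2 := by field_simp

namespace Core

lemma exists_threshold (hC : 1 ≤ C) {ω M η : ℝ} (hω : 0 < ω) (hM : 1 ≤ M) (hη : 0 < η) :
    ∃ η₀ : ℝ, 0 < η₀ ∧ ∀ D, Core δ D → Ctl C D → ∀ h ∈ Ioc (0 : ℝ) 1, η₀ * D.l h ≤ D.L h →
      ∀ k, 0 < k → k ≤ h → h ≤ M * k → η * D.l k ≤ D.L k ∧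
        ∀ R, IsRot R → ∀ ih, Aligned D 0 h ih (R ih) →
          ∃ ik, Aligned D 0 k ik (R ik) ∧ ‖ik - ih‖ ≤ ω ∧ ‖R ik - R ih‖ ≤ ω := by
  refine ⟨max (4 * C ^ 2 * M / ω) ((2 * C * M) ^ 2 * η), by positivity,
    fun D H B h hh hηh k hk hkh hhk => ?_⟩
  have hk' : k ∈ Ioc (0 : ℝ) 1 := ⟨hk, hkh.trans hh.2⟩
  have l0 := H.l_pos hh
  obtain ⟨h1, h2, -⟩ := H.axes_comparison B hh hk' hkh hhk
  refine ⟨?_, fun R hR ih F => H.exists_close_frame B hh hk' hkh hhk hω ?_ hR F⟩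
  · have h3 : (2 * C * M) ^ 2 * η * D.l h ≤ D.L h := by
      refine le_trans ?_ hηh; gcongr; exact le_max_right _ _
    have : 2 * C * M * (η * D.l k) ≤ 2 * C * M * D.L k := by
      calc 2 * C * M * (η * D.l k) ≤ 2 * C * M * (η * (2 * C * M * D.l h)) := by gcongr
        _ = (2 * C * M) ^ 2 * η * D.l h := by ring
        _ ≤ _ := h3.trans h1
    exact le_of_mul_le_mul_left this (by positivity)
  · refine le_trans ?_ hηh; gcongr; exact le_max_left _ _

/-- Alignment when both domains are supported by the frame. -/
lemma exists_alignA (hC : 1 ≤ C) : ∃ A : ℝ, 0 ≤ A ∧ ∀ cp Cp M : ℝ, 0 < cp → 0 ≤ Cp → 1 ≤ M →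
    ∃ η₀ h₁ : ℝ, 0 < η₀ ∧ 0 < h₁ ∧ h₁ ≤ 1 ∧ ∀ D, Core δ D → Ctl C D → Ctl C D.swap →
      ∀ h ∈ Ioc (0 : ℝ) h₁, η₀ * D.l h ≤ D.L h → ∀ R, IsRot R → ∀ ih, Aligned D 0 h ih (R ih) →
      ∀ i, ‖i‖ = 1 → (∀ y ∈ D.O₂, 0 ≤ ⟪y, i⟫) → (∀ x ∈ D.O₁, 0 ≤ ⟪x, R i⟫) →
      ∀ z₁ ∈ D.O₁, ∀ z₂ ∈ D.O₂, ‖z₁‖ ≤ Cp → ‖z₂‖ ≤ Cp → cp ≤ ⟪z₁, R ih⟫ → cp ≤ ⟪z₂, ih⟫ →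
      ∀ k, 0 < k → k ≤ h → h ≤ M * k → Aligned D A k i (R i) := by
  obtain ⟨ε, C', hε, hC', hP⟩ := exists_hasPoint (δ := δ) hC (A := 0) le_rfl
  refine ⟨C' / ε, by positivity, fun cp Cp M hcp hCp hM => ?_⟩
  obtain ⟨η', h₁, hη', hh₁, hh₁', hP⟩ := hP (cp / 2) Cp (by positivity) hCp
  obtain ⟨η₀, hη₀, hT⟩ := exists_threshold (δ := δ) hC (ω := cp / (2 * (Cp + 1))) (by positivity)
    hM hη'
  refine ⟨η₀, h₁, hη₀, hh₁, hh₁', fun D H B B' h hh hη R hR ih F i hi hO₂ hO₁ z₁ hz₁ z₂ hz₂ hn₁ hn₂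
    hc₁ hc₂ k hk hkh hhk => ?_⟩
  obtain ⟨hηk, hT⟩ := hT D H B h ⟨hh.1, hh.2.trans hh₁'⟩ hη k hk hkh hhk
  obtain ⟨ik, Fk, e1, e2⟩ := hT R hR ih F
  have hk1 : k ∈ Ioc (0 : ℝ) h₁ := ⟨hk, hkh.trans hh.2⟩
  have hk' : k ∈ Ioc (0 : ℝ) 1 := ⟨hk, hk1.2.trans hh₁'⟩
  have d1 := abs_le.1 (abs_inner_sub_le hCp hcp hn₁ e2)
  have d2 := abs_le.1 (abs_inner_sub_le hCp hcp hn₂ e1)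
  have p1 := hP D H B B' k hk1 ik (R ik) Fk hηk z₁ hz₁ (by linarith) hn₁
  have p2 := hP D.swap H.swap B' B k hk1 (R ik) ik (Fk.swap H hk') hηk z₂ hz₂ (by linarith) hn₂
  have L0 := H.L_pos hk'
  have l0 := H.l_pos hk'
  have hRi : ‖R i‖ = 1 := by rw [hR.norm, hi]
  have g1 := p1.neg_le_inner hε L0 l0 (by linarith) hi Fk.norm_i Fk.norm_j Fk.inner_ij hO₂
  have g2 := p2.neg_le_inner hε L0 l0 (by linarith) hRi Fk.norm_j Fk.norm_i
    (by rw [real_inner_comm]; exact Fk.inner_ij) hO₁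
  rw [hR.inner_left, neg_le_neg_iff] at g2
  exact .of_inner_le H hk' Fk hi hRi (hR.inner_self i) (abs_le.2 ⟨g1, g2⟩)

/-- Alignment when `O₁` has points far on both sides of the long axis. -/
lemma exists_alignB (hC : 1 ≤ C) : ∃ A : ℝ, 0 ≤ A ∧ ∀ cp Cp M : ℝ, 0 < cp → 0 ≤ Cp → 1 ≤ M →
    ∃ η₀ h₁ : ℝ, 0 < η₀ ∧ 0 < h₁ ∧ h₁ ≤ 1 ∧ ∀ D, Core δ D → Ctl C D → Ctl C D.swap →
      ∀ h ∈ Ioc (0 : ℝ) h₁, η₀ * D.l h ≤ D.L h → ∀ R, IsRot R → ∀ ih, Aligned D 0 h ih (R ih) →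
      ∀ i, ‖i‖ = 1 → (∀ y ∈ D.O₂, 0 ≤ ⟪y, i⟫) →
      ∀ z₁ ∈ D.O₁, ∀ z₂ ∈ D.O₁, ‖z₁‖ ≤ Cp → ‖z₂‖ ≤ Cp → cp ≤ ⟪z₁, R ih⟫ → ⟪z₂, R ih⟫ ≤ -cp →
      ∃ j, cp / 2 ≤ ⟪z₁, j⟫ ∧ ⟪z₂, j⟫ ≤ -(cp / 2) ∧
        ∀ k, 0 < k → k ≤ h → h ≤ M * k → Aligned D A k i j := by
  obtain ⟨ε, C', hε, hC', hP⟩ := exists_hasPoint (δ := δ) hC (A := 0) le_rfl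
  refine ⟨C' / ε, by positivity, fun cp Cp M hcp hCp hM => ?_⟩
  obtain ⟨η', h₁, hη', hh₁, hh₁', hP⟩ := hP (cp / 2) Cp (by positivity) hCp
  set ω := cp / (2 * (Cp + 1)) with hω
  have hω0 : 0 < ω := by positivity
  obtain ⟨η₀, hη₀, hT⟩ := exists_threshold (δ := δ) hC hω0 hM
    (η := max η' (2 * (C' / ε) / ω)) (lt_max_of_lt_left hη')
  refine ⟨η₀, h₁, hη₀, hh₁, hh₁', fun D H B B' h hh hη R hR ih F i hi hO₂ z₁ hz₁ z₂ hz₂ hn₁ hn₂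
    hc₁ hc₂ => ?_⟩
  have hh' : h ∈ Ioc (0 : ℝ) 1 := ⟨hh.1, hh.2.trans hh₁'⟩
  have hRi : ‖R i‖ = 1 := by rw [hR.norm, hi]
  have key : ∀ k, 0 < k → k ≤ h → h ≤ M * k → ∀ ik, Aligned D 0 k ik (R ik) →
      ‖R ik - R ih‖ ≤ ω → |⟪i, R ik⟫| ≤ C' / ε * (D.l k / D.L k) := by
    intro k hk hkh hhk ik Fk e2
    have hk1 : k ∈ Ioc (0 : ℝ) h₁ := ⟨hk, hkh.trans hh.2⟩
    have hk' : k ∈ Ioc (0 : ℝ) 1 := ⟨hk, hk1.2.trans hh₁'⟩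
    have L0 := H.L_pos hk'
    have l0 := H.l_pos hk'
    have hηk : η' * D.l k ≤ D.L k := by
      refine le_trans ?_ (hT D H B h hh' hη k hk hkh hhk).1
      gcongr; exact le_max_left _ _
    have d1 := abs_le.1 (abs_inner_sub_le hCp hcp hn₁ e2)
    have d2 := abs_le.1 (abs_inner_sub_le hCp hcp hn₂ e2)
    have p1 := hP D H B B' k hk1 ik (R ik) Fk hηk z₁ hz₁ (by linarith) hn₁
    have p2 := hP D H B B' k hk1 ik (-R ik) Fk.neg_right hηk z₂ hz₂
      (by rw [inner_neg_right]; linarith) hn₂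
    have g1 := p1.neg_le_inner hε L0 l0 (by linarith) hi Fk.norm_i Fk.norm_j Fk.inner_ij hO₂
    have g2 := p2.neg_le_inner hε L0 l0 (by linarith) hi Fk.norm_i Fk.neg_right.norm_j
      Fk.neg_right.inner_ij hO₂
    rw [inner_neg_right, neg_le_neg_iff] at g2
    exact abs_le.2 ⟨g1, g2⟩
  have al : ∀ k, 0 < k → k ≤ h → h ≤ M * k → Aligned D (C' / ε) k i (R i) := by
    intro k hk hkh hhk
    obtain ⟨ik, Fk, -, e2⟩ := (hT D H B h hh' hη k hk hkh hhk).2 R hR ih F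
    exact .of_inner_le H ⟨hk, hkh.trans hh'.2⟩ Fk hi hRi (hR.inner_self i)
      (key k hk hkh hhk ik Fk e2)
  have hhM : h ≤ M * h := le_mul_of_one_le_left hh.1.le hM
  have L0 := H.L_pos hh'
  have hsmall : |⟪R i, ih⟫| ≤ ω / 2 := by
    rw [hR.inner_left, abs_neg]
    refine (key h hh.1 le_rfl hhM ih F (by simpa using hω0.le)).trans ?_
    have h3 : 2 * (C' / ε) / ω * D.l h ≤ D.L h := by
      have l0 := H.l_pos hh'
      refine le_trans ?_ (hT D H B h hh' hη h hh.1 le_rfl hhM).1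
      gcongr; exact le_max_right _ _
    rw [div_mul_eq_mul_div, div_le_iff₀ hω0] at h3
    rw [← mul_div_assoc, div_le_iff₀ L0]
    linarith
  obtain ⟨σ, hσ, hcl⟩ := exists_sign_close hRi F.norm_j F.norm_i
    (by rw [real_inner_comm]; exact F.inner_ij) hsmall
  have hcl' : ‖σ • R i - R ih‖ ≤ ω := by linarith
  have d1 := abs_le.1 (abs_inner_sub_le hCp hcp hn₁ hcl')
  have d2 := abs_le.1 (abs_inner_sub_le hCp hcp hn₂ hcl')
  refine ⟨σ • R i, by linarith, by linarith, fun k hk hkh hhk => ?_⟩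
  rcases hσ with rfl | rfl
  · rw [one_smul]; exact al k hk hkh hhk
  · rw [neg_one_smul]; exact (al k hk hkh hhk).neg_right

end Core

lemma le_of_monotone_pair {x1 x2 y1 y2 a1 l b1 b2 ε C' K L : ℝ} (hε : 0 < ε) (hL : 0 < L)
    (hl : 0 < l) (hC' : 0 ≤ C') (hm : 0 ≤ (x1 - a1) * (y1 - b1) + (x2 - l) * (y2 - b2))
    (ha1 : |a1| ≤ K * l) (hb1 : |b1| ≤ C' * l) (hb2 : ε * L ≤ b2) (hK : K * l ≤ ε / 8 * L)
    (hx1 : |x1| ≤ ε / 8 * L) (hy2 : |y2| ≤ ε / 8 * L) : x2 ≤ l + (|y1| + C' * l) / 2 := by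
  by_contra! hcon
  have hy := abs_nonneg y1
  have hp : 0 ≤ |y1| + C' * l := by positivity
  have hpos : 0 < x2 - l := by linarith
  have h1 : |x1 - a1| ≤ ε / 4 * L := by
    have := abs_sub x1 a1
    linarith
  have h2 : |y1 - b1| ≤ |y1| + C' * l := (abs_sub y1 b1).trans (by linarith)
  have h3 : (x1 - a1) * (y1 - b1) ≤ ε / 4 * L * (|y1| + C' * l) := by
    refine (le_abs_self _).trans ?_
    rw [abs_mul]
    gcongr
  have h4 : ε / 2 * L ≤ b2 - y2 := by
    have := le_abs_self y2
    have : 0 < ε * L := by positivity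
    linarith
  have h5 : (x2 - l) * (ε / 2 * L) ≤ (x2 - l) * (b2 - y2) := by gcongr
  have h6 : (|y1| + C' * l) / 2 * (ε / 2 * L) < (x2 - l) * (ε / 2 * L) := by
    apply mul_lt_mul_of_pos_right _ (by positivity)
    linarith
  linarith

namespace HasPoint

variable {ε C' K L l : ℝ} {i j x y : R2}

lemma inner_le (hp : HasPoint D ε C' K L l i j) (hi : ‖i‖ = 1) (hj : ‖j‖ = 1) (hij : ⟪i, j⟫ = 0)
    (hε : 0 < ε) (hL : 0 < L) (hl : 0 < l) (hC' : 0 ≤ C') (hK : K * l ≤ ε / 8 * L)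
    (hxy : SubgradAt D.u x y) (hx : |⟪x, i⟫| ≤ ε / 8 * L) (hy : |⟪y, j⟫| ≤ ε / 8 * L) :
    ⟪x, j⟫ ≤ l + (|⟪y, i⟫| + C' * l) / 2 := by
  obtain ⟨a, -, b, -, hab, -, h1, h2, h3, h4, -⟩ := hp
  have hm := hxy.inner_sub_nonneg hab
  rw [inner_eq_of_orthonormal hi hj hij] at hm
  simp only [inner_sub_left, h1] at hm
  exact le_of_monotone_pair hε hL hl hC' hm h2 h3 h4 hK hx hy

lemma inner_le_swap (hp : HasPoint D.swap ε C' K L l j i) (hi : ‖i‖ = 1) (hj : ‖j‖ = 1)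
    (hij : ⟪i, j⟫ = 0) (hε : 0 < ε) (hL : 0 < L) (hl : 0 < l) (hC' : 0 ≤ C')
    (hK : K * l ≤ ε / 8 * L) (hxy : SubgradAt D.u x y) (hx : |⟪x, i⟫| ≤ ε / 8 * L)
    (hy : |⟪y, j⟫| ≤ ε / 8 * L) :
    ⟪y, i⟫ ≤ l + (|⟪x, j⟫| + C' * l) / 2 := by
  obtain ⟨b, -, a, -, -, hab, h1, h2, h3, h4, -⟩ := hp
  have hm := hxy.inner_sub_nonneg hab
  rw [inner_eq_of_orthonormal hi hj hij] at hm
  simp only [inner_sub_left, h1] at hm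
  refine le_of_monotone_pair (x1 := ⟪y, j⟫) (a1 := ⟪b, j⟫) (b1 := ⟪a, j⟫) (b2 := ⟪a, i⟫)
    (y2 := ⟪x, i⟫) hε hL hl hC' ?_ h2 h3 h4 hK hy hx
  linarith

end HasPoint

/-- Partial hodograph coordinates: existence of a contact pair with prescribed `⟪x, i⟫`
and `⟪y, j⟫`. -/
lemma exists_contact {u : R2 → ℝ} (hu : ConvexOn ℝ univ u) {i j : R2} (hi : ‖i‖ = 1) (hj : ‖j‖ = 1)
    (hij : ⟪i, j⟫ = 0) {a b ya yb : R2} (ha : SubgradAt u a ya) (hb : SubgradAt u b yb) {t : ℝ}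
    (hat : ⟪ya, j⟫ < t) (htb : t < ⟪yb, j⟫) (s : ℝ) :
    ∃ x y, SubgradAt u x y ∧ ⟪x, i⟫ = s ∧ ⟪y, j⟫ = t := by
  have hcont : Continuous u := continuousOn_univ.1 (hu.continuousOn isOpen_univ)
  have hjj : ⟪j, j⟫ = 1 := by rw [real_inner_self_eq_norm_sq, hj, one_pow]
  have hii : ⟪i, i⟫ = 1 := by rw [real_inner_self_eq_norm_sq, hi, one_pow]
  let g : ℝ → ℝ := fun r => u (s • i + r • j) - t * r
  have hg : Continuous g := by fun_prop
  have lower : ∀ c yc, SubgradAt u c yc → ∀ r,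
      (u c + ⟪yc, s • i - c⟫) + (⟪yc, j⟫ - t) * r ≤ g r := by
    intro c yc hc r
    have := hc (s • i + r • j)
    have e : ⟪yc, s • i + r • j - c⟫ = ⟪yc, s • i - c⟫ + r * ⟪yc, j⟫ := by
      rw [← real_inner_smul_right, ← inner_add_right]
      congr 1
      abel
    simp only [g]
    linarith
  have hlim : Tendsto g (cocompact ℝ) atTop := by
    rw [cocompact_eq_atBot_atTop, tendsto_sup]
    constructor
    · refine tendsto_atTop_mono (lower a ya ha) (tendsto_atTop_add_const_left _ _ ?_)
      exact tendsto_id.const_mul_atBot_of_neg (by linarith)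
    · refine tendsto_atTop_mono (lower b yb hb) (tendsto_atTop_add_const_left _ _ ?_)
      exact tendsto_id.const_mul_atTop (by linarith)
  obtain ⟨r₀, hr₀⟩ := hg.exists_forall_le hlim
  obtain ⟨y, hy, hyt⟩ := exists_subgradAt_inner_eq (j := j) (t := t) (x₀ := s • i + r₀ • j) hu (by
    intro r
    have := hr₀ (r₀ + r)
    simp only [g] at this
    have e : s • i + (r₀ + r) • j = s • i + r₀ • j + r • j := by rw [add_smul, add_assoc]
    rw [e] at this
    linarith)
  refine ⟨_, y, hy, ?_, hyt⟩
  rw [inner_add_left, real_inner_smul_left, real_inner_smul_left, hii, real_inner_comm, hij]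
  ring

/-- Two contact pairs on which the monotonicity inequality degenerates. -/
lemma SubgradAt.of_inner_sub_eq_zero {u : R2 → ℝ} {x y x' y' : R2} (h : SubgradAt u x y)
    (h' : SubgradAt u x' y') (he : ⟪x - x', y - y'⟫ = 0) : SubgradAt u x' y := by
  intro z
  have h1 := h z
  have h2 := h' x
  have e1 : ⟪y, z - x⟫ = ⟪y, z - x'⟫ - ⟪y, x - x'⟫ := by rw [← inner_sub_right]; congr 1; abel
  have e2 : ⟪y', x - x'⟫ = ⟪y, x - x'⟫ := by
    rw [real_inner_comm, inner_sub_left, sub_eq_zero] at he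
    exact he.symm
  linarith

/-- The image of the graph of the gradient map over `O₁` in partial hodograph coordinates. -/
def InGraph (D : Dat) (i j : R2) (s t : ℝ) : Prop :=
  ∃ x ∈ D.O₁, ∃ y, SubgradAt D.u x y ∧ ⟪x, i⟫ = s ∧ ⟪y, j⟫ = t

namespace Core

lemma dual_of_mem (H : Core δ D) {x y : R2} (hx : x ∈ D.O₁) (h : SubgradAt D.u x y) :
    y ∈ D.O₂ ∧ SubgradAt D.v y x := by
  obtain ⟨y', hy', h1, h2⟩ := H.half.exists_dual x hx
  obtain rfl := H.half.unique x hx _ _ h h1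
  exact ⟨hy', h2⟩

lemma mem_of_mem_dual (H : Core δ D) {x y : R2} (hy : y ∈ D.O₂) (h : SubgradAt D.u x y) :
    x ∈ D.O₁ := by
  obtain ⟨x', hx', h1, h2⟩ := H.half'.exists_dual y hy
  obtain rfl := H.half.unique' y hy _ _ h h2
  exact hx'

lemma contact_unique (H : Core δ D) {i j : R2} (hi : ‖i‖ = 1) (hj : ‖j‖ = 1) (hij : ⟪i, j⟫ = 0)
    {x y x' y' : R2} (hx' : x' ∈ D.O₁) (h : SubgradAt D.u x y) (h' : SubgradAt D.u x' y')
    (h1 : ⟪x, i⟫ = ⟪x', i⟫) (h2 : ⟪y, j⟫ = ⟪y', j⟫) : x = x' ∧ y = y' := by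
  have he : ⟪x - x', y - y'⟫ = 0 := by
    rw [inner_eq_of_orthonormal hi hj hij]
    simp only [inner_sub_left, h1, h2]
    ring
  have h3 := h.of_inner_sub_eq_zero h' he
  obtain rfl := H.half.unique x' hx' _ _ h3 h'
  exact ⟨H.half.unique' y (H.dual_of_mem hx' h').1 _ _ h h', rfl⟩

lemma inGraph_swap (H : Core δ D) {i j : R2} {s t : ℝ} (h : InGraph D i j s t) :
    InGraph D.swap j i t s := by
  obtain ⟨x, hx, y, hxy, rfl, rfl⟩ := h
  obtain ⟨hy, hyx⟩ := H.dual_of_mem hx hxy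
  exact ⟨y, hy, x, hyx, rfl, rfl⟩

lemma subgradAt_zero (H : Core δ D) : SubgradAt D.u 0 0 := by
  intro z
  rw [H.half.u_zero, inner_zero_left, add_zero]
  exact H.half.u_nonneg z

/-- A contact pair with `y ∉ O₂` obstructs all points to its left. -/
lemma not_inGraph_of_notMem (H : Core δ D) {i j : R2} (hi : ‖i‖ = 1) (hj : ‖j‖ = 1)
    (hij : ⟪i, j⟫ = 0) {x y z : R2} (hxy : SubgradAt D.u x y) (hy : y ∉ D.O₂) (hz : z ∈ D.O₂)
    (hy0 : 0 < ⟪y, j⟫) (hyz : ⟪y, j⟫ ≤ ⟪z, j⟫) (hlt : ⟪y, i⟫ * ⟪z, j⟫ < ⟪y, j⟫ * ⟪z, i⟫) {s : ℝ}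
    (hs : s ≤ ⟪x, i⟫) : ¬ InGraph D i j s ⟪y, j⟫ := by
  rintro ⟨x', hx', y', hxy', rfl, ht⟩
  obtain ⟨μ, hμ⟩ := exists_inner_lt_of_notMem H.half'.convex H.half'.isOpen hy
  have hzj : 0 < ⟪z, j⟫ := hy0.trans_le hyz
  have hc : 0 < ⟪y, j⟫ / ⟪z, j⟫ := by positivity
  have h1 := hμ _ (H.swap.smul_mem hz hc ((div_le_one hzj).2 hyz))
  have hμ1 : 0 < ⟪μ, i⟫ := by
    rw [real_inner_smul_right, inner_eq_of_orthonormal hi hj hij μ y,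
      inner_eq_of_orthonormal hi hj hij μ z] at h1
    have e : ⟪y, j⟫ / ⟪z, j⟫ * (⟪μ, i⟫ * ⟪z, i⟫ + ⟪μ, j⟫ * ⟪z, j⟫) =
      ⟪μ, i⟫ * (⟪y, j⟫ * ⟪z, i⟫ / ⟪z, j⟫) + ⟪μ, j⟫ * ⟪y, j⟫ := by field_simp
    rw [e] at h1
    have h2 : 0 < ⟪y, j⟫ * ⟪z, i⟫ / ⟪z, j⟫ - ⟪y, i⟫ := by
      rw [sub_pos, lt_div_iff₀ hzj]; exact hlt
    have h3 : 0 < ⟪μ, i⟫ * (⟪y, j⟫ * ⟪z, i⟫ / ⟪z, j⟫ - ⟪y, i⟫) := by linarith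
    exact pos_of_mul_pos_left h3 h2.le
  set τ := (⟪x, i⟫ - ⟪x', i⟫) / ⟪μ, i⟫ with hτ
  have hτ0 : 0 ≤ τ := div_nonneg (by linarith) hμ1.le
  have h4 : SubgradAt D.u (x - τ • μ) y :=
    hxy.sub_smul H.half.conv H.half.mem_closure (fun z hz => (hμ z hz).le) hτ0
  have h5 := H.contact_unique hi hj hij hx' h4 hxy' (by
    rw [inner_sub_left, real_inner_smul_left, hτ, div_mul_cancel₀ _ hμ1.ne']; ring) ht.symm
  exact hy (h5.2 ▸ (H.dual_of_mem hx' hxy').1)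

end Core

/-- A frame together with contact points at the scale `(L, l)`. -/
structure Scale (D : Dat) (ε C' K L l : ℝ) (i j : R2) : Prop where
  norm_i : ‖i‖ = 1
  norm_j : ‖j‖ = 1
  inner_ij : ⟪i, j⟫ = 0
  ε_pos : 0 < ε
  one_le : 1 ≤ C'
  L_pos : 0 < L
  l_pos : 0 < l
  K_le : K * l ≤ ε / 8 * L
  pa : HasPoint D ε C' K L l i j
  pb : HasPoint D.swap ε C' K L l j i
  supp : ∀ y ∈ D.O₂, 0 ≤ ⟪y, i⟫

lemma nonneg_of_mem_closure {O : Set R2} {n x : R2} (h : ∀ y ∈ O, 0 ≤ ⟪y, n⟫)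
    (hx : x ∈ closure O) : 0 ≤ ⟪x, n⟫ :=
  closure_minimal (t := {z : R2 | 0 ≤ ⟪z, n⟫}) h
    (isClosed_le continuous_const (by fun_prop)) hx

lemma inner_pos_of_isOpen {O : Set R2} {n x : R2} (hO : IsOpen O) (hn : ‖n‖ = 1)
    (h : ∀ y ∈ O, 0 ≤ ⟪y, n⟫) (hx : x ∈ O) : 0 < ⟪x, n⟫ := by
  obtain ⟨r, hr, hb⟩ := Metric.isOpen_iff.1 hO x hx
  have h1 := h (x - (r / 2) • n) (hb (by
    rw [mem_ball, dist_eq_norm, sub_sub_cancel_left, norm_neg, norm_smul, hn, Real.norm_eq_abs,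
      abs_of_pos (by positivity)]
    linarith))
  rw [inner_sub_left, real_inner_smul_left, real_inner_self_eq_norm_sq, hn] at h1
  linarith

namespace Scale

variable {ε C' K L l : ℝ} {i j : R2}

lemma inner_ji (S : Scale D ε C' K L l i j) : ⟪j, i⟫ = 0 := by
  rw [real_inner_comm]; exact S.inner_ij

lemma swap (S : Scale D ε C' K L l i j) (supp : ∀ x ∈ D.O₁, 0 ≤ ⟪x, j⟫) :
    Scale D.swap ε C' K L l j i :=
  ⟨S.norm_j, S.norm_i, S.inner_ji, S.ε_pos, S.one_le, S.L_pos, S.l_pos, S.K_le, S.pb, S.pa, supp⟩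

lemma inner_y_nonneg (S : Scale D ε C' K L l i j) (H : Core δ D) {x y : R2}
    (h : SubgradAt D.u x y) : 0 ≤ ⟪y, i⟫ :=
  nonneg_of_mem_closure S.supp (H.half.mem_closure x y h)

lemma bound_of_abs (S : Scale D ε C' K L l i j) (H : Core δ D) {x y : R2}
    (h : SubgradAt D.u x y) (hx : |⟪x, i⟫| ≤ ε / 8 * L) (hy : |⟪y, j⟫| ≤ ε / 8 * L)
    (h' : |⟪x, j⟫| ≤ l + (|⟪y, i⟫| + C' * l) / 2) :
    |⟪y, i⟫| ≤ 3 * C' * l ∧ |⟪x, j⟫| ≤ 3 * C' * l := by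
  have hC := S.one_le
  have h1 := S.pb.inner_le_swap S.norm_i S.norm_j S.inner_ij S.ε_pos S.L_pos S.l_pos (by linarith)
    S.K_le h hx hy
  have h2 : l ≤ C' * l := le_mul_of_one_le_left S.l_pos.le hC
  rw [abs_of_nonneg (S.inner_y_nonneg H h)] at *
  constructor <;> linarith

/-- Bounds on contact pairs in the one-sided case. -/
lemma boundA (S : Scale D ε C' K L l i j) (H : Core δ D) {x y : R2} (h : SubgradAt D.u x y)
    (hx : |⟪x, i⟫| ≤ ε / 8 * L) (hy : |⟪y, j⟫| ≤ ε / 8 * L) (hy' : K * l ≤ ⟪y, j⟫) :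
    ⟪y, i⟫ ≤ 3 * C' * l ∧ ⟪x, j⟫ ≤ 3 * C' * l := by
  have hC := S.one_le
  have h1 := S.pa.inner_le S.norm_i S.norm_j S.inner_ij S.ε_pos S.L_pos S.l_pos (by linarith)
    S.K_le h hx hy
  have h1' := S.pb.inner_le_swap S.norm_i S.norm_j S.inner_ij S.ε_pos S.L_pos S.l_pos (by linarith)
    S.K_le h hx hy
  have h2 : l ≤ C' * l := le_mul_of_one_le_left S.l_pos.le hC
  rw [abs_of_nonneg (S.inner_y_nonneg H h)] at h1
  rcases le_or_gt (-(C' * l)) ⟪x, j⟫ with h0 | h0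
  · rcases le_total 0 ⟪x, j⟫ with h3 | h3
    · rw [abs_of_nonneg h3] at h1'
      constructor <;> linarith
    · rw [abs_of_nonpos h3] at h1'
      constructor <;> linarith
  · obtain ⟨b, -, xb, -, -, hab, k1, k2, k3, k4, -⟩ := S.pb
    have hm := h.inner_sub_nonneg hab
    rw [inner_eq_of_orthonormal S.norm_i S.norm_j S.inner_ij] at hm
    simp only [inner_sub_left, k1] at hm
    have k2' := abs_le.1 k2
    have k3' := abs_le.1 k3
    have hx' := abs_le.1 hx
    have hεL : 0 < ε * L := mul_pos S.ε_pos S.L_pos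
    have p1 : (⟪x, j⟫ - ⟪xb, j⟫) * (⟪y, j⟫ - ⟪b, j⟫) ≤ 0 :=
      mul_nonpos_of_nonpos_of_nonneg (by linarith) (by linarith)
    have p2 : ⟪y, i⟫ ≤ l := by
      by_contra! hcon
      have : (⟪x, i⟫ - ⟪xb, i⟫) * (⟪y, i⟫ - l) < 0 :=
        mul_neg_of_neg_of_pos (by linarith) (by linarith)
      linarith
    constructor <;> linarith

/-- Bounds on contact pairs in the two-sided case. -/
lemma boundB (S : Scale D ε C' K L l i j) (H : Core δ D) (pa' : HasPoint D ε C' K L l i (-j))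
    {x y : R2} (h : SubgradAt D.u x y) (hx : |⟪x, i⟫| ≤ ε / 8 * L) (hy : |⟪y, j⟫| ≤ ε / 8 * L) :
    |⟪y, i⟫| ≤ 3 * C' * l ∧ |⟪x, j⟫| ≤ 3 * C' * l := by
  refine S.bound_of_abs H h hx hy ?_
  have h1 := S.pa.inner_le S.norm_i S.norm_j S.inner_ij S.ε_pos S.L_pos S.l_pos
    (by linarith [S.one_le]) S.K_le h hx hy
  have h2 := pa'.inner_le S.norm_i (by rw [norm_neg]; exact S.norm_j)
    (by rw [inner_neg_right, S.inner_ij, neg_zero]) S.ε_pos S.L_pos S.l_pos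
    (by linarith [S.one_le]) S.K_le h hx (by rwa [inner_neg_right, abs_neg])
  rw [inner_neg_right] at h2
  exact abs_le.2 ⟨by linarith, h1⟩

/-- In the two-sided case the partial hodograph coordinates cover a large rectangle. -/
lemma inGraphB (S : Scale D ε C' K L l i j) (H : Core δ D) (pa' : HasPoint D ε C' K L l i (-j))
    {q q' : R2} (hq : q ∈ D.O₁) (hq' : q' ∈ D.O₁) (h1 : ⟪q, j⟫ = 16 * C' * l)
    (h1' : ⟪q', j⟫ = -(16 * C' * l)) (h2 : |⟪q, i⟫| ≤ K * (16 * C' * l))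
    (h2' : |⟪q', i⟫| ≤ K * (16 * C' * l)) {s t : ℝ} (hs : K * (32 * C' * l) ≤ s)
    (hs0 : 0 < s) (hs' : s ≤ ε / 8 * L) (ht : |t| ≤ ε / 8 * L) :
    InGraph D i j s t := by
  have hε := S.ε_pos
  have hL := S.L_pos
  have hl := S.l_pos
  have hεL : 0 < ε * L := by positivity
  have hC := S.one_le
  obtain ⟨a, -, y, -, hay, -, -, -, -, hy2, -⟩ := id S.pa
  obtain ⟨a', -, y', -, hay', -, -, -, -, hy2', -⟩ := id pa'
  rw [inner_neg_right] at hy2'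
  have ht' := abs_le.1 ht
  obtain ⟨x, p, hxp, rfl, rfl⟩ := exists_contact H.half.conv S.norm_i S.norm_j S.inner_ij hay' hay
    (t := t) (by linarith) (by linarith) s
  refine ⟨x, ?_, p, hxp, rfl, rfl⟩
  by_contra hx
  obtain ⟨-, hx2⟩ := S.boundB H pa' hxp (by rwa [abs_of_pos hs0]) ht
  obtain ⟨ν, hν⟩ := exists_inner_lt_of_notMem H.half.convex H.half.isOpen hx
  obtain ⟨b, -, xb, hxb, -, -, -, -, hb1, hb2, -⟩ := id S.pb
  change xb ∈ D.O₁ at hxb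
  have n1 := hν xb hxb
  set T := 16 * C' * l with hT
  have hCl : 0 < C' * l := by positivity
  have hn2 := abs_nonneg ⟪ν, j⟫
  have hx2' := abs_le.1 hx2
  have hb1' := abs_le.1 hb1
  have side : ∃ p ∈ D.O₁, ⟪ν, j⟫ * ⟪p, j⟫ = -(|⟪ν, j⟫| * T) ∧ |⟪p, i⟫| ≤ K * T := by
    rcases le_total 0 ⟪ν, j⟫ with h0 | h0
    · exact ⟨q', hq', by rw [h1', abs_of_nonneg h0]; ring, h2'⟩
    · exact ⟨q, hq, by rw [h1, abs_of_nonpos h0]; ring, h2⟩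
  obtain ⟨p, hp, hp1, hp2⟩ := side
  have n2 := hν p hp
  rw [inner_eq_of_orthonormal S.norm_i S.norm_j S.inner_ij ν x,
    inner_eq_of_orthonormal S.norm_i S.norm_j S.inner_ij ν p] at n2
  rw [inner_eq_of_orthonormal S.norm_i S.norm_j S.inner_ij ν x,
    inner_eq_of_orthonormal S.norm_i S.norm_j S.inner_ij ν xb] at n1
  have hp2' := abs_le.1 hp2
  have hKT : K * T ≤ ⟪x, i⟫ / 2 := by rw [hT]; linarith
  have m1 : -(|⟪ν, j⟫| * (3 * C' * l)) ≤ ⟪ν, j⟫ * ⟪x, j⟫ := by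
    have : |⟪ν, j⟫ * ⟪x, j⟫| ≤ |⟪ν, j⟫| * (3 * C' * l) := by rw [abs_mul]; gcongr
    exact (abs_le.1 this).1
  have m2 : ⟪ν, j⟫ * (⟪xb, j⟫ - ⟪x, j⟫) ≤ |⟪ν, j⟫| * (4 * C' * l) := by
    refine (le_abs_self _).trans ?_
    rw [abs_mul]
    gcongr
    exact abs_le.2 ⟨by linarith, by linarith⟩
  have hneg : 0 < -⟪ν, i⟫ := by
    by_contra! hcon
    have : ⟪ν, i⟫ * ⟪p, i⟫ ≤ ⟪ν, i⟫ * ⟪x, i⟫ := by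
      apply mul_le_mul_of_nonneg_left _ (by linarith)
      linarith
    have : 0 ≤ |⟪ν, j⟫| * (C' * l) := by positivity
    rw [hT] at hp1
    linarith
  have m3 : |⟪ν, j⟫| * (13 * C' * l) ≤ -⟪ν, i⟫ * (3 / 2 * ⟪x, i⟫) := by
    have : -⟪ν, i⟫ * (⟪x, i⟫ - ⟪p, i⟫) ≤ -⟪ν, i⟫ * (3 / 2 * ⟪x, i⟫) := by
      gcongr
      linarith
    rw [hT] at hp1
    linarith
  have m4 : -⟪ν, i⟫ * (7 * ⟪x, i⟫) ≤ -⟪ν, i⟫ * (⟪xb, i⟫ - ⟪x, i⟫) := by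
    gcongr
    linarith
  have m5 : 0 < -⟪ν, i⟫ * ⟪x, i⟫ := by positivity
  have : 0 ≤ |⟪ν, j⟫| * (C' * l) := by positivity
  linarith

/-- In the one-sided case the partial hodograph coordinates cover a large square. -/
lemma inGraphA (S : Scale D ε C' K L l i j) (H : Core δ D) (supp : ∀ x ∈ D.O₁, 0 ≤ ⟪x, j⟫)
    {z₁ z₂ : R2} (hz₁ : z₁ ∈ D.O₁) (hz₂ : z₂ ∈ D.O₂) {L' l' α : ℝ} (hL' : 0 < L')
    (p' : HasPoint D ε C' K L' l' i j) (hα1 : C' * L' ≤ α) (hα2 : K * l' ≤ α) (hα3 : K * l ≤ α)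
    (hα4 : K * l ≤ ε * L') (hα0 : 0 < α) (c1 : 3 * C' * l * ⟪z₂, j⟫ < ε * L' * ⟪z₂, i⟫)
    (c2 : 3 * C' * l * ⟪z₁, i⟫ < α * ⟪z₁, j⟫) (c3 : ε / 8 * L ≤ ⟪z₂, j⟫)
    (c4 : ε / 8 * L ≤ ⟪z₁, i⟫) {s t : ℝ} (hs : α ≤ s) (ht : α ≤ t) (hs' : s ≤ ε / 8 * L)
    (ht' : t ≤ ε / 8 * L) : InGraph D i j s t := by
  by_contra hnot
  have hε := S.ε_pos
  have hεL : 0 < ε * L := mul_pos S.ε_pos S.L_pos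
  have S' := S.swap supp
  have hz₁j : 0 < ⟪z₁, j⟫ := inner_pos_of_isOpen H.half.isOpen S.norm_j supp hz₁
  have hz₂i : 0 < ⟪z₂, i⟫ := inner_pos_of_isOpen H.half'.isOpen S.norm_i S.supp hz₂
  obtain ⟨b, -, xb, -, hb, -, -, -, -, hb1, -⟩ := id S.pb
  obtain ⟨a', ha', y', -, hay', -, -, ha1', -, hy1', hy2'⟩ := id p'
  obtain ⟨a, -, ya, -, ha, -, -, -, -, ha1, -⟩ := id S.pa
  have ha1'' := (abs_le.1 ha1').2
  have hεL' : 0 < ε * L' := by positivity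
  obtain ⟨y, x, hyx, rfl, rfl⟩ := exists_contact H.half'.conv S'.norm_i S'.norm_j S'.inner_ij
    H.swap.subgradAt_zero hb (t := s) (by rw [inner_zero_left]; linarith) (by linarith) t
  have hx : x ∉ D.O₁ := fun hx => hnot (by
    have hy := H.swap.mem_of_mem_dual hx hyx
    exact H.swap.inGraph_swap ⟨y, hy, x, hyx, rfl, rfl⟩)
  have b1 := (S'.boundA H.swap hyx (by rw [abs_of_nonneg] <;> linarith)
    (by rw [abs_of_nonneg] <;> linarith) (by linarith)).1
  have n1 := H.swap.not_inGraph_of_notMem S'.norm_i S'.norm_j S'.inner_ij hyx hx hz₁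
    (by linarith) (by linarith) (by
      calc ⟪x, j⟫ * ⟪z₁, i⟫ ≤ 3 * C' * l * ⟪z₁, i⟫ := by
            apply mul_le_mul_of_nonneg_right b1; linarith
        _ < α * ⟪z₁, j⟫ := c2
        _ ≤ ⟪x, i⟫ * ⟪z₁, j⟫ := by gcongr) (s := ⟪y', j⟫) (by linarith)
  obtain ⟨x₂, y₂, h₂, e1, e2⟩ := exists_contact H.half.conv S.norm_i S.norm_j S.inner_ij
    H.subgradAt_zero ha (t := ⟪y', j⟫) (by rw [inner_zero_left]; linarith) (by linarith) ⟪x, i⟫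
  have hy₂ : y₂ ∉ D.O₂ := fun hy => n1 (by
    have hx₂ := H.mem_of_mem_dual hy h₂
    exact H.inGraph_swap ⟨x₂, hx₂, y₂, h₂, e1, e2⟩)
  have b2 := (S.boundA H h₂ (by rw [abs_of_nonneg] <;> linarith)
    (by rw [abs_of_nonneg] <;> linarith) (by linarith)).1
  have n2 := H.not_inGraph_of_notMem S.norm_i S.norm_j S.inner_ij h₂ hy₂ hz₂
    (by linarith) (by linarith) (by
      calc ⟪y₂, i⟫ * ⟪z₂, j⟫ ≤ 3 * C' * l * ⟪z₂, j⟫ := by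
            apply mul_le_mul_of_nonneg_right b2; linarith
        _ < ε * L' * ⟪z₂, i⟫ := c1
        _ ≤ ⟪y₂, j⟫ * ⟪z₂, i⟫ := by gcongr; linarith) (s := ⟪a', i⟫) (by linarith)
  exact n2 ⟨a', ha', y', hay', rfl, e2.symm⟩

end Scale

/-- Partial hodograph coordinates on a rectangle: `(s, t)` corresponds to the contact pair
`(s • i + r s t • j, p s t • i + t • j)`. -/
structure Hodo (D : Dat) (i j : R2) (I J : Set ℝ) (p r : ℝ → ℝ → ℝ) : Prop where
  norm_i : ‖i‖ = 1
  norm_j : ‖j‖ = 1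
  inner_ij : ⟪i, j⟫ = 0
  mem : ∀ s ∈ I, ∀ t ∈ J, s • i + r s t • j ∈ D.O₁
  sub : ∀ s ∈ I, ∀ t ∈ J, SubgradAt D.u (s • i + r s t • j) (p s t • i + t • j)

lemma inner_frame_left {i j : R2} (hi : ‖i‖ = 1) (hij : ⟪i, j⟫ = 0) (a b : ℝ) :
    ⟪a • i + b • j, i⟫ = a := by
  rw [inner_add_left, real_inner_smul_left, real_inner_smul_left, real_inner_self_eq_norm_sq, hi,
    real_inner_comm, hij]
  ring

lemma inner_frame_right {i j : R2} (hj : ‖j‖ = 1) (hij : ⟪i, j⟫ = 0) (a b : ℝ) :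
    ⟪a • i + b • j, j⟫ = b := by
  rw [inner_add_left, real_inner_smul_left, real_inner_smul_left, real_inner_self_eq_norm_sq, hj,
    hij]
  ring

namespace Hodo

variable {i j : R2} {I J : Set ℝ} {p r : ℝ → ℝ → ℝ}

lemma fst (F : Hodo D i j I J p r) (a b : ℝ) : ⟪a • i + b • j, i⟫ = a :=
  inner_frame_left F.norm_i F.inner_ij a b

lemma snd (F : Hodo D i j I J p r) (a b : ℝ) : ⟪a • i + b • j, j⟫ = b :=
  inner_frame_right F.norm_j F.inner_ij a b

lemma ext (F : Hodo D i j I J p r) {x y : R2} (h1 : ⟪x, i⟫ = ⟪y, i⟫) (h2 : ⟪x, j⟫ = ⟪y, j⟫) :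
    x = y := by
  rw [eq_add_smul_of_orthonormal F.norm_i F.norm_j F.inner_ij x, h1, h2,
    ← eq_add_smul_of_orthonormal F.norm_i F.norm_j F.inner_ij y]

lemma swap (F : Hodo D i j I J p r) (H : Core δ D) :
    Hodo D.swap j i J I (fun t s => r s t) (fun t s => p s t) where
  norm_i := F.norm_j
  norm_j := F.norm_i
  inner_ij := by rw [real_inner_comm]; exact F.inner_ij
  mem t ht s hs := by
    rw [add_comm]
    exact (H.dual_of_mem (F.mem s hs t ht) (F.sub s hs t ht)).1
  sub t ht s hs := by
    rw [add_comm, add_comm (r s t • j)]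
    exact (H.dual_of_mem (F.mem s hs t ht) (F.sub s hs t ht)).2

lemma monotone_pair (F : Hodo D i j I J p r) {s t : ℝ} (hs : s ∈ I) (ht : t ∈ J) {x y : R2}
    (hxy : SubgradAt D.u x y) :
    0 ≤ (⟪x, i⟫ - s) * (⟪y, i⟫ - p s t) + (⟪x, j⟫ - r s t) * (⟪y, j⟫ - t) := by
  have hm := hxy.inner_sub_nonneg (F.sub s hs t ht)
  rw [inner_eq_of_orthonormal F.norm_i F.norm_j F.inner_ij] at hm
  simp only [inner_sub_left, F.fst, F.snd] at hm
  exact hm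

lemma eq_of_contact (F : Hodo D i j I J p r) (H : Core δ D) {s t : ℝ} (hs : s ∈ I) (ht : t ∈ J)
    {x y : R2} (hxy : SubgradAt D.u x y) (h1 : ⟪x, i⟫ = s) (h2 : ⟪y, j⟫ = t) :
    ⟪x, j⟫ = r s t ∧ ⟪y, i⟫ = p s t := by
  obtain ⟨rfl, rfl⟩ := H.contact_unique F.norm_i F.norm_j F.inner_ij (F.mem s hs t ht) hxy
    (F.sub s hs t ht) (by rw [h1, F.fst]) (by rw [h2, F.snd])
  rw [F.fst, F.snd]
  exact ⟨rfl, rfl⟩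

/-- Above the curve `r · c`, the dual variable exceeds `c`. -/
lemma lt_iff (F : Hodo D i j I J p r) (H : Core δ D) {c : ℝ} {x y : R2} (hx : x ∈ D.O₁)
    (hxy : SubgradAt D.u x y) (hs : ⟪x, i⟫ ∈ I) (hc : c ∈ J) :
    r ⟪x, i⟫ c < ⟪x, j⟫ ↔ c < ⟪y, j⟫ := by
  have hm := F.monotone_pair hs hc hxy
  rw [sub_self, zero_mul, zero_add] at hm
  constructor
  · intro h
    refine lt_of_le_of_ne ?_ ?_
    · have := nonneg_of_mul_nonneg_right hm (by linarith)
      linarith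
    · intro e
      exact h.ne' (F.eq_of_contact H hs hc hxy rfl e.symm).1
  · intro h
    refine lt_of_le_of_ne ?_ ?_
    · have := nonneg_of_mul_nonneg_left hm (by linarith)
      linarith
    · intro e
      have hX : x = ⟪x, i⟫ • i + r ⟪x, i⟫ c • j := F.ext (by rw [F.fst]) (by rw [F.snd, e])
      have h3 := F.sub _ hs c hc
      rw [← hX] at h3
      have := H.half.unique x hx _ _ hxy h3
      rw [this, F.snd] at h
      exact lt_irrefl _ h

lemma lt_iff' (F : Hodo D i j I J p r) (H : Core δ D) {c : ℝ} {x y : R2} (hx : x ∈ D.O₁)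
    (hxy : SubgradAt D.u x y) (hs : ⟪x, i⟫ ∈ I) (hc : c ∈ J) :
    ⟪x, j⟫ < r ⟪x, i⟫ c ↔ ⟪y, j⟫ < c := by
  have h := F.lt_iff H hx hxy hs hc
  have h' : ⟪x, j⟫ = r ⟪x, i⟫ c ↔ ⟪y, j⟫ = c := by
    constructor
    · intro e
      have hX : x = ⟪x, i⟫ • i + r ⟪x, i⟫ c • j := F.ext (by rw [F.fst]) (by rw [F.snd, e])
      have h3 := F.sub _ hs c hc
      rw [← hX] at h3
      rw [H.half.unique x hx _ _ hxy h3, F.snd]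
    · intro e
      exact (F.eq_of_contact H hs hc hxy rfl e).1
  constructor
  · intro h1
    exact lt_of_le_of_ne (not_lt.1 fun h2 => lt_asymm h1 (h.2 h2)) fun e => h1.ne (h'.2 e)
  · intro h1
    exact lt_of_le_of_ne (not_lt.1 fun h2 => lt_asymm h1 (h.1 h2)) fun e => h1.ne (h'.1 e)

lemma r_strictMono (F : Hodo D i j I J p r) (H : Core δ D) {s t t' : ℝ} (hs : s ∈ I) (ht : t ∈ J)
    (ht' : t' ∈ J) (h : t < t') : r s t < r s t' := by
  have := (F.lt_iff H (F.mem s hs t' ht') (F.sub s hs t' ht') (c := t) (by rwa [F.fst]) ht).2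
    (by rwa [F.snd])
  rwa [F.fst, F.snd] at this

/-- The area identity for a rectangle. -/
lemma iUnion_subgrad (F : Hodo D i j I J p r) (H : Core δ D) {a b c d : ℝ}
    (hI : Icc a b ⊆ I) (hJ : Icc c d ⊆ J) (hab : a ≤ b) (hcd : c ≤ d) :
    (⋃ x ∈ {x : R2 | (⟪x, i⟫, ⟪x, j⟫) ∈ regionBetween (r · c) (r · d) (Ioo a b)},
      {y : R2 | SubgradAt D.u x y}) =
    {y : R2 | (⟪y, j⟫, ⟪y, i⟫) ∈ regionBetween (p a ·) (p b ·) (Ioo c d)} ∧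
    {x : R2 | (⟪x, i⟫, ⟪x, j⟫) ∈ regionBetween (r · c) (r · d) (Ioo a b)} ⊆ D.O₁ := by
  have ha : a ∈ I := hI (left_mem_Icc.2 hab)
  have hb : b ∈ I := hI (right_mem_Icc.2 hab)
  have hc : c ∈ J := hJ (left_mem_Icc.2 hcd)
  have hd : d ∈ J := hJ (right_mem_Icc.2 hcd)
  have key : ∀ {D' : Dat} {i' j' : R2} {I' J' : Set ℝ} {p' r' : ℝ → ℝ → ℝ} {c' d' : ℝ} {x : R2},
      Hodo D' i' j' I' J' p' r' → Core δ D' → c' ∈ J' → d' ∈ J' → ⟪x, i'⟫ ∈ I' →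
      r' ⟪x, i'⟫ c' < ⟪x, j'⟫ → ⟪x, j'⟫ < r' ⟪x, i'⟫ d' → x ∈ D'.O₁ := by
    intro D' i' j' I' J' p' r' c' d' x F' H' hc' hd' hs h1 h2
    have h3 : (1 - (⟪x, j'⟫ - r' ⟪x, i'⟫ c') / (r' ⟪x, i'⟫ d' - r' ⟪x, i'⟫ c')) +
      ((⟪x, j'⟫ - r' ⟪x, i'⟫ c') / (r' ⟪x, i'⟫ d' - r' ⟪x, i'⟫ c')) = 1 := by ring
    have hpos : 0 < r' ⟪x, i'⟫ d' - r' ⟪x, i'⟫ c' := by linarith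
    have h4 := H'.half.convex (F'.mem _ hs c' hc') (F'.mem _ hs d' hd') (by
      rw [sub_nonneg, div_le_one hpos]; linarith) (div_nonneg (by linarith) hpos.le) h3
    convert h4 using 1
    apply F'.ext
    · rw [inner_add_left, real_inner_smul_left, real_inner_smul_left, F'.fst, F'.fst]; ring
    · rw [inner_add_left, real_inner_smul_left, real_inner_smul_left, F'.snd, F'.snd]
      field_simp
      ring
  have hsub : {x : R2 | (⟪x, i⟫, ⟪x, j⟫) ∈ regionBetween (r · c) (r · d) (Ioo a b)} ⊆ D.O₁ := by
    rintro x ⟨h1, h2, h3⟩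
    exact key F H hc hd (hI (Ioo_subset_Icc_self h1)) h2 h3
  refine ⟨?_, hsub⟩
  have F' := F.swap H
  ext y
  simp only [mem_iUnion, mem_ofPred_eq, exists_prop]
  constructor
  · rintro ⟨x, ⟨h1, h2, h3⟩, h4⟩
    have hx : x ∈ D.O₁ := hsub ⟨h1, h2, h3⟩
    have hs := hI (Ioo_subset_Icc_self h1)
    have g1 := (F.lt_iff H hx h4 hs hc).1 h2
    have g2 := (F.lt_iff' H hx h4 hs hd).1 h3
    obtain ⟨hy, hyx⟩ := H.dual_of_mem hx h4
    have ht : ⟪y, j⟫ ∈ J := hJ ⟨g1.le, g2.le⟩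
    exact ⟨⟨g1, g2⟩, (F'.lt_iff H.swap hy hyx ht ha).2 h1.1, (F'.lt_iff' H.swap hy hyx ht hb).2 h1.2⟩
  · rintro ⟨h1, h2, h3⟩
    have ht := hJ (Ioo_subset_Icc_self h1)
    have hy : y ∈ D.O₂ := key F' H.swap ha hb ht h2 h3
    obtain ⟨x, hx, hyx, hxy⟩ := H.swap.half.exists_dual y hy
    have g1 := (F'.lt_iff H.swap hy hyx ht ha).1 h2
    have g2 := (F'.lt_iff' H.swap hy hyx ht hb).1 h3
    have hs : ⟪x, i⟫ ∈ I := hI ⟨g1.le, g2.le⟩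
    exact ⟨x, ⟨⟨g1, g2⟩, (F.lt_iff H hx hxy hs hc).2 h1.1, (F.lt_iff' H hx hxy hs hd).2 h1.2⟩, hxy⟩

end Hodo

lemma hasDerivAt_of_abs_sub_le {g φ : ℝ → ℝ} {s : ℝ} (hφ : ContinuousAt φ s)
    (h : ∀ᶠ s' in 𝓝 s, |g s' - g s - φ s * (s' - s)| ≤ |φ s' - φ s| * |s' - s|) :
    HasDerivAt g (φ s) s := by
  rw [hasDerivAt_iff_isLittleO, Asymptotics.isLittleO_iff]
  intro c hc
  filter_upwards [h, Metric.continuousAt_iff'.1 hφ c hc] with s' h1 h2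
  rw [Real.dist_eq] at h2
  rw [smul_eq_mul, Real.norm_eq_abs, Real.norm_eq_abs, mul_comm (s' - s)]
  exact h1.trans (mul_le_mul_of_nonneg_right h2.le (abs_nonneg _))

lemma abs_sub_le_abs_of_between {m x y d : ℝ} (h1 : x * d ≤ m) (h2 : m ≤ y * d) :
    |m - x * d| ≤ |y - x| * |d| := by
  rw [← abs_mul, abs_of_nonneg (by linarith)]
  refine le_trans ?_ (le_abs_self _)
  linarith

namespace Hodo

variable {i j : R2} {I J : Set ℝ} {p r : ℝ → ℝ → ℝ}

lemma continuousOn (F : Hodo D i j I J p r) (H : Core δ D) {B : ℝ}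
    (hp : ∀ s ∈ I, ∀ t ∈ J, |p s t| ≤ B) (hr : ∀ s ∈ I, ∀ t ∈ J, |r s t| ≤ B) :
    ContinuousOn (fun z : ℝ × ℝ => (p z.1 z.2, r z.1 z.2)) (I ×ˢ J) := by
  have hcont : Continuous D.u := continuousOn_univ.1 (H.half.conv.continuousOn isOpen_univ)
  rintro ⟨s, t⟩ ⟨hs, ht⟩
  refine IsCompact.tendsto_nhds_of_unique_mapClusterPt
    ((isCompact_Icc (a := -B) (b := B)).prod (isCompact_Icc (a := -B) (b := B))) ?_ ?_
  · filter_upwards [self_mem_nhdsWithin] with z hz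
    exact ⟨abs_le.1 (hp _ hz.1 _ hz.2), abs_le.1 (hr _ hz.1 _ hz.2)⟩
  · rintro ⟨p', r'⟩ - hcl
    obtain ⟨U, hU, hUt⟩ := mapClusterPt_iff_ultrafilter.1 hcl
    have h0 : Tendsto (fun z : ℝ × ℝ => z) U (𝓝 (s, t)) := hU.trans nhdsWithin_le_nhds
    have h1 : Tendsto (fun z : ℝ × ℝ => z.1) U (𝓝 s) := (continuous_fst.tendsto (s, t)).comp h0
    have h2 : Tendsto (fun z : ℝ × ℝ => z.2) U (𝓝 t) := (continuous_snd.tendsto (s, t)).comp h0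
    have h3 : Tendsto (fun z : ℝ × ℝ => p z.1 z.2) U (𝓝 p') :=
      (continuous_fst.tendsto (p', r')).comp hUt
    have h4 : Tendsto (fun z : ℝ × ℝ => r z.1 z.2) U (𝓝 r') :=
      (continuous_snd.tendsto (p', r')).comp hUt
    have hX := (h1.smul_const i).add (h4.smul_const j)
    have hY := (h3.smul_const i).add (h2.smul_const j)
    have hsub : SubgradAt D.u (s • i + r' • j) (p' • i + t • j) := by
      intro w
      refine le_of_tendsto (((hcont.tendsto _).comp hX).add (hY.inner (hX.const_sub w))) ?_
      filter_upwards [hU self_mem_nhdsWithin] with z hz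
      exact F.sub _ hz.1 _ hz.2 w
    have := F.eq_of_contact H hs ht hsub (F.fst _ _) (F.snd _ _)
    rw [F.fst, F.snd] at this
    rw [this.1, this.2]

lemma continuousOn_p (hc : ContinuousOn (fun z : ℝ × ℝ => (p z.1 z.2, r z.1 z.2)) (I ×ˢ J))
    {s : ℝ} (hs : s ∈ I) : ContinuousOn (p s ·) J :=
  (continuous_fst.comp_continuousOn hc).comp (f := fun t => (s, t)) (by fun_prop)
    fun _ ht => ⟨hs, ht⟩

lemma continuousOn_r (hc : ContinuousOn (fun z : ℝ × ℝ => (p z.1 z.2, r z.1 z.2)) (I ×ˢ J))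
    {s : ℝ} (hs : s ∈ I) : ContinuousOn (r s ·) J :=
  (continuous_snd.comp_continuousOn hc).comp (f := fun t => (s, t)) (by fun_prop)
    fun _ ht => ⟨hs, ht⟩

lemma continuousOn_p' (hc : ContinuousOn (fun z : ℝ × ℝ => (p z.1 z.2, r z.1 z.2)) (I ×ˢ J))
    {t : ℝ} (ht : t ∈ J) : ContinuousOn (p · t) I :=
  (continuous_fst.comp_continuousOn hc).comp (f := fun s => (s, t)) (by fun_prop)
    fun _ hs => ⟨hs, ht⟩

lemma continuousOn_r' (hc : ContinuousOn (fun z : ℝ × ℝ => (p z.1 z.2, r z.1 z.2)) (I ×ˢ J))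
    {t : ℝ} (ht : t ∈ J) : ContinuousOn (r · t) I :=
  (continuous_snd.comp_continuousOn hc).comp (f := fun s => (s, t)) (by fun_prop)
    fun _ hs => ⟨hs, ht⟩

lemma volume_region {i j : R2} (hi : ‖i‖ = 1) (hj : ‖j‖ = 1) (hij : ⟪i, j⟫ = 0) {f g : ℝ → ℝ}
    {a b : ℝ} (hab : a ≤ b) (hf : ContinuousOn f (Icc a b)) (hg : ContinuousOn g (Icc a b))
    (hfg : ∀ s ∈ Icc a b, f s ≤ g s) :
    volume {x : R2 | (⟪x, i⟫, ⟪x, j⟫) ∈ regionBetween f g (Ioo a b)} =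
      ENNReal.ofReal (∫ s in a..b, (g s - f s)) ∧
    MeasurableSet {x : R2 | (⟪x, i⟫, ⟪x, j⟫) ∈ regionBetween f g (Ioo a b)} := by
  have hf' := hf.mono Ioo_subset_Icc_self
  have hg' := hg.mono Ioo_subset_Icc_self
  have hopen : IsOpen (regionBetween f g (Ioo a b)) := by
    have ho : IsOpen ((Ioo a b) ×ˢ (univ : Set ℝ)) := isOpen_Ioo.prod isOpen_univ
    have hmaps : MapsTo (fun z : ℝ × ℝ => z.1) ((Ioo a b) ×ˢ (univ : Set ℝ)) (Ioo a b) :=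
      fun z hz => hz.1
    have h1 := (continuous_snd.continuousOn.sub (hf'.comp continuous_fst.continuousOn hmaps)).prodMk
      ((hg'.comp continuous_fst.continuousOn hmaps).sub continuous_snd.continuousOn)
    have h2 := h1.isOpen_inter_preimage ho (isOpen_Ioi (a := (0 : ℝ)) |>.prod (isOpen_Ioi (a := (0 : ℝ))))
    convert h2 using 1
    ext z
    simp [regionBetween]
  have hdet : |det2 i j| = 1 := abs_det2_of_orthonormal hi hj hij
  have hne : det2 i j ≠ 0 := by
    intro h
    rw [h, abs_zero] at hdet
    exact zero_ne_one hdet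
  refine ⟨?_, ?_⟩
  · rw [volume_pair_preimage hne hopen.measurableSet, abs_inv, hdet, inv_one, ENNReal.ofReal_one,
      one_mul, Measure.volume_eq_prod, volume_regionBetween_eq_integral
        (hf.integrableOn_Icc.mono_set Ioo_subset_Icc_self)
        (hg.integrableOn_Icc.mono_set Ioo_subset_Icc_self) measurableSet_Ioo
        (fun s hs => hfg s (Ioo_subset_Icc_self hs)), intervalIntegral.integral_of_le hab,
      ← integral_Ioc_eq_integral_Ioo]
    rfl
  · exact (hopen.preimage (f := fun x : R2 => ((⟪x, i⟫, ⟪x, j⟫) : ℝ × ℝ)) (by fun_prop)).measurableSet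

lemma integral_eq (F : Hodo D i j I J p r) (H : Core δ D)
    (hcon : ContinuousOn (fun z : ℝ × ℝ => (p z.1 z.2, r z.1 z.2)) (I ×ˢ J)) {a b c d : ℝ}
    (hI : Icc a b ⊆ I) (hJ : Icc c d ⊆ J) (hab : a ≤ b) (hcd : c ≤ d) :
    ∫ s in a..b, (r s d - r s c) = ∫ t in c..d, (p b t - p a t) := by
  have ha : a ∈ I := hI (left_mem_Icc.2 hab)
  have hb : b ∈ I := hI (right_mem_Icc.2 hab)
  have hc : c ∈ J := hJ (left_mem_Icc.2 hcd)
  have hd : d ∈ J := hJ (right_mem_Icc.2 hcd)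
  have F' := F.swap H
  have m1 : ∀ s ∈ Icc a b, r s c ≤ r s d := by
    intro s hs
    rcases hcd.eq_or_lt with rfl | h
    · exact le_rfl
    · exact (F.r_strictMono H (hI hs) hc hd h).le
  have m2 : ∀ t ∈ Icc c d, p a t ≤ p b t := by
    intro t ht
    rcases hab.eq_or_lt with rfl | h
    · exact le_rfl
    · exact (F'.r_strictMono H.swap (hJ ht) ha hb h).le
  obtain ⟨e1, hm⟩ := volume_region F.norm_i F.norm_j F.inner_ij hab
    ((continuousOn_r' hcon hc).mono hI) ((continuousOn_r' hcon hd).mono hI) m1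
  obtain ⟨e2, -⟩ := volume_region F'.norm_i F'.norm_j F'.inner_ij hcd
    ((continuousOn_p hcon ha).mono hJ) ((continuousOn_p hcon hb).mono hJ) m2
  obtain ⟨e3, hsub⟩ := F.iUnion_subgrad H hI hJ hab hcd
  have e4 := H.half.volume_image _ hsub hm
  rw [e3, e1, e2, ENNReal.ofReal_eq_ofReal_iff] at e4
  · exact e4.symm
  · exact intervalIntegral.integral_nonneg hcd fun t ht => sub_nonneg.2 (m2 t ht)
  · exact intervalIntegral.integral_nonneg hab fun t ht => sub_nonneg.2 (m1 t ht)

/-- The partial Legendre transform. -/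
def pot (D : Dat) (i j : R2) (r : ℝ → ℝ → ℝ) (s t : ℝ) : ℝ :=
  D.u (s • i + r s t • j) - r s t * t

lemma pot_le (F : Hodo D i j I J p r) {s t s' t' : ℝ} (hs : s ∈ I) (ht : t ∈ J) :
    pot D i j r s t + p s t * (s' - s) - r s' t' * (t' - t) ≤ pot D i j r s' t' := by
  have h := F.sub s hs t ht (s' • i + r s' t' • j)
  rw [inner_eq_of_orthonormal F.norm_i F.norm_j F.inner_ij] at h
  simp only [inner_sub_left, F.fst, F.snd] at h
  simp only [pot]
  linarith

lemma hasDerivAt_fst (F : Hodo D i j I J p r)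
    (hcon : ContinuousOn (fun z : ℝ × ℝ => (p z.1 z.2, r z.1 z.2)) (I ×ˢ J)) (hI : IsOpen I)
    {s t : ℝ} (hs : s ∈ I) (ht : t ∈ J) : HasDerivAt (pot D i j r · t) (p s t) s := by
  refine hasDerivAt_of_abs_sub_le (φ := (p · t))
    ((continuousOn_p' hcon ht).continuousAt (hI.mem_nhds hs)) ?_
  filter_upwards [hI.mem_nhds hs] with s' hs'
  have h1 := F.pot_le (s' := s') (t' := t) hs ht
  have h2 := F.pot_le (s' := s) (t' := t) hs' ht
  apply abs_sub_le_abs_of_between <;> linarith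

lemma hasDerivAt_snd (F : Hodo D i j I J p r)
    (hcon : ContinuousOn (fun z : ℝ × ℝ => (p z.1 z.2, r z.1 z.2)) (I ×ˢ J)) (hJ : IsOpen J)
    {s t : ℝ} (hs : s ∈ I) (ht : t ∈ J) : HasDerivAt (pot D i j r s ·) (- r s t) t := by
  refine hasDerivAt_of_abs_sub_le (φ := fun t => - r s t)
    ((continuousOn_r hcon hs).neg.continuousAt (hJ.mem_nhds ht)) ?_
  filter_upwards [hJ.mem_nhds ht] with t' ht'
  have h1 := F.pot_le (s' := s) (t' := t') hs ht
  have h2 := F.pot_le (s' := s) (t' := t) hs ht'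
  have := abs_sub_le_abs_of_between (m := -(pot D i j r s t' - pot D i j r s t)) (x := r s t)
    (y := r s t') (d := t' - t) (by linarith) (by linarith)
  rw [← abs_neg, ← abs_neg (-r s t' - -r s t)]
  convert this using 2
  · ring
  · congr 1; ring

end Hodo

end

section

open Filter Topology
open scoped Pointwise ComplexOrder
variable {δ C : ℝ} {D : Dat}

lemma integral_add_mul_I {f g : ℝ → ℝ} {a b : ℝ} (hf : ContinuousOn f (uIcc a b))
    (hg : ContinuousOn g (uIcc a b)) :
    ∫ x in a..b, ((f x : ℂ) + g x * Complex.I) =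
      ((∫ x in a..b, f x : ℝ) : ℂ) + (∫ x in a..b, g x : ℝ) * Complex.I := by
  have hf' : ContinuousOn (fun x => (f x : ℂ)) (uIcc a b) :=
    Complex.continuous_ofReal.comp_continuousOn hf
  have hg' : ContinuousOn (fun x => (g x : ℂ)) (uIcc a b) :=
    Complex.continuous_ofReal.comp_continuousOn hg
  have hg'' : ContinuousOn (fun x => (g x : ℂ) * Complex.I) (uIcc a b) :=
    hg'.mul continuousOn_const
  rw [intervalIntegral.integral_add hf'.intervalIntegrable hg''.intervalIntegrable, intervalIntegral.integral_mul_const,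
    intervalIntegral.integral_ofReal, intervalIntegral.integral_ofReal]

namespace Hodo

variable {i j : R2} {I J : Set ℝ} {p r : ℝ → ℝ → ℝ}

lemma integral_eq' (F : Hodo D i j I J p r) (H : Core δ D)
    (hcon : ContinuousOn (fun z : ℝ × ℝ => (p z.1 z.2, r z.1 z.2)) (I ×ˢ J)) {a b c d : ℝ}
    (hI : uIcc a b ⊆ I) (hJ : uIcc c d ⊆ J) :
    ∫ s in a..b, (r s d - r s c) = ∫ t in c..d, (p b t - p a t) := by
  have neg1 : ∀ a b c d, ∫ s in b..a, (r s d - r s c) = -∫ s in a..b, (r s d - r s c) :=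
    fun a b c d => intervalIntegral.integral_symm a b
  have neg2 : ∀ a b c d, ∫ s in a..b, (r s c - r s d) = -∫ s in a..b, (r s d - r s c) := by
    intro a b c d
    rw [← intervalIntegral.integral_neg]
    simp
  have neg3 : ∀ a b c d, ∫ t in d..c, (p b t - p a t) = -∫ t in c..d, (p b t - p a t) :=
    fun a b c d => intervalIntegral.integral_symm c d
  have neg4 : ∀ a b c d, ∫ t in c..d, (p a t - p b t) = -∫ t in c..d, (p b t - p a t) := by
    intro a b c d
    rw [← intervalIntegral.integral_neg]
    simp
  rcases le_total a b with hab | hab <;> rcases le_total c d with hcd | hcd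
  · rw [uIcc_of_le hab] at hI
    rw [uIcc_of_le hcd] at hJ
    exact F.integral_eq H hcon hI hJ hab hcd
  · rw [uIcc_of_le hab] at hI
    rw [uIcc_of_ge hcd] at hJ
    rw [neg2, neg3, F.integral_eq H hcon hI hJ hab hcd]
  · rw [uIcc_of_ge hab] at hI
    rw [uIcc_of_le hcd] at hJ
    rw [neg1, neg4, F.integral_eq H hcon hI hJ hab hcd]
  · rw [uIcc_of_ge hab] at hI
    rw [uIcc_of_ge hcd] at hJ
    rw [neg1, neg2, neg3, neg4, F.integral_eq H hcon hI hJ hab hcd]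

/-- The complexified hodograph map. -/
def zeta (p r : ℝ → ℝ → ℝ) (z : ℂ) : ℂ := p z.re z.im + r z.re z.im * Complex.I

lemma zeta_re (p r : ℝ → ℝ → ℝ) (z : ℂ) : (zeta p r z).re = p z.re z.im := by simp [zeta]

lemma zeta_im (p r : ℝ → ℝ → ℝ) (z : ℂ) : (zeta p r z).im = r z.re z.im := by simp [zeta]

/-- The Monge–Ampère equation turns into the Cauchy–Riemann equations. -/
lemma differentiableOn (F : Hodo D i j I J p r) (H : Core δ D) (hI : IsOpen I) (hJ : IsOpen J)
    {B : ℝ} (hp : ∀ s ∈ I, ∀ t ∈ J, |p s t| ≤ B) (hr : ∀ s ∈ I, ∀ t ∈ J, |r s t| ≤ B) :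
    DifferentiableOn ℂ (zeta p r) (I ×ℂ J) := by
  have hcon := F.continuousOn H hp hr
  rw [← Complex.isConservativeOn_and_continuousOn_iff_isDifferentiableOn (hI.reProdIm hJ)]
  constructor
  · intro z w hzw
    rw [← add_eq_zero_iff_eq_neg, Complex.wedgeIntegral_add_wedgeIntegral_eq]
    have hI' : uIcc z.re w.re ⊆ I := fun s hs =>
      (hzw (show (⟨s, z.im⟩ : ℂ) ∈ Complex.Rectangle z w from ⟨hs, left_mem_uIcc⟩)).1
    have hJ' : uIcc z.im w.im ⊆ J := fun t ht =>
      (hzw (show (⟨z.re, t⟩ : ℂ) ∈ Complex.Rectangle z w from ⟨left_mem_uIcc, ht⟩)).2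
    have hz1 := hI' left_mem_uIcc
    have hw1 := hI' right_mem_uIcc
    have hz2 := hJ' left_mem_uIcc
    have hw2 := hJ' right_mem_uIcc
    have cp := fun t (ht : t ∈ J) => (continuousOn_p' hcon ht).mono hI'
    have cr := fun t (ht : t ∈ J) => (continuousOn_r' hcon ht).mono hI'
    have cp' := fun s (hs : s ∈ I) => (continuousOn_p hcon hs).mono hJ'
    have cr' := fun s (hs : s ∈ I) => (continuousOn_r hcon hs).mono hJ'
    have e1 : ∀ t ∈ J, ∫ s in z.re..w.re, zeta p r (s + t * Complex.I) =
        ((∫ s in z.re..w.re, p s t : ℝ) : ℂ) + (∫ s in z.re..w.re, r s t : ℝ) * Complex.I := by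
      intro t ht
      rw [← integral_add_mul_I (cp t ht) (cr t ht)]
      simp [zeta]
    have e2 : ∀ s ∈ I, ∫ t in z.im..w.im, zeta p r (s + t * Complex.I) =
        ((∫ t in z.im..w.im, p s t : ℝ) : ℂ) + (∫ t in z.im..w.im, r s t : ℝ) * Complex.I := by
      intro s hs
      rw [← integral_add_mul_I (cp' s hs) (cr' s hs)]
      simp [zeta]
    rw [e1 _ hz2, e1 _ hw2, e2 _ hz1, e2 _ hw1]
    have d1 : ∀ t ∈ J, ∫ s in z.re..w.re, p s t = pot D i j r w.re t - pot D i j r z.re t :=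
      fun t ht => intervalIntegral.integral_eq_sub_of_hasDerivAt
        (fun s hs => F.hasDerivAt_fst hcon hI (hI' hs) ht) (cp t ht).intervalIntegrable
    have d2 : ∀ s ∈ I, ∫ t in z.im..w.im, r s t = -(pot D i j r s w.im - pot D i j r s z.im) := by
      intro s hs
      rw [← intervalIntegral.integral_eq_sub_of_hasDerivAt
        (fun t ht => F.hasDerivAt_snd hcon hJ hs (hJ' ht)) (cr' s hs).neg.intervalIntegrable,
        intervalIntegral.integral_neg, neg_neg]
    have ar := F.integral_eq' H hcon hI' hJ'
    rw [intervalIntegral.integral_sub (cr _ hw2).intervalIntegrable (cr _ hz2).intervalIntegrable,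
      intervalIntegral.integral_sub (cp' _ hw1).intervalIntegrable
        (cp' _ hz1).intervalIntegrable] at ar
    apply Complex.ext
    · simp [d1 _ hz2, d1 _ hw2, d2 _ hz1, d2 _ hw1]
      ring
    · simp
      linarith
  · have h1 : ContinuousOn (fun z : ℂ => (p z.re z.im, r z.re z.im)) (I ×ℂ J) :=
      hcon.comp (f := fun z : ℂ => (z.re, z.im))
        (Complex.continuous_re.prodMk Complex.continuous_im).continuousOn fun z hz => hz
    exact (Complex.continuous_ofReal.comp_continuousOn (continuous_fst.comp_continuousOn h1)).add
      ((Complex.continuous_ofReal.comp_continuousOn (continuous_snd.comp_continuousOn h1)).mul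
        continuousOn_const)

end Hodo

/-- Contact pairs over a rectangle are parametrised by a holomorphic function. -/
lemma Core.exists_holomorphic (H : Core δ D) {i j : R2} (hi : ‖i‖ = 1) (hj : ‖j‖ = 1)
    (hij : ⟪i, j⟫ = 0) {I J : Set ℝ} (hI : IsOpen I) (hJ : IsOpen J) {B : ℝ}
    (hg : ∀ s ∈ I, ∀ t ∈ J, InGraph D i j s t)
    (hB : ∀ x ∈ D.O₁, ∀ y, SubgradAt D.u x y → ⟪x, i⟫ ∈ I → ⟪y, j⟫ ∈ J → |⟪y, i⟫| ≤ B ∧ |⟪x, j⟫| ≤ B) :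
    ∃ ζ : ℂ → ℂ, DifferentiableOn ℂ ζ (I ×ℂ J) ∧ ∀ z ∈ I ×ℂ J, ∃ x ∈ D.O₁, ∃ y ∈ D.O₂,
      SubgradAt D.u x y ∧ SubgradAt D.v y x ∧
      ⟪x, i⟫ = z.re ∧ ⟪y, j⟫ = z.im ∧ ⟪y, i⟫ = (ζ z).re ∧ ⟪x, j⟫ = (ζ z).im := by
  choose! X hX Y hXY hs ht using hg
  have F : Hodo D i j I J (fun s t => ⟪Y s t, i⟫) (fun s t => ⟪X s t, j⟫) := by
    refine ⟨hi, hj, hij, ?_, ?_⟩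
    · intro s hs' t ht'
      have := eq_add_smul_of_orthonormal hi hj hij (X s t)
      rw [hs s hs' t ht'] at this
      rw [← this]
      exact hX s hs' t ht'
    · intro s hs' t ht'
      have e1 := eq_add_smul_of_orthonormal hi hj hij (X s t)
      have e2 := eq_add_smul_of_orthonormal hi hj hij (Y s t)
      rw [hs s hs' t ht'] at e1
      rw [ht s hs' t ht'] at e2
      rw [← e1, ← e2]
      exact hXY s hs' t ht'
  have hb := fun s (hs' : s ∈ I) t (ht' : t ∈ J) => hB _ (hX s hs' t ht') _ (hXY s hs' t ht')
    (by rwa [hs s hs' t ht']) (by rwa [ht s hs' t ht'])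
  refine ⟨Hodo.zeta _ _, F.differentiableOn H hI hJ (fun s hs t ht => (hb s hs t ht).1)
    (fun s hs t ht => (hb s hs t ht).2), ?_⟩
  intro z hz
  obtain ⟨h1, h2⟩ := H.dual_of_mem (hX _ hz.1 _ hz.2) (hXY _ hz.1 _ hz.2)
  exact ⟨_, hX _ hz.1 _ hz.2, _, h1, hXY _ hz.1 _ hz.2, h2, hs _ hz.1 _ hz.2, ht _ hz.1 _ hz.2,
    by rw [Hodo.zeta_re], by rw [Hodo.zeta_im]⟩

end

section

open Filter Topology
open scoped Pointwise

/-- The Schwarz–Pick inequality for functions with values in the upper half plane. -/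
lemma schwarz_pick {f : ℂ → ℂ} {c z : ℂ} {R ρ : ℝ} (hf : DifferentiableOn ℂ f (ball c R))
    (him : ∀ z ∈ ball c R, 0 < (f z).im) (hR : 0 < R) (hz : z ∈ ball c R)
    (hρ : dist z c ≤ ρ * R) (hρ1 : ρ ≤ 1) :
    (1 - ρ) * ‖f z - f c‖ ^ 2 ≤ 4 * ((f z).im * (f c).im) ∧
      (1 - ρ) * (f c).im ≤ 4 * (f z).im := by
  have hc : c ∈ ball c R := mem_ball_self hR
  have hb := him c hc
  have ha := him z hz
  have hρ0 : 0 ≤ ρ := by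
    have := dist_nonneg.trans hρ
    exact nonneg_of_mul_nonneg_left this hR
  have hne : ∀ z ∈ ball c R, f z - (starRingEnd ℂ) (f c) ≠ 0 := by
    intro z hz h
    have := congrArg Complex.im h
    simp at this
    linarith [him z hz]
  have hsq : ∀ z, ‖f z - (starRingEnd ℂ) (f c)‖ ^ 2 =
      ‖f z - f c‖ ^ 2 + 4 * ((f z).im * (f c).im) := by
    intro z
    rw [← Complex.normSq_eq_norm_sq, ← Complex.normSq_eq_norm_sq]
    simp [Complex.normSq_apply]
    ring
  have hlt : ∀ z ∈ ball c R, ‖f z - f c‖ < ‖f z - (starRingEnd ℂ) (f c)‖ := by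
    intro z hz
    refine lt_of_pow_lt_pow_left₀ 2 (norm_nonneg _) ?_
    rw [hsq]
    have := mul_pos (him z hz) hb
    linarith
  set g : ℂ → ℂ := fun z => (f z - f c) / (f z - (starRingEnd ℂ) (f c)) with hg
  have hgc : g c = 0 := by simp [hg]
  have hgd : DifferentiableOn ℂ g (ball c R) :=
    (hf.sub_const _).div (hf.sub_const _) hne
  have hmaps : MapsTo g (ball c R) (ball (g c) 1) := by
    intro z hz
    rw [hgc, mem_ball_zero_iff, hg, norm_div, div_lt_one (norm_pos_iff.2 (hne z hz))]
    exact hlt z hz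
  have hS := Complex.dist_le_div_mul_dist_of_mapsTo_ball hgd
    (fun z hz => ball_subset_closedBall (hmaps hz)) hz
  rw [hgc, dist_zero_right, hg, norm_div] at hS
  have h1 : ‖f z - f c‖ ≤ ρ * ‖f z - (starRingEnd ℂ) (f c)‖ := by
    rw [← div_le_iff₀ (norm_pos_iff.2 (hne z hz))]
    refine hS.trans ?_
    rw [one_div, inv_mul_le_iff₀ hR, mul_comm R]
    exact hρ
  have h2 : ‖f z - f c‖ ^ 2 ≤ ρ ^ 2 * (‖f z - f c‖ ^ 2 + 4 * ((f z).im * (f c).im)) := by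
    rw [← hsq, ← mul_pow]
    gcongr
  set a := (f z).im
  set b := (f c).im
  have hn : (a - b) ^ 2 ≤ ‖f z - f c‖ ^ 2 := by
    rw [← Complex.normSq_eq_norm_sq, Complex.normSq_apply, Complex.sub_re, Complex.sub_im]
    have := mul_self_nonneg ((f z).re - (f c).re)
    rw [sq]
    linarith
  set n := ‖f z - f c‖ ^ 2
  have hab : 0 < a * b := mul_pos ha hb
  have hn0 : 0 ≤ n := (sq_nonneg _).trans hn
  have hρ2 : ρ ^ 2 ≤ ρ := by rw [sq]; exact mul_le_of_le_one_left hρ0 hρ1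
  have h3 : ρ ^ 2 * (n + 4 * (a * b)) ≤ ρ * (n + 4 * (a * b)) := by gcongr
  have h4 : ρ * (a * b) ≤ a * b := mul_le_of_le_one_left hab.le hρ1
  have h5 : (1 - ρ) * n ≤ 4 * (ρ * (a * b)) := by linarith
  refine ⟨by linarith, ?_⟩
  have h6 : (1 - ρ) * (a - b) ^ 2 ≤ (1 - ρ) * n := by
    apply mul_le_mul_of_nonneg_left hn; linarith
  have h7 : 0 ≤ (1 - ρ) * a ^ 2 := mul_nonneg (by linarith) (sq_nonneg _)
  have h8 : (1 - ρ) * b * b ≤ 4 * a * b := by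
    have e : (1 - ρ) * (a - b) ^ 2 = (1 - ρ) * a ^ 2 + (1 - ρ) * b * b - 2 * (a * b) +
      2 * (ρ * (a * b)) := by ring
    linarith
  exact le_of_mul_le_mul_right h8 hb

/-- Harnack-type inequality for a holomorphic function with positive real part. -/
lemma harnack_re {ζ : ℂ → ℂ} {α β γ a : ℝ} (hζ : DifferentiableOn ℂ ζ (Ioo α β ×ℂ Ioo (-γ) γ))
    (hre : ∀ z ∈ Ioo α β ×ℂ Ioo (-γ) γ, 0 < (ζ z).re) (hγ : β - α ≤ 2 * γ) (ha : 0 < a)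
    (hab : a ≤ (β - α) / 2) :
    2 * a / (β - α) * (ζ (((α + β) / 2 : ℝ) : ℂ)).re ≤ 4 * (ζ ((α + a : ℝ) : ℂ)).re := by
  have hR : 0 < (β - α) / 2 := by linarith
  set c : ℂ := (((α + β) / 2 : ℝ) : ℂ) with hc
  have hsub : ball c ((β - α) / 2) ⊆ Ioo α β ×ℂ Ioo (-γ) γ := by
    intro z hz
    rw [mem_ball, dist_eq_norm] at hz
    have h1 := (Complex.abs_re_le_norm (z - c)).trans_lt hz
    have h2 := (Complex.abs_im_le_norm (z - c)).trans_lt hz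
    rw [Complex.sub_re, hc, Complex.ofReal_re, abs_lt] at h1
    rw [Complex.sub_im, hc, Complex.ofReal_im, abs_lt] at h2
    exact ⟨⟨by linarith, by linarith⟩, ⟨by linarith, by linarith⟩⟩
  have hdist : dist ((α + a : ℝ) : ℂ) c = (β - α) / 2 - a := by
    rw [hc, dist_eq_norm, ← Complex.ofReal_sub, Complex.norm_real, Real.norm_eq_abs, abs_of_nonpos]
    · ring
    · linarith
  have h := (schwarz_pick (f := fun z => Complex.I * ζ z) (c := c) (z := ((α + a : ℝ) : ℂ))
    (R := (β - α) / 2) (ρ := 1 - 2 * a / (β - α)) ((hζ.mono hsub).const_mul _)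
    (fun z hz => by simpa using hre z (hsub hz)) hR (by rw [mem_ball, hdist]; linarith)
    (by
      rw [hdist]
      apply le_of_eq
      have : β - α ≠ 0 := by linarith
      field_simp) (by
      have : 0 ≤ 2 * a / (β - α) := div_nonneg (by linarith) (by linarith)
      linarith)).2
  simpa using h

lemma exists_sqrt : ∃ s : ℂ → ℂ, DifferentiableOn ℂ s {w | 0 < w.im} ∧
    ∀ w : ℂ, 0 < w.im → s w ^ 2 = w ∧ 0 < (s w).re ∧ 0 < (s w).im := by
  refine ⟨fun w => w ^ (((2 : ℕ) : ℂ)⁻¹), ?_, ?_⟩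
  · intro w hw
    have hw' : w ∈ Complex.slitPlane := Or.inr (ne_of_gt hw)
    exact (differentiableAt_id.cpow_const hw').differentiableWithinAt
  · intro w hw
    have h1 : (w ^ (((2 : ℕ) : ℂ)⁻¹)) ^ 2 = w := Complex.cpow_nat_inv_pow w two_ne_zero
    have hw0 : w ≠ 0 := by
      rintro rfl
      simp at hw
    have h2 : 0 < (w ^ (((2 : ℕ) : ℂ)⁻¹)).re := by
      have e : (((2 : ℕ) : ℂ)⁻¹) = (((1 / 2 : ℝ)) : ℂ) := by push_cast; norm_num
      rw [e, Complex.cpow_ofReal_re]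
      have h3 := Complex.arg_nonneg_iff.2 hw.le
      have h4 := (Complex.arg_lt_pi_iff.2 (Or.inr hw.ne'))
      refine mul_pos (Real.rpow_pos_of_pos (norm_pos_iff.2 hw0) _)
        (Real.cos_pos_of_mem_Ioo ⟨by linarith [Real.pi_pos], by linarith⟩)
    refine ⟨h1, h2, ?_⟩
    have h3 := congrArg Complex.im h1
    rw [sq, Complex.mul_im] at h3
    have h4 : 0 < (w ^ (((2 : ℕ) : ℂ)⁻¹)).re * (w ^ (((2 : ℕ) : ℂ)⁻¹)).im := by linarith
    exact pos_of_mul_pos_right h4 h2.le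

/-- Harnack-type inequality for a holomorphic function with values in a quadrant. -/
lemma harnack_quadrant {ζ : ℂ → ℂ} {α β a : ℝ}
    (hζ : DifferentiableOn ℂ ζ (Ioo α β ×ℂ Ioo α β))
    (hpos : ∀ z ∈ Ioo α β ×ℂ Ioo α β, 0 < (ζ z).re ∧ 0 < (ζ z).im) (ha : 0 < a)
    (hab : a ≤ (β - α) / 2) {c z : ℂ} (hc : c = ⟨(α + β) / 2, (α + β) / 2⟩)
    (hz : z = ⟨α + a, α + a⟩) :
    (2 * a / (β - α)) ^ 2 * ‖ζ z ^ 2 - ζ c ^ 2‖ ^ 2 ≤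
      16 * (((ζ z).re * (ζ z).im) * ((ζ c).re * (ζ c).im)) ∧
    (2 * a / (β - α)) ^ 2 * ((ζ c).re * (ζ c).im) ≤ 4 * ((ζ z).re * (ζ z).im) := by
  obtain ⟨s, hs, hs'⟩ := exists_sqrt
  have hβ : 0 < β - α := by linarith
  set r := (β - α) ^ 2 / 2 with hr
  have hr0 : 0 < r := by positivity
  set o : ℂ := ⟨α, α⟩ with ho
  set w₀ : ℂ := ⟨0, r⟩ with hw₀
  have him : ∀ w ∈ ball w₀ r, 0 < w.im := by
    intro w hw
    rw [mem_ball, dist_eq_norm] at hw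
    have h2 := (Complex.abs_im_le_norm (w - w₀)).trans_lt hw
    rw [Complex.sub_im, hw₀, abs_lt] at h2
    dsimp only at h2
    linarith
  have hmaps : ∀ w ∈ ball w₀ r, s w + o ∈ Ioo α β ×ℂ Ioo α β := by
    intro w hw
    obtain ⟨h1, h2, h3⟩ := hs' w (him w hw)
    have hn : ‖w‖ < 2 * r := by
      have h4 : ‖w₀‖ = r := by
        have : w₀ = (r : ℂ) * Complex.I := by
          apply Complex.ext <;> simp [hw₀]
        rw [this, norm_mul, Complex.norm_I, mul_one, Complex.norm_real, Real.norm_eq_abs,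
          abs_of_pos hr0]
      rw [mem_ball, dist_eq_norm] at hw
      have := norm_le_norm_add_norm_sub w₀ w
      rw [norm_sub_rev] at this
      linarith
    have h5 : ‖s w‖ < β - α := by
      refine lt_of_pow_lt_pow_left₀ 2 hβ.le ?_
      rw [← norm_pow, h1]
      rw [hr] at hn
      linarith
    have h6 := (le_abs_self _).trans (Complex.abs_re_le_norm (s w))
    have h7 := (le_abs_self _).trans (Complex.abs_im_le_norm (s w))
    refine ⟨⟨?_, ?_⟩, ⟨?_, ?_⟩⟩ <;> simp only [Complex.add_re, Complex.add_im, ho] <;> linarith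
  have heval : ∀ b : ℝ, 0 < b → s ⟨0, 2 * b ^ 2⟩ = ⟨b, b⟩ := by
    intro b hb
    obtain ⟨h1, h2, h3⟩ := hs' ⟨0, 2 * b ^ 2⟩ (by dsimp only; positivity)
    have h4 : (⟨b, b⟩ : ℂ) ^ 2 = ⟨0, 2 * b ^ 2⟩ := by
      rw [sq]
      apply Complex.ext
      · rw [Complex.mul_re]; dsimp only; ring
      · rw [Complex.mul_im]; dsimp only; ring
    rw [← h4] at h1
    rw [← h4] at h2 ⊢
    rcases sq_eq_sq_iff_eq_or_eq_neg.1 h1 with h | h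
    · exact h
    · rw [h] at h2
      simp only [Complex.neg_re] at h2
      linarith
  set f : ℂ → ℂ := fun w => ζ (s w + o) ^ 2 with hf
  have hfd : DifferentiableOn ℂ f (ball w₀ r) :=
    (hζ.comp ((hs.mono him).add_const o) hmaps).pow 2
  have himsq : ∀ w : ℂ, (w ^ 2).im = 2 * (w.re * w.im) := by
    intro w
    rw [sq, Complex.mul_im]
    ring
  have hfim : ∀ w ∈ ball w₀ r, 0 < (f w).im := by
    intro w hw
    obtain ⟨h1, h2⟩ := hpos _ (hmaps w hw)
    rw [hf, himsq]
    positivity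
  have e0 : f w₀ = ζ c ^ 2 := by
    have h1 : w₀ = ⟨0, 2 * ((β - α) / 2) ^ 2⟩ := by
      rw [hw₀, hr]; congr 1; ring
    rw [hf]
    dsimp only
    rw [h1, heval _ (by linarith), hc]
    congr 2
    apply Complex.ext <;> simp only [Complex.add_re, Complex.add_im, ho] <;> ring
  have e1 : f ⟨0, 2 * a ^ 2⟩ = ζ z ^ 2 := by
    rw [hf]
    dsimp only
    rw [heval _ ha, hz]
    congr 2
    apply Complex.ext <;> simp only [Complex.add_re, Complex.add_im, ho] <;> ring
  have har : a ^ 2 ≤ ((β - α) / 2) ^ 2 := by gcongr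
  have hle : 2 * a ^ 2 ≤ r := by rw [hr]; linarith
  have hdist : dist (⟨0, 2 * a ^ 2⟩ : ℂ) w₀ = r - 2 * a ^ 2 := by
    have : (⟨0, 2 * a ^ 2⟩ : ℂ) - w₀ = ((2 * a ^ 2 - r : ℝ) : ℂ) * Complex.I := by
      apply Complex.ext <;> simp [hw₀, -Complex.ofReal_pow]
    rw [dist_eq_norm, this, norm_mul, Complex.norm_I, mul_one, Complex.norm_real, Real.norm_eq_abs,
      abs_of_nonpos (by linarith)]
    ring
  have ha2 : 0 < a ^ 2 := by positivity
  have h := schwarz_pick (ρ := 1 - (2 * a / (β - α)) ^ 2) hfd hfim hr0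
    (z := ⟨0, 2 * a ^ 2⟩) (by rw [mem_ball, hdist]; linarith) (by
      rw [hdist, hr]
      apply le_of_eq
      field_simp) (by
      have := sq_nonneg (2 * a / (β - α))
      linarith)
  rw [e0, e1, sub_sub_cancel, himsq, himsq] at h
  constructor
  · linarith [h.1]
  · linarith [h.2]

end

section

open Filter Topology
open scoped Pointwise
variable {δ C : ℝ} {D : Dat}

lemma mul_div_le_of_pos {a b c d e : ℝ} (hb : 0 < b) (h : a / b * c ≤ d) (he : b ≤ e) (hd : 0 ≤ d) :
    a * c ≤ d * e := by
  have h1 : a * c = a / b * c * b := by field_simp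
  rw [h1]
  exact (mul_le_mul_of_nonneg_right h hb.le).trans (mul_le_mul_of_nonneg_left he hd)

namespace Scale

variable {ε C' K L l L' l' : ℝ} {i j : R2}

lemma growth_two_sided (S : Scale D ε C' K L l i j) (S' : Scale D ε C' K L' l' i j) (H : Core δ D)
    (pa : HasPoint D ε C' K L l i (-j)) (pa' : HasPoint D ε C' K L' l' i (-j))
    {q q' : R2} (hq : q ∈ D.O₁) (hq' : q' ∈ D.O₁) (h1 : ⟪q, j⟫ = 16 * C' * l)
    (h1' : ⟪q', j⟫ = -(16 * C' * l)) (h2 : |⟪q, i⟫| ≤ K * (16 * C' * l))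
    (h2' : |⟪q', i⟫| ≤ K * (16 * C' * l)) (hK : 0 ≤ K)
    (hα : K * (32 * C' * l) ≤ ε / 16 * L) (hα' : K * (32 * C' * l) ≤ ε / 16 * L') {A μ : ℝ}
    (hA : 1 ≤ A) (hLA : L' ≤ A * L)
    (hlow : ∀ x y, SubgradAt D.v y x → ε / 16 * L ≤ ⟪x, i⟫ → μ * (ε / 8 * L * l) ≤ ⟪x, y⟫) :
    L' * l * μ ≤ 24 * A * C' * L * l' := by
  have hε := S.ε_pos
  have hL := S.L_pos
  have hl := S.l_pos
  have hL' := S'.L_pos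
  have hl' := S'.l_pos
  have hC := S.one_le
  have hεL : 0 < ε * L := by positivity
  have hεL' : 0 < ε * L' := by positivity
  set α := K * (32 * C' * l) with hαdef
  have hα0 : 0 ≤ α := by positivity
  set β := ε / 8 * L with hβ
  have hββ : β = 2 * (ε / 16 * L) := by rw [hβ]; ring
  have hβ0 : 0 < β := by positivity
  obtain ⟨ζ, hζ, hζ'⟩ := H.exists_holomorphic S.norm_i S.norm_j S.inner_ij (I := Ioo α β)
    (J := Ioo (-β) β) isOpen_Ioo isOpen_Ioo (B := 3 * C' * l)
    (fun s hs t ht => S.inGraphB H pa hq hq' h1 h1' h2 h2' hs.1.le (hα0.trans_lt hs.1) hs.2.le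
      (abs_le.2 ⟨ht.1.le, ht.2.le⟩))
    (fun x hx y hxy hs ht => S.boundB H pa hxy
      (abs_le.2 ⟨by linarith [hs.1], hs.2.le⟩) (abs_le.2 ⟨ht.1.le, ht.2.le⟩))
  set a := ε / 8 * L' / (4 * A) with ha
  have ha0 : 0 < a := by positivity
  have ha1 : a ≤ ε / 8 * L / 4 := by
    rw [ha, div_le_div_iff₀ (by positivity) (by positivity)]
    calc ε / 8 * L' * 4 ≤ ε / 8 * (A * L) * 4 := by gcongr
      _ = _ := by ring
  have ha2 : a ≤ ε / 8 * L' / 4 := by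
    rw [ha]
    gcongr
    linarith
  have hre : ∀ z ∈ Ioo α β ×ℂ Ioo (-β) β, 0 < (ζ z).re := by
    intro z hz
    obtain ⟨x, hx, y, hy, -, -, -, -, h3, -⟩ := hζ' z hz
    rw [← h3]
    exact inner_pos_of_isOpen H.half'.isOpen S.norm_i S.supp hy
  have hh := harnack_re hζ hre (by linarith) ha0 (by linarith)
  have hβα : 0 < β - α := by linarith
  have hc1 : μ * l ≤ (ζ (((α + β) / 2 : ℝ) : ℂ)).re := by
    obtain ⟨x, hx, y, hy, -, h4, h5, h6, h7, -⟩ := hζ' (((α + β) / 2 : ℝ) : ℂ)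
      ⟨by rw [mem_preimage, Complex.ofReal_re]; constructor <;> linarith,
        by rw [mem_preimage, Complex.ofReal_im]; constructor <;> linarith⟩
    rw [Complex.ofReal_re] at h5
    rw [Complex.ofReal_im] at h6
    have h8 := hlow x y h4 (by rw [h5]; linarith)
    rw [inner_eq_of_orthonormal S.norm_i S.norm_j S.inner_ij, h6, mul_zero, add_zero, h5, h7] at h8
    have hp : 0 < (ζ (((α + β) / 2 : ℝ) : ℂ)).re := by
      rw [← h7]
      exact inner_pos_of_isOpen H.half'.isOpen S.norm_i S.supp hy
    have h9 : (α + β) / 2 * (ζ (((α + β) / 2 : ℝ) : ℂ)).re ≤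
        β * (ζ (((α + β) / 2 : ℝ) : ℂ)).re := by
      apply mul_le_mul_of_nonneg_right _ hp.le; linarith
    have h10 : β * (μ * l) ≤ β * (ζ (((α + β) / 2 : ℝ) : ℂ)).re := by
      have e : μ * (β * l) = β * (μ * l) := by ring
      linarith
    exact le_of_mul_le_mul_left h10 hβ0
  have hc2 : (ζ ((α + a : ℝ) : ℂ)).re ≤ 3 * C' * l' := by
    obtain ⟨x, hx, y, hy, h3, -, h5, h6, h7, -⟩ := hζ' ((α + a : ℝ) : ℂ)
      ⟨by rw [mem_preimage, Complex.ofReal_re]; constructor <;> linarith,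
        by rw [mem_preimage, Complex.ofReal_im]; constructor <;> linarith⟩
    rw [Complex.ofReal_re] at h5
    rw [Complex.ofReal_im] at h6
    have := (S'.boundB H pa' h3 (by rw [h5, abs_of_pos (by linarith)]; linarith)
      (by rw [h6, abs_zero]; positivity)).1
    rw [← h7]
    exact (le_abs_self _).trans this
  have h11 : 2 * a / (β - α) * (μ * l) ≤ 12 * C' * l' := by
    have : 2 * a / (β - α) * (μ * l) ≤ 2 * a / (β - α) * (ζ (((α + β) / 2 : ℝ) : ℂ)).re := by
      gcongr
    linarith
  have h12 := mul_div_le_of_pos hβα h11 (e := β) (by linarith) (by positivity)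
  have e1 : 2 * a * (μ * l) = ε / 16 / A * (L' * l * μ) := by
    rw [ha]; field_simp; ring
  have e2 : 12 * C' * l' * β = ε / 16 / A * (24 * A * C' * L * l') := by
    rw [hβ]; field_simp; ring
  rw [e1, e2] at h12
  exact le_of_mul_le_mul_left h12 (by positivity)

lemma growth_one_sided {Lκ lκ : ℝ} (S : Scale D ε C' K L l i j) (S' : Scale D ε C' K L' l' i j)
    (Sκ : Scale D ε C' K Lκ lκ i j) (H : Core δ D) (supp : ∀ x ∈ D.O₁, 0 ≤ ⟪x, j⟫)
    {α : ℝ} (hα : 0 < α) (hα1 : α ≤ ε / 16 * L) (hα2 : α ≤ ε / 16 * L') (hα3 : α ≤ ε / 16 * Lκ)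
    (hK1 : K * l ≤ α) (hK2 : K * l' ≤ α) (hK3 : K * lκ ≤ α)
    (hg : ∀ s ∈ Ioo α (ε / 8 * L), ∀ t ∈ Ioo α (ε / 8 * L), InGraph D i j s t) {A μ θ : ℝ}
    (hA : 1 ≤ A) (hLA : L' ≤ A * L) (hLA' : Lκ ≤ A * L) (hθ : 0 < θ) (hθL : θ * L ≤ Lκ)
    (hμ : 0 < μ) (hlκ : lκ ≤ l) (hlκ' : 9 * C' * lκ ≤ μ * l)
    (hlow : ∀ x y, SubgradAt D.v y x → ε / 16 * L ≤ ⟪x, i⟫ → μ * (ε / 8 * L * l) ≤ ⟪x, y⟫) :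
    L' * l * (θ * μ ^ 2) ≤ 1152 * A ^ 2 * C' ^ 2 * L * l' := by
  have hε := S.ε_pos
  have hL := S.L_pos
  have hl := S.l_pos
  have hL' := S'.L_pos
  have hl' := S'.l_pos
  have hLκ := Sκ.L_pos
  have hlκ0 := Sκ.l_pos
  have hC := S.one_le
  have hεL : 0 < ε * L := by positivity
  set β := ε / 8 * L with hβ
  have hββ : β = 2 * (ε / 16 * L) := by rw [hβ]; ring
  have hβ0 : 0 < β := by positivity
  have hβα : 0 < β - α := by linarith
  have S₂ := S.swap supp
  obtain ⟨ζ, hζ, hζ'⟩ := H.exists_holomorphic S.norm_i S.norm_j S.inner_ij (I := Ioo α β)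
    (J := Ioo α β) isOpen_Ioo isOpen_Ioo (B := 3 * C' * l) hg
    (fun x hx y hxy hs ht => by
      have h1 := S.boundA H hxy (abs_le.2 ⟨by linarith [hs.1], hs.2.le⟩)
        (abs_le.2 ⟨by linarith [ht.1], ht.2.le⟩) (hK1.trans ht.1.le)
      rw [abs_of_nonneg (S.inner_y_nonneg H hxy), abs_of_nonneg (supp x hx)]
      exact h1)
  have hpos : ∀ z ∈ Ioo α β ×ℂ Ioo α β, 0 < (ζ z).re ∧ 0 < (ζ z).im := by
    intro z hz
    obtain ⟨x, hx, y, hy, -, -, -, -, h3, h4⟩ := hζ' z hz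
    rw [← h3, ← h4]
    exact ⟨inner_pos_of_isOpen H.half'.isOpen S.norm_i S.supp hy,
      inner_pos_of_isOpen H.half.isOpen S.norm_j supp hx⟩
  set c : ℂ := ⟨(α + β) / 2, (α + β) / 2⟩ with hc
  have hcm : c ∈ Ioo α β ×ℂ Ioo α β := by
    refine ⟨⟨?_, ?_⟩, ⟨?_, ?_⟩⟩ <;> simp only [hc] <;> linarith
  obtain ⟨hc1, hc2⟩ := hpos c hcm
  have hlowc : μ * l ≤ (ζ c).re + (ζ c).im := by
    obtain ⟨x, hx, y, hy, -, h4, h5, h6, h7, h7'⟩ := hζ' c hcm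
    have h8 := hlow x y h4 (by rw [h5]; simp only [hc]; linarith)
    rw [inner_eq_of_orthonormal S.norm_i S.norm_j S.inner_ij, h6, h5, h7, h7'] at h8
    have h9 : (α + β) / 2 * ((ζ c).re + (ζ c).im) ≤ β * ((ζ c).re + (ζ c).im) := by
      apply mul_le_mul_of_nonneg_right _ (by linarith); linarith
    have h10 : β * (μ * l) ≤ β * ((ζ c).re + (ζ c).im) := by
      have e : μ * (β * l) = β * (μ * l) := by ring
      have e2 : c.re * (ζ c).re + (ζ c).im * c.im = (α + β) / 2 * ((ζ c).re + (ζ c).im) := by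
        simp only [hc]; ring
      linarith
    exact le_of_mul_le_mul_left h10 hβ0
  -- evaluation at a smaller scale
  have small : ∀ {L₁ l₁ : ℝ}, Scale D ε C' K L₁ l₁ i j → α ≤ ε / 16 * L₁ → K * l₁ ≤ α →
      L₁ ≤ A * L → ∃ z : ℂ, 0 < (ζ z).re ∧ 0 < (ζ z).im ∧ (ζ z).re ≤ 3 * C' * l₁ ∧
        (ζ z).im ≤ 3 * C' * l₁ ∧
        (L₁ / (2 * A * L)) ^ 2 * ‖ζ z ^ 2 - ζ c ^ 2‖ ^ 2 ≤
          16 * (((ζ z).re * (ζ z).im) * ((ζ c).re * (ζ c).im)) ∧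
        (L₁ / (2 * A * L)) ^ 2 * ((ζ c).re * (ζ c).im) ≤ 4 * ((ζ z).re * (ζ z).im) := by
    intro L₁ l₁ S₁ hα₁ hK₁ hLA₁
    have hL₁ := S₁.L_pos
    have hεL₁ : 0 < ε * L₁ := by positivity
    set a := ε / 8 * L₁ / (4 * A) with ha
    have ha0 : 0 < a := by positivity
    have ha1 : a ≤ ε / 8 * L / 4 := by
      rw [ha, div_le_div_iff₀ (by positivity) (by positivity)]
      calc ε / 8 * L₁ * 4 ≤ ε / 8 * (A * L) * 4 := by gcongr
        _ = _ := by ring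
    have ha2 : a ≤ ε / 8 * L₁ / 4 := by
      rw [ha]
      gcongr
      linarith
    obtain ⟨g1, g2⟩ := harnack_quadrant hζ hpos ha0 (by linarith) hc (z := ⟨α + a, α + a⟩) rfl
    have hzm : (⟨α + a, α + a⟩ : ℂ) ∈ Ioo α β ×ℂ Ioo α β := by
      refine ⟨⟨?_, ?_⟩, ⟨?_, ?_⟩⟩ <;> dsimp only <;> linarith
    obtain ⟨x, hx, y, hy, h3, -, h5, h6, h7, h8⟩ := hζ' _ hzm
    dsimp only at h5 h6
    obtain ⟨k1, k2⟩ := S₁.boundA H h3 (by rw [h5, abs_of_pos (by linarith)]; linarith)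
      (by rw [h6, abs_of_pos (by linarith)]; linarith) (by rw [h6]; linarith)
    have hτ : L₁ / (2 * A * L) ≤ 2 * a / (β - α) := by
      have : L₁ / (2 * A * L) = 2 * a / β := by
        rw [ha, hβ]; field_simp; norm_num
      rw [this]
      gcongr
      linarith
    obtain ⟨p1, p2⟩ := hpos _ hzm
    refine ⟨_, p1, p2, h7 ▸ k1, h8 ▸ k2, le_trans ?_ g1, le_trans ?_ g2⟩
    · gcongr
    · gcongr
  set b := (ζ c).re * (ζ c).im with hb
  have hb0 : 0 < b := mul_pos hc1 hc2
  have key : (θ / (2 * A)) * (μ ^ 2 * l) / (48 * C') ≤ √b := by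
    obtain ⟨z, p1, p2, k1, k2, k3, -⟩ := small Sκ hα3 hK3 hLA'
    have hn1 : ‖ζ z ^ 2‖ ≤ μ ^ 2 * l ^ 2 / 4 := by
      rw [norm_pow, ← Complex.normSq_eq_norm_sq, Complex.normSq_apply]
      have e1 : (ζ z).re * (ζ z).re ≤ (3 * C' * lκ) * (3 * C' * lκ) := by gcongr
      have e2 : (ζ z).im * (ζ z).im ≤ (3 * C' * lκ) * (3 * C' * lκ) := by gcongr
      have e3 : (9 * C' * lκ) * (9 * C' * lκ) ≤ (μ * l) * (μ * l) := by gcongr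
      have e4 : 0 ≤ C' * lκ * (C' * lκ) := by positivity
      linarith
    have hn2 : μ ^ 2 * l ^ 2 / 2 ≤ ‖ζ c ^ 2‖ := by
      rw [norm_pow, ← Complex.normSq_eq_norm_sq, Complex.normSq_apply]
      have e3 : (μ * l) * (μ * l) ≤ ((ζ c).re + (ζ c).im) * ((ζ c).re + (ζ c).im) := by gcongr
      have e4 := mul_self_nonneg ((ζ c).re - (ζ c).im)
      linarith
    have hn3 : μ ^ 2 * l ^ 2 / 4 ≤ ‖ζ z ^ 2 - ζ c ^ 2‖ := by
      have := norm_sub_norm_le (ζ c ^ 2) (ζ z ^ 2)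
      rw [norm_sub_rev] at this
      linarith
    have hθ' : θ / (2 * A) ≤ Lκ / (2 * A * L) := by
      rw [div_le_div_iff₀ (by positivity) (by positivity)]
      calc θ * (2 * A * L) = (θ * L) * (2 * A) := by ring
        _ ≤ Lκ * (2 * A) := by gcongr
    have h1 : (θ / (2 * A)) ^ 2 * (μ ^ 2 * l ^ 2 / 4) ^ 2 ≤
        16 * (((3 * C' * l) * (3 * C' * l)) * b) := by
      calc _ ≤ (Lκ / (2 * A * L)) ^ 2 * ‖ζ z ^ 2 - ζ c ^ 2‖ ^ 2 := by gcongr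
        _ ≤ _ := k3
        _ ≤ _ := by
          have k1' : (ζ z).re ≤ 3 * C' * l := k1.trans (by gcongr)
          have k2' : (ζ z).im ≤ 3 * C' * l := k2.trans (by gcongr)
          gcongr
    apply Real.le_sqrt_of_sq_le
    have e : (θ / (2 * A) * (μ ^ 2 * l) / (48 * C')) ^ 2 =
        (θ / (2 * A)) ^ 2 * (μ ^ 2 * l ^ 2 / 4) ^ 2 / (144 * C' ^ 2 * l ^ 2) := by
      field_simp
      norm_num
    rw [e, div_le_iff₀ (by positivity)]
    linarith
  obtain ⟨z, p1, p2, k1, k2, -, k3⟩ := small S' hα2 hK2 hLA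
  have h2 : L' / (2 * A * L) * √b ≤ 6 * C' * l' := by
    refine le_of_sq_le_sq ?_ (by positivity)
    rw [mul_pow, Real.sq_sqrt hb0.le]
    refine k3.trans ?_
    calc 4 * ((ζ z).re * (ζ z).im) ≤ 4 * ((3 * C' * l') * (3 * C' * l')) := by gcongr
      _ = _ := by ring
  have h3 : L' / (2 * A * L) * ((θ / (2 * A)) * (μ ^ 2 * l) / (48 * C')) ≤ 6 * C' * l' :=
    (mul_le_mul_of_nonneg_left key (by positivity)).trans h2
  have e : L' / (2 * A * L) * ((θ / (2 * A)) * (μ ^ 2 * l) / (48 * C')) =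
      L' * l * (θ * μ ^ 2) / (192 * A ^ 2 * C' * L) := by
    field_simp
    norm_num
  rw [e, div_le_iff₀ (by positivity)] at h3
  linarith

end Scale

namespace Core

/-- A comparison of gauges bounds the long axis. -/
lemma L_le_of_q_le (H : Core δ D) {h k c : ℝ} (hh : h ∈ Ioc (0 : ℝ) 1) (hk : k ∈ Ioc (0 : ℝ) 1)
    (hc : 0 ≤ c) (hq : ∀ x, D.q h x ≤ c * D.q k x) : D.L k ≤ 2 * c * D.L h := by
  obtain ⟨a, b, e, l0, lL, -⟩ := H.axes h hh
  obtain ⟨a', b', e', l0', lL', -⟩ := H.axes k hk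
  have L0 := H.L_pos hk
  have h1 : D.q k (D.L k • D.e k) ≤ 1 := by
    rw [H.q_le_iff hk, inner_smul_left, inner_smul_left, e', real_inner_self_eq_norm_sq, a']
    simp only [conj_trivial]
    constructor
    · rw [one_pow, mul_one, abs_of_pos L0]
    · rw [mul_zero, abs_zero, mul_one]; exact l0'.le
  have h2 : D.q h (D.L k • D.e k) ≤ c :=
    (hq _).trans ((mul_le_mul_of_nonneg_left h1 hc).trans_eq (mul_one c))
  rw [H.q_le_iff hh] at h2
  have h3 : D.L k = ‖D.L k • D.e k‖ := by rw [norm_smul, a', mul_one, Real.norm_of_nonneg L0.le]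
  rw [h3]
  calc ‖D.L k • D.e k‖ ≤ |⟪D.L k • D.e k, D.e h⟫| + |⟪D.L k • D.e k, D.f h⟫| := by
        conv_lhs => rw [eq_add_smul_of_orthonormal a b e (D.L k • D.e k)]
        refine (norm_add_le _ _).trans ?_
        rw [norm_smul, norm_smul, a, b, mul_one, mul_one, Real.norm_eq_abs, Real.norm_eq_abs]
    _ ≤ D.L h * c + D.l h * c := add_le_add h2.1 h2.2
    _ ≤ D.L h * c + D.L h * c := by gcongr
    _ = _ := by ring

/-- A comparison of gauges bounds the short axis if the axes are nearly parallel. -/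
lemma l_le_of_q_le (H : Core δ D) {h k c : ℝ} (hh : h ∈ Ioc (0 : ℝ) 1) (hk : k ∈ Ioc (0 : ℝ) 1)
    (hc : 0 ≤ c) (hq : ∀ x, D.q h x ≤ c * D.q k x) (hef : |⟪D.e k, D.f h⟫| ≤ 1 / 2) :
    D.l k ≤ 2 * c * D.l h := by
  obtain ⟨a, b, e, l0, lL, -⟩ := H.axes h hh
  obtain ⟨a', b', e', l0', lL', -⟩ := H.axes k hk
  have h1 : D.q k (D.l k • D.f k) ≤ 1 := by
    rw [H.q_le_iff hk, inner_smul_left, inner_smul_left, real_inner_comm (D.e k), e',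
      real_inner_self_eq_norm_sq, b']
    simp only [conj_trivial]
    constructor
    · rw [mul_zero, abs_zero, mul_one]; exact (H.L_pos hk).le
    · rw [one_pow, mul_one, abs_of_pos l0']
  have h2 : D.q h (D.l k • D.f k) ≤ c :=
    (hq _).trans ((mul_le_mul_of_nonneg_left h1 hc).trans_eq (mul_one c))
  rw [H.q_le_iff hh, inner_smul_left, inner_smul_left] at h2
  have h3 := h2.2
  simp only [conj_trivial] at h3
  rw [abs_mul, abs_of_pos l0'] at h3
  have h4 := abs_inner_eq_of_orthonormal a' b' e' a b e
  rw [← h4] at hef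
  have h5 : (1 : ℝ) = ⟪D.f k, D.e h⟫ ^ 2 + ⟪D.f k, D.f h⟫ ^ 2 := by
    have := inner_eq_of_orthonormal a b e (D.f k) (D.f k)
    rw [real_inner_self_eq_norm_sq, b'] at this
    linear_combination this
  have h6 : 1 / 2 ≤ |⟪D.f k, D.f h⟫| := by
    by_contra hlt
    push Not at hlt
    have e1 := mul_self_le_mul_self (abs_nonneg _) hef
    have e2 := mul_self_le_mul_self (abs_nonneg _) hlt.le
    rw [abs_mul_abs_self] at e1 e2
    linarith
  have h7 : D.l k * (1 / 2) ≤ D.l k * |⟪D.f k, D.f h⟫| := mul_le_mul_of_nonneg_left h6 l0'.le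
  linarith

lemma exists_smul_point (H : Core δ D) {z i j : R2} (hi : ‖i‖ = 1) (hz : z ∈ D.O₁) {c E t : ℝ}
    (hc : 0 < c) (hzc : c ≤ ⟪z, j⟫) (hzE : ‖z‖ ≤ E) (ht : 0 < t) (htc : t ≤ c) :
    ∃ q ∈ D.O₁, ⟪q, j⟫ = t ∧ |⟪q, i⟫| ≤ E / c * t := by
  have hp : 0 < ⟪z, j⟫ := hc.trans_le hzc
  refine ⟨(t / ⟪z, j⟫) • z, H.smul_mem hz (by positivity) ((div_le_one hp).2 (htc.trans hzc)), ?_, ?_⟩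
  · rw [inner_smul_left]
    simp only [conj_trivial]
    field_simp
  · rw [inner_smul_left]
    simp only [conj_trivial]
    have h1 : |⟪z, i⟫| ≤ E := by
      have := abs_real_inner_le_norm z i
      rw [hi, mul_one] at this
      exact this.trans hzE
    rw [abs_mul, abs_of_pos (by positivity : 0 < t / ⟪z, j⟫)]
    calc t / ⟪z, j⟫ * |⟪z, i⟫| ≤ t / c * E := by gcongr
      _ = _ := by ring

/-- All the data used at one scale are available once the eccentricity is large. -/
lemma exists_scale (hC : 1 ≤ C) {A : ℝ} (hA : 0 ≤ A) :
    ∃ ε C' : ℝ, 0 < ε ∧ 1 ≤ C' ∧ ∀ cp Cp : ℝ, 0 < cp → 0 ≤ Cp → ∃ η₀ h₁ : ℝ, 0 < η₀ ∧ 0 < h₁ ∧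
      h₁ ≤ 1 ∧ ∀ D, Core δ D → Ctl C D → Ctl C D.swap → ∀ h ∈ Ioc (0 : ℝ) h₁,
        η₀ * D.l h ≤ D.L h → ∀ i j, Aligned D A h i j → ∀ z ∈ D.O₁, cp ≤ ⟪z, j⟫ → ‖z‖ ≤ Cp →
        HasPoint D ε C' (Cp / cp) (D.L h) (D.l h) i j ∧
        ((∀ y ∈ D.O₂, 0 ≤ ⟪y, i⟫) → ∀ w ∈ D.O₂, cp ≤ ⟪w, i⟫ → ‖w‖ ≤ Cp →
          Scale D ε C' (Cp / cp) (D.L h) (D.l h) i j) := by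
  obtain ⟨ε, C', hε, hC', hP⟩ := exists_hasPoint (δ := δ) hC hA
  refine ⟨ε, C', hε, hC', fun cp Cp hcp hCp => ?_⟩
  obtain ⟨η₀, h₁, hη₀, hh₁, hh₁', hP⟩ := hP cp Cp hcp hCp
  refine ⟨max η₀ (Cp / cp * 8 / ε), h₁, lt_max_of_lt_left hη₀, hh₁, hh₁',
    fun D H B B' h hh hη i j F z hz hzj hzn => ?_⟩
  have hh' : h ∈ Ioc (0 : ℝ) 1 := ⟨hh.1, hh.2.trans hh₁'⟩
  have l0 := H.l_pos hh'
  have e1 : η₀ * D.l h ≤ D.L h := (mul_le_mul_of_nonneg_right (le_max_left _ _) l0.le).trans hη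
  have e2 : Cp / cp * 8 / ε * D.l h ≤ D.L h :=
    (mul_le_mul_of_nonneg_right (le_max_right _ _) l0.le).trans hη
  have pa := hP D H B B' h hh i j F e1 z hz hzj hzn
  refine ⟨pa, fun supp w hw hwi hwn => ⟨F.norm_i, F.norm_j, F.inner_ij, hε, hC', H.L_pos hh', l0, ?_,
    pa, hP D.swap H.swap B' B h hh j i (F.swap H hh') e1 w hw hwi hwn, supp⟩⟩
  calc Cp / cp * D.l h = ε / 8 * (Cp / cp * 8 / ε * D.l h) := by field_simp
    _ ≤ _ := by gcongr

lemma div_le_of_mul_le {L l L' l' c : ℝ} (hl : 0 < l) (hl' : 0 < l') (h : L' * l ≤ c * L * l') :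
    L' / l' ≤ c * (L / l) := by
  rw [← mul_div_assoc, div_le_div_iff₀ hl' hl]
  exact h

/-- Eccentricity growth when the domain lies on both sides of the short axis. -/
lemma exists_growth_two_sided (hC : 1 ≤ C) : ∃ C₁ : ℝ, 0 < C₁ ∧ ∀ M cp Cp : ℝ, 1 ≤ M → 0 < cp →
    0 ≤ Cp → ∃ η₀ h₀ : ℝ, 0 < η₀ ∧ 0 < h₀ ∧ h₀ ≤ 1 ∧ ∀ D, Core δ D → Ctl C D → Ctl C D.swap →
      ∀ h ∈ Ioc (0 : ℝ) h₀, η₀ * D.l h ≤ D.L h → ∀ R, IsRot R → ∀ ih, Aligned D 0 h ih (R ih) →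
      ∀ i, ‖i‖ = 1 → (∀ y ∈ D.O₂, 0 ≤ ⟪y, i⟫) → ∀ z₁ ∈ D.O₁, ∀ z₂ ∈ D.O₁, ‖z₁‖ ≤ Cp → ‖z₂‖ ≤ Cp →
      cp ≤ ⟪z₁, R ih⟫ → ⟪z₂, R ih⟫ ≤ -cp → ∀ w ∈ D.O₂, ‖w‖ ≤ Cp → cp ≤ ⟪w, i⟫ →
      D.L (h / M) / D.l (h / M) ≤ C₁ * (D.L h / D.l h) := by
  obtain ⟨A, hA, hF⟩ := exists_alignB (δ := δ) hC
  obtain ⟨ε, C', hε, hC', hS⟩ := exists_scale (δ := δ) hC hA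
  obtain ⟨ε₂, hε₂, hG⟩ := exists_frame_inner_lower (δ := δ) hC hA (c := ε / 16) (by positivity)
  set μ := 8 * ε₂ / ε with hμ
  have hμ0 : 0 < μ := by positivity
  refine ⟨24 * (2 * C) * C' / μ, by positivity, fun M cp Cp hM hcp hCp => ?_⟩
  obtain ⟨η₁, h₁, hη₁, hh₁, hh₁', hF⟩ := hF cp Cp M hcp hCp hM
  obtain ⟨η₂, h₂, hη₂, hh₂, hh₂', hS⟩ := hS (cp / 2) Cp (by positivity) hCp
  obtain ⟨η₃, hη₃, hT⟩ := exists_threshold (δ := δ) hC one_pos hM hη₂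
  set K := Cp / (cp / 2) with hK
  have hK0 : 0 ≤ K := by positivity
  set c₀ := cp / (32 * C') with hc₀
  have hc₀0 : 0 < c₀ := by positivity
  refine ⟨max (max η₁ η₃) (K * (32 * C') * 16 / ε * (2 * C * M)), min (min h₁ h₂) (c₀ ^ 2),
    lt_max_of_lt_left (lt_max_of_lt_left hη₁), by positivity,
    (min_le_left _ _).trans ((min_le_left _ _).trans hh₁'),
    fun D H B B' h hh hη R hR ih Fh i hi supp z₁ hz₁ z₂ hz₂ hn₁ hn₂ hp₁ hp₂ w hw hwn hwi => ?_⟩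
  have hhh₁ : h ≤ h₁ := hh.2.trans ((min_le_left _ _).trans (min_le_left _ _))
  have hhh₂ : h ≤ h₂ := hh.2.trans ((min_le_left _ _).trans (min_le_right _ _))
  have hh' : h ∈ Ioc (0 : ℝ) 1 := ⟨hh.1, hhh₁.trans hh₁'⟩
  have l0 := H.l_pos hh'
  have L0 := H.L_pos hh'
  have g1 := (mul_le_mul_of_nonneg_right ((le_max_left _ _).trans (le_max_left _ _)) l0.le).trans hη
  have g2 := (mul_le_mul_of_nonneg_right ((le_max_right _ _).trans (le_max_left _ _)) l0.le).trans hη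
  have g3 := (mul_le_mul_of_nonneg_right (le_max_right _ _) l0.le).trans hη
  obtain ⟨j, hj₁, hj₂, hF⟩ := hF D H B B' h ⟨hh.1, hhh₁⟩ g1 R hR ih Fh i hi supp z₁ hz₁ z₂ hz₂ hn₁ hn₂
    hp₁ hp₂
  have hM0 : 0 < M := by linarith
  set k := h / M with hkdef
  have hk0 : 0 < k := div_pos hh.1 hM0
  have hkh : k ≤ h := div_le_self hh.1.le hM
  have hhk : h = M * k := by rw [hkdef]; field_simp
  have hk' : k ∈ Ioc (0 : ℝ) 1 := ⟨hk0, hkh.trans hh'.2⟩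
  have F := hF h hh.1 le_rfl (le_mul_of_one_le_left hh.1.le hM)
  have F' := hF k hk0 hkh hhk.le
  have t := (hT D H B h hh' g2 h hh.1 le_rfl (le_mul_of_one_le_left hh.1.le hM)).1
  have t' := (hT D H B h hh' g2 k hk0 hkh hhk.le).1
  have hj₂' : cp / 2 ≤ ⟪z₂, -j⟫ := by rw [inner_neg_right]; linarith
  have hwi' : cp / 2 ≤ ⟪w, i⟫ := by linarith
  have S := (hS D H B B' h ⟨hh.1, hhh₂⟩ t i j F z₁ hz₁ hj₁ hn₁).2 supp w hw hwi' hwn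
  have S' := (hS D H B B' k ⟨hk0, hkh.trans hhh₂⟩ t' i j F' z₁ hz₁ hj₁ hn₁).2 supp w hw hwi' hwn
  have P := (hS D H B B' h ⟨hh.1, hhh₂⟩ t i (-j) F.neg_right z₂ hz₂ hj₂' hn₂).1
  have P' := (hS D H B B' k ⟨hk0, hkh.trans hhh₂⟩ t' i (-j) F'.neg_right z₂ hz₂ hj₂' hn₂).1
  have hl : 16 * C' * D.l h ≤ cp / 2 := by
    calc 16 * C' * D.l h ≤ 16 * C' * c₀ := by
          gcongr; exact H.l_le_of_le hh' hc₀0 (hh.2.trans (min_le_right _ _))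
      _ = _ := by rw [hc₀]; field_simp; norm_num
  have hlp : 0 < 16 * C' * D.l h := by positivity
  obtain ⟨q, hq, q1, q2⟩ := H.exists_smul_point hi hz₁ (by positivity) hj₁ hn₁ hlp hl
  obtain ⟨q', hq', q1', q2'⟩ := H.exists_smul_point hi hz₂ (by positivity) hj₂' hn₂ hlp hl
  rw [inner_neg_right] at q1'
  obtain ⟨n1, -, -⟩ := H.axes_comparison B hh' hk' hkh hhk.le
  have hLk := H.L_le_of_q_le hh' hk' (by positivity) (q_le_of_le B hk' hh' hkh)
  have L0' := H.L_pos hk'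
  have b2 : K * (32 * C' * D.l h) ≤ ε / 16 * D.L k := by
    have b3 := g3.trans n1
    have e1 : K * (32 * C') * 16 / ε * (2 * C * M) * D.l h =
      (2 * C * M) * (K * (32 * C') * 16 / ε * D.l h) := by ring
    rw [e1] at b3
    have b4 := le_of_mul_le_mul_left b3 (by positivity)
    calc K * (32 * C' * D.l h) = ε / 16 * (K * (32 * C') * 16 / ε * D.l h) := by field_simp
      _ ≤ _ := by gcongr
  have b1 : K * (32 * C' * D.l h) ≤ ε / 16 * D.L h := by
    have h2CM : 1 ≤ 2 * C * M := by
      calc (1 : ℝ) ≤ 1 * 1 := by norm_num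
        _ ≤ 2 * C * M := by gcongr; linarith
    have e1 : K * (32 * C') * 16 / ε * D.l h ≤ D.L h := by
      refine le_trans ?_ g3
      gcongr
      exact le_mul_of_one_le_right (by positivity) h2CM
    calc K * (32 * C' * D.l h) = ε / 16 * (K * (32 * C') * 16 / ε * D.l h) := by field_simp
      _ ≤ _ := by gcongr
  have hmain := S.growth_two_sided S' H P P' hq hq' q1 (by linarith) q2 q2' hK0 b1 b2 (A := 2 * C)
    (μ := μ) (by linarith) hLk (fun x y hxy hx => by
      have := hG D H B B' h hh' i j F x y hxy (Or.inl (hx.trans (le_abs_self _)))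
      have e : μ * (ε / 8 * D.L h * D.l h) = ε₂ * (D.L h * D.l h) := by rw [hμ]; field_simp
      rw [e, H.L_mul_l hh']
      exact this)
  apply div_le_of_mul_le l0 (H.l_pos hk')
  rw [div_mul_eq_mul_div, div_mul_eq_mul_div, le_div_iff₀ hμ0]
  exact hmain

end Core

namespace Core

/-- Eccentricity growth when both domains lie on one side of the axes. -/
lemma exists_growth_one_sided (hC : 1 ≤ C) : ∃ C₁ : ℝ, 0 < C₁ ∧ ∀ M cp Cp : ℝ, 1 ≤ M → 0 < cp →
    0 ≤ Cp → ∃ η₀ h₀ : ℝ, 0 < η₀ ∧ 0 < h₀ ∧ h₀ ≤ 1 ∧ ∀ D, Core δ D → Ctl C D → Ctl C D.swap →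
      D.L 1 ≤ Cp → ∀ h ∈ Ioc (0 : ℝ) h₀, η₀ * D.l h ≤ D.L h → ∀ R, IsRot R → ∀ ih,
      Aligned D 0 h ih (R ih) → ∀ i, ‖i‖ = 1 → (∀ y ∈ D.O₂, 0 ≤ ⟪y, i⟫) →
      (∀ x ∈ D.O₁, 0 ≤ ⟪x, R i⟫) → ∀ z₁ ∈ D.O₁, ∀ z₂ ∈ D.O₂, ‖z₁‖ ≤ Cp → ‖z₂‖ ≤ Cp →
      cp ≤ ⟪z₁, R ih⟫ → cp ≤ ⟪z₂, ih⟫ → ∀ p₁ ∈ D.O₁, ∀ p₂ ∈ D.O₂, ‖p₁‖ ≤ Cp → ‖p₂‖ ≤ Cp →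
      cp ≤ ⟪p₁, i⟫ → cp ≤ ⟪p₁, R i⟫ → cp ≤ ⟪p₂, i⟫ → cp ≤ ⟪p₂, R i⟫ →
      D.L (h / M) / D.l (h / M) ≤ C₁ * (D.L h / D.l h) := by
  obtain ⟨A, hA, hF⟩ := exists_alignA (δ := δ) hC
  obtain ⟨ε, C', hε, hC', hS⟩ := exists_scale (δ := δ) hC hA
  obtain ⟨ε₂, hε₂, hG⟩ := exists_frame_inner_lower (δ := δ) hC hA (c := ε / 16) (by positivity)
  set μ := 8 * ε₂ / ε with hμ
  have hμ0 : 0 < μ := by positivity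
  set κ := min (1 / 2) (μ / (18 * C')) with hκ
  have hκ0 : 0 < κ := by positivity
  have hκ1 : 2 * κ ≤ 1 := by linarith [min_le_left (1 / 2) (μ / (18 * C'))]
  have hκ2 : 9 * C' * (2 * κ) ≤ μ := by
    have := min_le_right (1 / 2) (μ / (18 * C'))
    rw [← hκ, le_div_iff₀ (by positivity)] at this
    linarith
  obtain ⟨N, hN, hstrict⟩ := exists_strict (δ := δ) hC hκ0
  set θ := 1 / (2 * C * N) with hθ
  have hθ0 : 0 < θ := by positivity
  refine ⟨1152 * (2 * C) ^ 2 * C' ^ 2 / (θ * μ ^ 2), by positivity, fun M cp Cp hM hcp hCp => ?_⟩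
  set P := max M N with hP
  have hP1 : 1 ≤ P := hM.trans (le_max_left _ _)
  set a₀ := ε / (32 * C * P) with ha₀
  have ha₀0 : 0 < a₀ := by positivity
  obtain ⟨N₂, hN₂, hstrict₂⟩ := exists_strict (δ := δ) hC (κ := a₀ / (2 * C')) (by positivity)
  obtain ⟨N₃, hN₃, hstrict₃⟩ := exists_strict (δ := δ) hC (κ := 4 * cp / (ε * (Cp + 1)))
    (by positivity)
  set Q := max P N₂ with hQ
  have hQ1 : 1 ≤ Q := hP1.trans (le_max_left _ _)
  obtain ⟨η₁, h₁, hη₁, hh₁, hh₁', hF⟩ := hF cp Cp Q hcp hCp hQ1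
  obtain ⟨η₂, h₂, hη₂, hh₂, hh₂', hS⟩ := hS cp Cp hcp hCp
  obtain ⟨η₃, hη₃, hT⟩ := exists_threshold (δ := δ) hC one_pos hQ1 hη₂
  set K := Cp / cp with hK
  have hK0 : 0 ≤ K := by positivity
  set Λ := 2 * C * Q with hΛ
  have hΛ0 : 0 < Λ := by positivity
  refine ⟨max (max η₁ η₃) (K * Λ / a₀ + K * Λ / ε + (3 * C' * Cp + 1) * Λ / (ε * cp) +
      (3 * C' * Cp + 1) / (a₀ * cp) + 4 * C ^ 2 * N), min (min h₁ h₂) (1 / N₃),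
    lt_max_of_lt_left (lt_max_of_lt_left hη₁), by positivity,
    (min_le_left _ _).trans ((min_le_left _ _).trans hh₁'),
    fun D H B B' hL1 h hh hη R hR ih Fh i hi supp₂ supp₁ z₁ hz₁ z₂ hz₂ hn₁ hn₂ hc₁ hc₂ p₁ hp₁ p₂ hp₂
      hm₁ hm₂ k₁ k₂ k₃ k₄ => ?_⟩
  have hhh₁ : h ≤ h₁ := hh.2.trans ((min_le_left _ _).trans (min_le_left _ _))
  have hhh₂ : h ≤ h₂ := hh.2.trans ((min_le_left _ _).trans (min_le_right _ _))
  have hhh₃ : h ≤ 1 / N₃ := hh.2.trans (min_le_right _ _)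
  have hh' : h ∈ Ioc (0 : ℝ) 1 := ⟨hh.1, hhh₁.trans hh₁'⟩
  have l0 := H.l_pos hh'
  have L0 := H.L_pos hh'
  have g1 := (mul_le_mul_of_nonneg_right ((le_max_left _ _).trans (le_max_left _ _)) l0.le).trans hη
  have g2 := (mul_le_mul_of_nonneg_right ((le_max_right _ _).trans (le_max_left _ _)) l0.le).trans hη
  have g3 := (mul_le_mul_of_nonneg_right (le_max_right _ _) l0.le).trans hη
  clear hη
  rw [add_mul, add_mul, add_mul, add_mul] at g3
  have w1 : 0 ≤ K * Λ / a₀ * D.l h := by positivity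
  have w2 : 0 ≤ K * Λ / ε * D.l h := by positivity
  have w3 : 0 ≤ (3 * C' * Cp + 1) * Λ / (ε * cp) * D.l h := by positivity
  have w4 : 0 ≤ (3 * C' * Cp + 1) / (a₀ * cp) * D.l h := by positivity
  have w5 : 0 ≤ 4 * C ^ 2 * N * D.l h := by positivity
  have t1 : K * Λ / a₀ * D.l h ≤ D.L h := by linarith
  have t2 : K * Λ / ε * D.l h ≤ D.L h := by linarith
  have t3 : (3 * C' * Cp + 1) * Λ / (ε * cp) * D.l h ≤ D.L h := by linarith
  have t4 : (3 * C' * Cp + 1) / (a₀ * cp) * D.l h ≤ D.L h := by linarith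
  have t5 : 4 * C ^ 2 * N * D.l h ≤ D.L h := by linarith
  clear g3 w1 w2 w3 w4 w5
  have frame : ∀ m, 1 ≤ m → m ≤ Q → h / m ∈ Ioc (0 : ℝ) 1 ∧ h / m ≤ h ∧ h ≤ m * (h / m) ∧
      Aligned D A (h / m) i (R i) ∧ Scale D ε C' K (D.L (h / m)) (D.l (h / m)) i (R i) ∧
      D.L h ≤ 2 * C * m * D.L (h / m) ∧ D.l (h / m) ≤ Λ * D.l h ∧
      D.L (h / m) ≤ 2 * C * D.L h ∧ D.L h ≤ Λ * D.L (h / m) := by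
    intro m hm hmQ
    have hm0 : 0 < m := by linarith
    have hk0 : 0 < h / m := div_pos hh.1 hm0
    have hkh : h / m ≤ h := div_le_self hh.1.le hm
    have hhk : h = m * (h / m) := by field_simp
    have hk' : h / m ∈ Ioc (0 : ℝ) 1 := ⟨hk0, hkh.trans hh'.2⟩
    have hhQ : h ≤ Q * (h / m) := hhk.le.trans (mul_le_mul_of_nonneg_right hmQ hk0.le)
    have F := hF D H B B' h ⟨hh.1, hhh₁⟩ g1 R hR ih Fh i hi supp₂ supp₁ z₁ hz₁ z₂ hz₂ hn₁ hn₂ hc₁ hc₂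
      (h / m) hk0 hkh hhQ
    have t := (hT D H B h hh' g2 (h / m) hk0 hkh hhQ).1
    have S := (hS D H B B' (h / m) ⟨hk0, hkh.trans hhh₂⟩ t i (R i) F p₁ hp₁ k₂ hm₁).2 supp₂ p₂ hp₂ k₃
      hm₂
    obtain ⟨n1, n2, -⟩ := H.axes_comparison B hh' hk' hkh hhk.le
    obtain ⟨n1', n2', -⟩ := H.axes_comparison B hh' hk' hkh hhQ
    exact ⟨hk', hkh, hhk.le, F, S, n1, n2',
      H.L_le_of_q_le hh' hk' (by positivity) (q_le_of_le B hk' hh' hkh), n1'⟩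
  obtain ⟨-, -, -, F, S, -⟩ := frame 1 le_rfl hQ1
  rw [div_one] at F S
  obtain ⟨hk', hkh, hhk, -, S', nM, lM, LM, -⟩ := frame M hM ((le_max_left _ _).trans (le_max_left _ _))
  obtain ⟨hkN, hNh, hhN, -, SN, nN, lN, LN, -⟩ := frame N hN ((le_max_right _ _).trans (le_max_left _ _))
  obtain ⟨hk₂, -, hhk₂, -, S₂, -, l₂, -, n₂⟩ := frame N₂ hN₂ (le_max_right _ _)
  clear frame
  have L0' := H.L_pos hk'
  have LN0 := H.L_pos hkN
  have L₂0 := H.L_pos hk₂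
  have hl' := H.l_pos hk'
  set α := a₀ * D.L h with hα
  have hα0 : 0 < α := by positivity
  have hαle : ∀ m X : ℝ, m ≤ P → 0 < X → D.L h ≤ 2 * C * m * X → α ≤ ε / 16 * X := by
    intro m X hm hX h1
    have h2 : D.L h ≤ 2 * C * P * X := h1.trans (by gcongr)
    calc α ≤ a₀ * (2 * C * P * X) := by rw [hα]; gcongr
      _ = _ := by rw [ha₀]; field_simp; norm_num
  have hKα : K * (Λ * D.l h) ≤ α := by
    calc K * (Λ * D.l h) = a₀ * (K * Λ / a₀ * D.l h) := by field_simp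
      _ ≤ _ := by rw [hα]; gcongr
  have h2C : 1 ≤ 2 * C * 1 := by linarith
  have hlΛ : D.l h ≤ Λ * D.l h := le_mul_of_one_le_left l0.le (by
    rw [hΛ]
    calc (1 : ℝ) ≤ 2 * C * 1 := h2C
      _ ≤ _ := by gcongr)
  have hKl : ∀ x, x ≤ Λ * D.l h → K * x ≤ α :=
    fun x hx => (mul_le_mul_of_nonneg_left hx hK0).trans hKα
  have hup : ∀ x : R2, ∀ y : R2, ‖x‖ ≤ Cp → ‖y‖ = 1 → ⟪x, y⟫ ≤ Cp := by
    intro x y hx hy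
    have := real_inner_le_norm x y
    rw [hy, mul_one] at this
    exact this.trans hx
  have hLc : ε / 8 * D.L h ≤ cp := by
    have hone : (1 : ℝ) ∈ Ioc (0 : ℝ) 1 := ⟨one_pos, le_rfl⟩
    have h1 := H.L_le_of_q_le hone hh' (by positivity) (hstrict₃ D H B B' 1 hone h hh' (by
      rw [le_div_iff₀ (by linarith)] at hhh₃; linarith))
    have h2 : D.L h ≤ 2 * (4 * cp / (ε * (Cp + 1))) * (Cp + 1) :=
      h1.trans (mul_le_mul_of_nonneg_left (by linarith) (by positivity))
    calc ε / 8 * D.L h ≤ ε / 8 * (2 * (4 * cp / (ε * (Cp + 1))) * (Cp + 1)) := by gcongr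
      _ = cp := by field_simp; norm_num
  have hg : ∀ s ∈ Ioo α (ε / 8 * D.L h), ∀ t ∈ Ioo α (ε / 8 * D.L h), InGraph D i (R i) s t := by
    intro s hs t ht
    refine S.inGraphA H supp₁ hp₁ hp₂ L₂0 S₂.pa ?_ (hKl _ l₂) (hKl _ hlΛ) ?_ hα0 ?_ ?_ (hLc.trans k₄)
      (hLc.trans k₁) hs.1.le ht.1.le hs.2.le ht.2.le
    · have := H.L_le_of_q_le hh' hk₂ (by positivity) (hstrict₂ D H B B' h hh' _ hk₂ (by
        rw [mul_div_cancel₀ _ (by linarith : N₂ ≠ 0)]))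
      calc C' * D.L (h / N₂) ≤ C' * (2 * (a₀ / (2 * C')) * D.L h) := by gcongr
        _ = α := by rw [hα]; field_simp
    · have h1 := t2.trans n₂
      have h2 : Λ * (K / ε * D.l h) ≤ Λ * D.L (h / N₂) := by
        calc Λ * (K / ε * D.l h) = K * Λ / ε * D.l h := by ring
          _ ≤ _ := h1
      calc K * D.l h = ε * (K / ε * D.l h) := by field_simp
        _ ≤ _ := mul_le_mul_of_nonneg_left (le_of_mul_le_mul_left h2 hΛ0) hε.le
    · have h1 := t3.trans n₂
      have h2 : Λ * ((3 * C' * Cp + 1) / (ε * cp) * D.l h) ≤ Λ * D.L (h / N₂) := by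
        calc _ = (3 * C' * Cp + 1) * Λ / (ε * cp) * D.l h := by ring
          _ ≤ _ := h1
      have h3 := le_of_mul_le_mul_left h2 hΛ0
      calc 3 * C' * D.l h * ⟪p₂, R i⟫ ≤ 3 * C' * D.l h * Cp := by
            gcongr; exact hup _ _ hm₂ S.norm_j
        _ < (3 * C' * Cp + 1) * D.l h := by linarith
        _ = ε * ((3 * C' * Cp + 1) / (ε * cp) * D.l h) * cp := by field_simp
        _ ≤ ε * D.L (h / N₂) * ⟪p₂, i⟫ := by gcongr
    · calc 3 * C' * D.l h * ⟪p₁, i⟫ ≤ 3 * C' * D.l h * Cp := by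
            gcongr; exact hup _ _ hm₁ hi
        _ < (3 * C' * Cp + 1) * D.l h := by linarith
        _ = a₀ * ((3 * C' * Cp + 1) / (a₀ * cp) * D.l h) * cp := by field_simp
        _ ≤ α * ⟪p₁, R i⟫ := by rw [hα]; gcongr
  have hlκ : D.l (h / N) ≤ 2 * κ * D.l h := by
    refine H.l_le_of_q_le hh' hkN hκ0.le (hstrict D H B B' h hh' _ hkN (by
      rw [mul_div_cancel₀ _ (by linarith : N ≠ 0)])) ?_
    refine (H.axes_comparison B hh' hkN hNh hhN).2.2.trans ?_
    rw [← mul_div_assoc, div_le_iff₀ L0]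
    linarith
  have hmain := S.growth_one_sided S' SN H supp₁ hα0 (hαle 1 _ hP1 L0 (by
      rw [mul_one]; exact le_mul_of_one_le_left L0.le (by linarith)))
    (hαle M _ (le_max_left _ _) L0' nM) (hαle N _ (le_max_right _ _) LN0 nN) (hKl _ hlΛ) (hKl _ lM)
    (hKl _ lN) hg (A := 2 * C) (μ := μ) (θ := θ) (by linarith) LM LN hθ0
    (by rw [hθ, div_mul_eq_mul_div, one_mul, div_le_iff₀ (by positivity)]; linarith) hμ0
    (hlκ.trans (mul_le_of_le_one_left l0.le hκ1))
    (by
      calc 9 * C' * D.l (h / N) ≤ 9 * C' * (2 * κ * D.l h) := by gcongr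
        _ = 9 * C' * (2 * κ) * D.l h := by ring
        _ ≤ _ := by gcongr)
    (fun x y hxy hx => by
      have := hG D H B B' h hh' i (R i) F x y hxy (Or.inl (hx.trans (le_abs_self _)))
      have e : μ * (ε / 8 * D.L h * D.l h) = ε₂ * (D.L h * D.l h) := by rw [hμ]; field_simp
      rw [e, H.L_mul_l hh']
      exact this)
  apply div_le_of_mul_le l0 hl'
  rw [div_mul_eq_mul_div, div_mul_eq_mul_div, le_div_iff₀ (by positivity)]
  exact hmain

/-- In the one-sided case large eccentricity forces both domains to be genuinely two-dimensional
with respect to the frame. -/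
lemma exists_pos_of_one_sided (hC : 1 ≤ C) : ∀ cp Cp : ℝ, 0 < cp → 0 ≤ Cp →
    ∃ η₀ h₀ : ℝ, 0 < η₀ ∧ 0 < h₀ ∧ h₀ ≤ 1 ∧ ∀ D, Core δ D → Ctl C D → Ctl C D.swap →
      ∀ h ∈ Ioc (0 : ℝ) h₀, η₀ * D.l h ≤ D.L h → ∀ R, IsRot R → ∀ ih,
      Aligned D 0 h ih (R ih) → ∀ i, ‖i‖ = 1 → (∀ y ∈ D.O₂, 0 ≤ ⟪y, i⟫) →
      (∀ x ∈ D.O₁, 0 ≤ ⟪x, R i⟫) → ∀ z₁ ∈ D.O₁, ∀ z₂ ∈ D.O₂, ‖z₁‖ ≤ Cp → ‖z₂‖ ≤ Cp →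
      cp ≤ ⟪z₁, R ih⟫ → cp ≤ ⟪z₂, ih⟫ → cp ≤ ⟪z₁, R i⟫ → cp ≤ ⟪z₂, i⟫ →
      (∃ p ∈ D.O₁, 0 < ⟪p, i⟫) ∧ ∃ p ∈ D.O₂, 0 < ⟪p, R i⟫ := by
  intro cp Cp hcp hCp
  obtain ⟨A, hA, hF⟩ := exists_alignA (δ := δ) hC
  obtain ⟨ε, C', hε, hC', hS⟩ := exists_scale (δ := δ) hC hA
  obtain ⟨η₁, h₁, hη₁, hh₁, hh₁', hF⟩ := hF cp Cp 1 hcp hCp le_rfl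
  obtain ⟨η₂, h₂, hη₂, hh₂, hh₂', hS⟩ := hS cp Cp hcp hCp
  refine ⟨max η₁ η₂, min h₁ h₂, lt_max_of_lt_left hη₁, by positivity, (min_le_left _ _).trans hh₁',
    fun D H B B' h hh hη R hR ih Fh i hi supp₂ supp₁ z₁ hz₁ z₂ hz₂ hn₁ hn₂ hc₁ hc₂ k₁ k₂ => ?_⟩
  have hhh₁ : h ≤ h₁ := hh.2.trans (min_le_left _ _)
  have hhh₂ : h ≤ h₂ := hh.2.trans (min_le_right _ _)
  have hh' : h ∈ Ioc (0 : ℝ) 1 := ⟨hh.1, hhh₁.trans hh₁'⟩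
  have l0 := H.l_pos hh'
  have L0 := H.L_pos hh'
  have g1 := (mul_le_mul_of_nonneg_right (le_max_left _ _) l0.le).trans hη
  have g2 := (mul_le_mul_of_nonneg_right (le_max_right _ _) l0.le).trans hη
  have F := hF D H B B' h ⟨hh.1, hhh₁⟩ g1 R hR ih Fh i hi supp₂ supp₁ z₁ hz₁ z₂ hz₂ hn₁ hn₂ hc₁ hc₂
      h hh.1 le_rfl (by rw [one_mul])
  have S := (hS D H B B' h ⟨hh.1, hhh₂⟩ g2 i (R i) F z₁ hz₁ k₁ hn₁).2 supp₂ z₂ hz₂ k₂ hn₂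
  obtain ⟨-, -, y, hy, -, -, -, -, -, h1, -⟩ := S.pa
  obtain ⟨-, -, x, hx, -, -, -, -, -, h2, -⟩ := S.pb
  have := mul_pos hε L0
  exact ⟨⟨x, hx, lt_of_lt_of_le this h2⟩, ⟨y, hy, lt_of_lt_of_le this h1⟩⟩

end Core

lemma exists_isRot : ∃ R : R2 →ₗ[ℝ] R2, IsRot R := by
  refine ⟨{ toFun := fun x => !₂[-x 1, x 0], map_add' := fun x y => ?_, map_smul' := fun c x => ?_ },
    ⟨fun x => ?_, fun x y => ?_⟩⟩
  · ext k; fin_cases k <;> simp; ring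
  · ext k; fin_cases k <;> simp
  · ext k; fin_cases k <;> simp
  · simp [PiLp.inner_apply, Fin.sum_univ_two]; ring

lemma exists_forall_add_mem {O : Set R2} (hO : IsOpen O) {x : R2} (hx : x ∈ O) :
    ∃ ρ : ℝ, 0 < ρ ∧ ∀ n : R2, ‖n‖ ≤ ρ → x + n ∈ O := by
  obtain ⟨ρ, hρ, hb⟩ := Metric.nhds_basis_closedBall.mem_iff.1 (hO.mem_nhds hx)
  exact ⟨ρ, hρ, fun n hn => hb (by simpa using hn)⟩

lemma nonneg_of_forall_add_mul_pos {a b : ℝ} (h : ∀ t : ℝ, 0 < t → t ≤ 1 → 0 < a + t * b) :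
    0 ≤ a := by
  by_contra! ha
  have hb : a < b := by have := h 1 one_pos le_rfl; linarith
  have hb0 : 0 < b := by have := h 1 one_pos le_rfl; linarith
  have h1 := h (min 1 (-a / b)) (lt_min one_pos (div_pos (by linarith) hb0)) (min_le_left _ _)
  have h2 : min 1 (-a / b) * b ≤ -a / b * b := mul_le_mul_of_nonneg_right (min_le_right _ _) hb0.le
  rw [div_mul_cancel₀ _ hb0.ne'] at h2
  linarith

namespace Core

/-- Unit normal of a supporting line at the origin. -/
lemma exists_unit_normal (H : Core δ D) : ∃ i : R2, ‖i‖ = 1 ∧ ∀ x ∈ D.O₁, 0 ≤ ⟪x, i⟫ := by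
  obtain ⟨n, hn⟩ := exists_inner_lt_of_notMem H.half.convex H.half.isOpen H.half.zero_notMem
  obtain ⟨a, ha⟩ := H.half.nonempty
  have hn0 : n ≠ 0 := by
    rintro rfl
    simpa using hn a ha
  have hpos := norm_pos_iff.2 hn0
  refine ⟨‖n‖⁻¹ • n, by rw [norm_smul, norm_inv, norm_norm, inv_mul_cancel₀ hpos.ne'],
    fun x hx => ?_⟩
  have h1 := hn x hx
  rw [inner_zero_right] at h1
  rw [real_inner_smul_right, real_inner_comm]
  positivity

/-- Either the two domains admit compatible supporting lines, or they have compatible points. -/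
lemma exists_normal_or_exists_points (H : Core δ D) {R : R2 →ₗ[ℝ] R2} (hR : IsRot R) :
    (∃ i, ‖i‖ = 1 ∧ (∀ y ∈ D.O₂, 0 ≤ ⟪y, i⟫) ∧ ∀ x ∈ D.O₁, 0 ≤ ⟪x, R i⟫) ∨
      ∃ d ∈ D.O₁, ∃ c ∈ D.O₂, d = -R c := by
  have hO₂ : Convex ℝ (R '' D.O₂) := Convex.linear_image H.half'.convex R
  by_cases h0 : (0 : R2) ∈ D.O₁ + R '' D.O₂
  · obtain ⟨d, hd, -, ⟨c, hc, rfl⟩, h⟩ := Set.mem_add.1 h0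
    exact Or.inr ⟨d, hd, c, hc, eq_neg_of_add_eq_zero_left h⟩
  · left
    obtain ⟨n, hn⟩ := exists_inner_lt_of_notMem (H.half.convex.add hO₂) H.half.isOpen.add_right h0
    have key : ∀ d ∈ D.O₁, ∀ c ∈ D.O₂, 0 < ⟪d, n⟫ + ⟪R c, n⟫ := fun d hd c hc => by
      have := hn _ (Set.add_mem_add hd (Set.mem_image_of_mem R hc))
      rwa [inner_zero_right, inner_add_right, real_inner_comm, real_inner_comm (R c)] at this
    obtain ⟨a, ha⟩ := H.half.nonempty
    obtain ⟨b, hb⟩ := H.half'.nonempty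
    have hn0 : n ≠ 0 := by
      rintro rfl
      simpa using key a ha b hb
    have hpos := norm_pos_iff.2 hn0
    have hRi : R (-(‖n‖⁻¹ • R n)) = ‖n‖⁻¹ • n := by
      rw [map_neg, map_smul, hR.sq, smul_neg, neg_neg]
    refine ⟨-(‖n‖⁻¹ • R n), ?_, fun y hy => ?_, fun x hx => ?_⟩
    · rw [norm_neg, norm_smul, hR.norm, norm_inv, norm_norm, inv_mul_cancel₀ hpos.ne']
    · rw [← hR.inner, hRi, real_inner_smul_right]
      have : 0 ≤ ⟪R y, n⟫ := nonneg_of_forall_add_mul_pos (b := ⟪a, n⟫) fun t ht ht1 => by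
        have := key _ (H.smul_mem ha ht ht1) y hy
        rw [real_inner_smul_left] at this
        linarith
      positivity
    · rw [hRi, real_inner_smul_right]
      have : 0 ≤ ⟪x, n⟫ := nonneg_of_forall_add_mul_pos (b := ⟪R b, n⟫) fun t ht ht1 => by
        have := key x hx _ (H.swap.smul_mem hb ht ht1)
        rwa [map_smul, real_inner_smul_left] at this
      positivity

/-- Eccentricity growth for a fixed orientation of the axes. -/
lemma exists_growth (hC : 1 ≤ C) : ∃ C₁ : ℝ, 0 < C₁ ∧ ∀ M : ℝ, 1 ≤ M → ∀ D, Core δ D → Ctl C D →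
    Ctl C D.swap → ∀ a₁ ∈ D.O₁, ∀ a₂ ∈ D.O₂, ∀ R, IsRot R → ∃ η₀ h₀ : ℝ, 0 < η₀ ∧ 0 < h₀ ∧ h₀ ≤ 1 ∧
      ∀ h ∈ Ioc (0 : ℝ) h₀, η₀ * D.l h ≤ D.L h → ∀ ih, Aligned D 0 h ih (R ih) →
      0 ≤ ⟪a₁, R ih⟫ → 0 ≤ ⟪a₂, ih⟫ → D.L (h / M) / D.l (h / M) ≤ C₁ * (D.L h / D.l h) := by
  obtain ⟨CB, hCB, GB⟩ := exists_growth_two_sided (δ := δ) hC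
  obtain ⟨CA, hCA, GA⟩ := exists_growth_one_sided (δ := δ) hC
  refine ⟨max CA CB, lt_max_of_lt_left hCA, fun M hM D H B B' a₁ ha₁ a₂ ha₂ R hR => ?_⟩
  have hpos : ∀ h ∈ Ioc (0 : ℝ) 1, 0 ≤ D.L h / D.l h :=
    fun h hh => div_nonneg (H.L_pos hh).le (H.l_pos hh).le
  obtain ⟨ρ₁, hρ₁, hb₁⟩ := exists_forall_add_mem H.half.isOpen ha₁
  obtain ⟨ρ₂, hρ₂, hb₂⟩ := exists_forall_add_mem H.half'.isOpen ha₂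
  have hself : ∀ x : R2, ‖x‖ = 1 → ⟪x, x⟫ = 1 := fun x hx => by
    rw [real_inner_self_eq_norm_sq, hx, one_pow]
  have hadd : ∀ a x : R2, ∀ r : ℝ, 0 ≤ r → ‖x‖ = 1 → ‖a + r • x‖ ≤ ‖a‖ + r := fun a x r hr hx =>
    (norm_add_le _ _).trans (by rw [norm_smul, hx, mul_one, Real.norm_of_nonneg hr])
  have hinn : ∀ a x : R2, ∀ r : ℝ, ‖x‖ = 1 → ⟪a + r • x, x⟫ = ⟪a, x⟫ + r := fun a x r hx => by
    rw [inner_add_left, real_inner_smul_left, hself x hx, mul_one]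
  rcases H.exists_normal_or_exists_points hR with ⟨i, hi, supp₂, supp₁⟩ | ⟨d, hd, c, hc, hdc⟩
  · by_cases hp : (∃ p ∈ D.O₁, 0 < ⟪p, i⟫) ∧ ∃ p ∈ D.O₂, 0 < ⟪p, R i⟫
    · obtain ⟨⟨p₁, hp₁, k₁⟩, ⟨p₂, hp₂, k₄⟩⟩ := hp
      have k₂ := inner_pos_of_isOpen H.half.isOpen (by rw [hR.norm, hi]) supp₁ hp₁
      have k₃ := inner_pos_of_isOpen H.half'.isOpen hi supp₂ hp₂
      set cp := min (min ρ₁ ρ₂) (min (min ⟪p₁, i⟫ ⟪p₁, R i⟫) (min ⟪p₂, i⟫ ⟪p₂, R i⟫)) with hcp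
      have c1 : cp ≤ ρ₁ := (min_le_left _ _).trans (min_le_left _ _)
      have c2 : cp ≤ ρ₂ := (min_le_left _ _).trans (min_le_right _ _)
      have c3 : cp ≤ ⟪p₁, i⟫ := (min_le_right _ _).trans ((min_le_left _ _).trans (min_le_left _ _))
      have c4 : cp ≤ ⟪p₁, R i⟫ := (min_le_right _ _).trans ((min_le_left _ _).trans (min_le_right _ _))
      have c5 : cp ≤ ⟪p₂, i⟫ := (min_le_right _ _).trans ((min_le_right _ _).trans (min_le_left _ _))
      have c6 : cp ≤ ⟪p₂, R i⟫ :=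
        (min_le_right _ _).trans ((min_le_right _ _).trans (min_le_right _ _))
      have hcp0 : 0 < cp := lt_min (lt_min hρ₁ hρ₂) (lt_min (lt_min k₁ k₂) (lt_min k₃ k₄))
      clear_value cp
      have hL1 : 0 < D.L 1 := H.L_pos ⟨one_pos, le_rfl⟩
      have n1 := norm_nonneg a₁
      have n2 := norm_nonneg a₂
      have n3 := norm_nonneg p₁
      have n4 := norm_nonneg p₂
      obtain ⟨η₀, h₀, hη₀, hh₀, hh₀', G⟩ := GA M cp
        (‖a₁‖ + ρ₁ + (‖a₂‖ + ρ₂) + ‖p₁‖ + ‖p₂‖ + D.L 1) hM hcp0 (by positivity)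
      refine ⟨η₀, h₀, hη₀, hh₀, hh₀', fun h hh hη ih F q₁ q₂ => ?_⟩
      refine (G D H B B' (by linarith) h hh hη R hR ih F i hi supp₂ supp₁ (a₁ + ρ₁ • R ih)
        (hb₁ _ ?_) (a₂ + ρ₂ • ih) (hb₂ _ ?_) ?_ ?_ ?_ ?_ p₁ hp₁ p₂ hp₂ (by linarith) (by linarith)
        c3 c4 c5 c6).trans (mul_le_mul_of_nonneg_right (le_max_left _ _)
          (hpos h ⟨hh.1, hh.2.trans hh₀'⟩))
      · rw [norm_smul, F.norm_j, mul_one, Real.norm_of_nonneg hρ₁.le]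
      · rw [norm_smul, F.norm_i, mul_one, Real.norm_of_nonneg hρ₂.le]
      · have := hadd a₁ _ _ hρ₁.le F.norm_j; linarith
      · have := hadd a₂ _ _ hρ₂.le F.norm_i; linarith
      · rw [hinn _ _ _ F.norm_j]; linarith
      · rw [hinn _ _ _ F.norm_i]; linarith
    · set ρ := min ρ₁ ρ₂ / 2 with hρ
      have hρ0 : 0 < ρ := by positivity
      have r1 : 2 * ρ ≤ ρ₁ := by linarith [min_le_left ρ₁ ρ₂]
      have r2 : 2 * ρ ≤ ρ₂ := by linarith [min_le_right ρ₁ ρ₂]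
      clear_value ρ
      obtain ⟨η₀, h₀, hη₀, hh₀, hh₀', G⟩ := exists_pos_of_one_sided (δ := δ) hC ρ
        (‖a₁‖ + ‖a₂‖ + ρ) hρ0 (by positivity)
      refine ⟨η₀, h₀, hη₀, hh₀, hh₀', fun h hh hη ih F q₁ q₂ => absurd ?_ hp⟩
      have n1 := norm_nonneg a₁
      have n2 := norm_nonneg a₂
      have hRi : ‖R i‖ = 1 := by rw [hR.norm, hi]
      refine G D H B B' h hh hη R hR ih F i hi supp₂ supp₁ (a₁ + ρ • R ih) (hb₁ _ ?_)
        (a₂ + ρ • ih) (hb₂ _ ?_) ?_ ?_ ?_ ?_ ?_ ?_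
      · rw [norm_smul, F.norm_j, mul_one, Real.norm_of_nonneg hρ0.le]; linarith
      · rw [norm_smul, F.norm_i, mul_one, Real.norm_of_nonneg hρ0.le]; linarith
      · have := hadd a₁ _ _ hρ0.le F.norm_j; linarith
      · have := hadd a₂ _ _ hρ0.le F.norm_i; linarith
      · rw [hinn _ _ _ F.norm_j]; linarith
      · rw [hinn _ _ _ F.norm_i]; linarith
      · have := supp₁ _ (hb₁ (ρ • R ih + (-ρ) • R i) ((norm_add_le _ _).trans (by
          rw [norm_smul, norm_smul, hRi, F.norm_j, mul_one, norm_neg, Real.norm_of_nonneg hρ0.le]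
          linarith)))
        rw [← add_assoc, hinn _ _ _ hRi] at this
        linarith
      · have := supp₂ _ (hb₂ (ρ • ih + (-ρ) • i) ((norm_add_le _ _).trans (by
          rw [norm_smul, norm_smul, hi, F.norm_i, mul_one, norm_neg, Real.norm_of_nonneg hρ0.le]
          linarith)))
        rw [← add_assoc, hinn _ _ _ hi] at this
        linarith
  · obtain ⟨ρ₃, hρ₃, hb₃⟩ := exists_forall_add_mem H.half.isOpen hd
    obtain ⟨ρ₄, hρ₄, hb₄⟩ := exists_forall_add_mem H.half'.isOpen hc
    obtain ⟨n₁, hn₁, supp₁⟩ := H.exists_unit_normal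
    obtain ⟨n₂, hn₂, supp₂⟩ := H.swap.exists_unit_normal
    have k₁ := inner_pos_of_isOpen H.half.isOpen hn₁ supp₁ ha₁
    have k₂ := inner_pos_of_isOpen H.half'.isOpen hn₂ supp₂ ha₂
    set cp := min (min (min ρ₁ ρ₂) (min ρ₃ ρ₄)) (min ⟪a₁, n₁⟫ ⟪a₂, n₂⟫) with hcp
    have c1 : cp ≤ ρ₁ := (min_le_left _ _).trans ((min_le_left _ _).trans (min_le_left _ _))
    have c2 : cp ≤ ρ₂ := (min_le_left _ _).trans ((min_le_left _ _).trans (min_le_right _ _))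
    have c3 : cp ≤ ρ₃ := (min_le_left _ _).trans ((min_le_right _ _).trans (min_le_left _ _))
    have c4 : cp ≤ ρ₄ := (min_le_left _ _).trans ((min_le_right _ _).trans (min_le_right _ _))
    have c5 : cp ≤ ⟪a₁, n₁⟫ := (min_le_right _ _).trans (min_le_left _ _)
    have c6 : cp ≤ ⟪a₂, n₂⟫ := (min_le_right _ _).trans (min_le_right _ _)
    have hcp0 : 0 < cp := lt_min (lt_min (lt_min hρ₁ hρ₂) (lt_min hρ₃ hρ₄)) (lt_min k₁ k₂)
    clear_value cp
    have n1 := norm_nonneg a₁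
    have n2 := norm_nonneg a₂
    have n3 := norm_nonneg d
    have n4 := norm_nonneg c
    obtain ⟨η₀, h₀, hη₀, hh₀, hh₀', G⟩ := GB M cp (‖a₁‖ + ‖a₂‖ + ‖d‖ + ‖c‖ + cp) hM hcp0
      (by positivity)
    refine ⟨η₀, h₀, hη₀, hh₀, hh₀', fun h hh hη ih F q₁ q₂ => ?_⟩
    have hh' : h ∈ Ioc (0 : ℝ) 1 := ⟨hh.1, hh.2.trans hh₀'⟩
    have hle := mul_le_mul_of_nonneg_right (le_max_right CA CB) (hpos h hh')
    have hsm : ∀ x : R2, ‖x‖ = 1 → ‖cp • x‖ = cp := fun x hx => by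
      rw [norm_smul, hx, mul_one, Real.norm_of_nonneg hcp0.le]
    have hneg : ∀ a x : R2, ‖x‖ = 1 → ‖a + -(cp • x)‖ ≤ ‖a‖ + cp := fun a x hx => by
      have := hadd a (-x) cp hcp0.le (by rw [norm_neg, hx])
      rwa [smul_neg] at this
    have hinneg : ∀ a x : R2, ‖x‖ = 1 → ⟪a + -(cp • x), x⟫ = ⟪a, x⟫ - cp := fun a x hx => by
      rw [← neg_smul, hinn _ _ _ hx, sub_eq_add_neg]
    have hdc' : ⟪d, R ih⟫ = -⟪c, ih⟫ := by rw [hdc, inner_neg_left, hR.inner]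
    rcases le_total ⟪d, R ih⟫ 0 with hs | hs
    · refine (G D H B B' h hh hη R hR ih F n₂ hn₂ supp₂ (a₁ + cp • R ih)
        (hb₁ _ (by rw [hsm _ F.norm_j]; exact c1)) (d + -(cp • R ih))
        (hb₃ _ (by rw [norm_neg, hsm _ F.norm_j]; exact c3)) ?_ ?_ ?_ ?_ a₂ ha₂ (by linarith)
        c6).trans hle
      · have := hadd a₁ _ _ hcp0.le F.norm_j; linarith
      · have := hneg d _ F.norm_j; linarith
      · rw [hinn _ _ _ F.norm_j]; linarith
      · rw [hinneg _ _ F.norm_j]; linarith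
    · have e : (-R) (R ih) = ih := by rw [LinearMap.neg_apply, hR.sq, neg_neg]
      have F' : Aligned D.swap 0 h (R ih) ((-R) (R ih)) := by rw [e]; exact F.swap H hh'
      refine (G D.swap H.swap B' B h hh hη (-R) hR.neg (R ih) F' n₁ hn₁ supp₁ (a₂ + cp • ih)
        (hb₂ _ (by rw [hsm _ F.norm_i]; exact c2)) (c + -(cp • ih))
        (hb₄ _ (by rw [norm_neg, hsm _ F.norm_i]; exact c4)) ?_ ?_ ?_ ?_ a₁ ha₁ (by linarith)
        c5).trans hle
      · have := hadd a₂ _ _ hcp0.le F.norm_i; linarith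
      · have := hneg c _ F.norm_i; linarith
      · rw [e, hinn _ _ _ F.norm_i]; linarith
      · rw [e, hinneg _ _ F.norm_i]; linarith

/-- The eccentricity growth dichotomy. -/
theorem eccentricity_dichotomy (hC : 1 ≤ C) : ∃ C₁ : ℝ, 0 < C₁ ∧ ∀ M : ℝ, 1 ≤ M → ∀ D, Core δ D →
    Ctl C D → Ctl C D.swap → ∃ η₀ h₀ : ℝ, 0 < h₀ ∧ h₀ ≤ 1 ∧ ∀ h ∈ Ioc (0 : ℝ) h₀,
      η₀ * D.l h ≤ D.L h → D.L (h / M) / D.l (h / M) ≤ C₁ * (D.L h / D.l h) := by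
  obtain ⟨C₁, hC₁, G⟩ := exists_growth (δ := δ) hC
  refine ⟨C₁, hC₁, fun M hM D H B B' => ?_⟩
  obtain ⟨R, hR⟩ := exists_isRot
  obtain ⟨a₁, ha₁⟩ := H.half.nonempty
  obtain ⟨a₂, ha₂⟩ := H.half'.nonempty
  obtain ⟨η₁, h₁, hη₁, hh₁, hh₁', G₁⟩ := G M hM D H B B' a₁ ha₁ a₂ ha₂ R hR
  obtain ⟨η₂, h₂, hη₂, hh₂, hh₂', G₂⟩ := G M hM D H B B' a₁ ha₁ a₂ ha₂ (-R) hR.neg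
  refine ⟨max η₁ η₂, min h₁ h₂, lt_min hh₁ hh₂, (min_le_left _ _).trans hh₁', fun h hh hη => ?_⟩
  have hh' : h ∈ Ioc (0 : ℝ) 1 := ⟨hh.1, hh.2.trans ((min_le_left _ _).trans hh₁')⟩
  have l0 := H.l_pos hh'
  have g1 := (mul_le_mul_of_nonneg_right (le_max_left _ _) l0.le).trans hη
  have g2 := (mul_le_mul_of_nonneg_right (le_max_right _ _) l0.le).trans hη
  obtain ⟨he, -⟩ := H.axes h hh'
  obtain ⟨ih, hih, hei, hai⟩ : ∃ ih : R2, ‖ih‖ = 1 ∧ ⟪D.e h, R ih⟫ = 0 ∧ 0 ≤ ⟪a₂, ih⟫ := by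
    rcases le_total 0 ⟪a₂, D.e h⟫ with hs | hs
    · exact ⟨D.e h, he, hR.inner_self _, hs⟩
    · refine ⟨-D.e h, by rw [norm_neg, he], ?_, ?_⟩
      · rw [map_neg, inner_neg_right, hR.inner_self, neg_zero]
      · rw [inner_neg_right]; linarith
  have F : Aligned D 0 h ih (R ih) := ⟨hih, by rw [hR.norm, hih], hR.inner_self _, by
    rw [hei, abs_zero, zero_mul]⟩
  rcases le_total 0 ⟪a₁, R ih⟫ with hs | hs
  · exact G₁ h ⟨hh.1, hh.2.trans (min_le_left _ _)⟩ g1 ih F hs hai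
  · refine G₂ h ⟨hh.1, hh.2.trans (min_le_right _ _)⟩ g2 ih F.neg_right ?_ hai
    rw [LinearMap.neg_apply, inner_neg_right]
    linarith

end Core

end

/-- eccentricity growth dichotomy: for `(u, v) ∈ S(δ̄)` there is
`C₁ = C₁(δ̄)` such that for every sufficiently large `M` there are `η₀` (large) and
`h₀ > 0` (small), depending on `M` and the pair `(u, v)`, with: for every `h < h₀`,
either `η_u(h) ≤ η₀` or `η_u(h/M) ≤ C₁ · η_u(h)`. -/
theorem stmt_14 :
    ∀ δb : ℝ, 0 < δb → ∃ C₁ : ℝ, 0 < C₁ ∧ ∃ M₀ : ℝ, 1 ≤ M₀ ∧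
      ∀ M : ℝ, M₀ ≤ M →
        ∀ (u v : R2 → ℝ) (Ω₁ Ω₂ : Set R2) (L l : ℝ → ℝ) (e f : ℝ → R2),
          InSFamily δb u v Ω₁ Ω₂ L l e f →
          ∃ η₀ h₀ : ℝ, 0 < h₀ ∧ h₀ ≤ 1 ∧
            ∀ h : ℝ, 0 < h → h < h₀ →
              L h / l h ≤ η₀ ∨ L (h / M) / l (h / M) ≤ C₁ * (L h / l h) := by
  intro δb hδb
  have hδ : 0 < min δb 1 := lt_min hδb one_pos
  obtain ⟨C, hC, hctl⟩ := exists_ctl hδ (min_le_right δb 1)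
  obtain ⟨C₁, hC₁, G⟩ := Core.eccentricity_dichotomy (δ := min δb 1) hC
  refine ⟨C₁, hC₁, 1, le_rfl, fun M hM u v Ω₁ Ω₂ L l e f hS => ?_⟩
  have H := hS.core hδb
  obtain ⟨B, B'⟩ := hctl _ H
  obtain ⟨η₀, h₀, hh₀, hh₀', G⟩ := G M hM _ H B B'
  refine ⟨η₀, h₀, hh₀, hh₀', fun h h0 hlt => or_iff_not_imp_left.2 fun hη => ?_⟩
  have hl : 0 < l h := H.l_pos ⟨h0, hlt.le.trans hh₀'⟩
  exact G h ⟨h0, hlt.le⟩ ((le_div_iff₀ hl).1 (not_le.1 hη).le)
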